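/- Let O be a W-orbit in ℝ^r and suppose q^{1/2}, k_0, u_0, k, k_r, u_r ∈ F^× and t ∈ T_O are such that the map O → (F^×)^r, y ↦ (γ_1^O(y), …, γ_r^O(y)), is injective. Then for every y ∈ O there exists a unique E_y^O ∈ F[O] such that: (1) E_y^O − x^y ∈ span_F{x^{y'} : y' < y} (that is, E_y^O is a monic quasi-polynomial of degree y), and (2) E_y^O is a joint eigenfunction of the commuting operators Y_1^O, …, Y_r^O. Moreover, Y_i^O(E_y^O) = γ_i^O(y)·E_y^O for 1 ≤ i ≤ r. -/

import Mathlib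

open scoped Classical

noncomputable section

namespace QP

/-! ### The space of quasi-polynomials -/

/-- Euclidean space `ℝ^r`. -/
abbrev E (r : ℕ) := Fin r → ℝ

variable (F : Type*) [Field F] [CharZero F] (r : ℕ)

/-- The algebra of quasi-polynomials `F[ℝ^r]`: the group algebra of `(ℝ^r,+)` over `F`. -/
abbrev QA := AddMonoidAlgebra F (E r)

/-- The quasi-monomial `x^y`. -/
def X (y : E r) : QA F r := AddMonoidAlgebra.single y 1

/-- The `i`-th coordinate of a vector (`1`-based). -/
def cd (y : E r) (i : ℕ) : ℝ := ∑ m : Fin r, if (m : ℕ) + 1 = i then y m else 0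

/-- The standard basis vector `ε_i` (`1`-based). -/
def epsV (i : ℕ) : E r := fun m => if (m : ℕ) + 1 = i then 1 else 0

/-- The standard basis vector (`0`-based). -/
def eV (m : Fin r) : E r := fun n => if n = m then 1 else 0

/-- The Euclidean inner product on `ℝ^r`. -/
def ip (v y : E r) : ℝ := ∑ m : Fin r, v m * y m

/-- An integral vector regarded as an element of `ℝ^r`. -/
def zc (lam : Fin r → ℤ) : E r := fun m => (lam m : ℝ)

/-- The simple reflections of the hyperoctahedral group `W₀ = S_r ⋉ (±1)^r` (`1`-based):
for `1 ≤ i < r`, `sW i` interchanges the `i`-th and `(i+1)`-st coordinates, and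
`sW r` negates the last coordinate. -/
def sW (i : ℕ) (y : E r) : E r := fun m =>
  if i = r then (if (m : ℕ) + 1 = r then -y m else y m)
  else if (m : ℕ) + 1 = i then cd r y (i + 1)
  else if (m : ℕ) = i then cd r y i
  else y m

/-- `s_{ε₁} = s₁⋯s_{r-1} s_r s_{r-1}⋯s₁`: negation of the first coordinate. -/
def sEps1 (y : E r) : E r := fun m => if (m : ℕ) = 0 then -y m else y m

/-- The affine simple reflection `s₀ = τ(ε₁) s_{ε₁} : y ↦ (1 - y₁, y₂, …, y_r)`, together
with `genF j = sW j` for `1 ≤ j ≤ r`: the Coxeter generators of the affine Weyl group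
`W = W₀ ⋉ ℤ^r`. -/
def genF (j : ℕ) (y : E r) : E r :=
  if j = 0 then fun m => if (m : ℕ) = 0 then 1 - y m else y m
  else sW r j y

/-- The action of the word `s_{j₁} ⋯ s_{j_ℓ}` on `ℝ^r`. -/
def wordAct (l : List ℕ) (y : E r) : E r := l.foldr (genF r) y

/-- The closure of the fundamental alcove
`C₊ = {y : 0 < y_r < ⋯ < y₁ < 1/2}`. -/
def CplusCl : Set (E r) :=
  {y | (∀ i j : Fin r, i ≤ j → y j ≤ y i) ∧ ∀ m : Fin r, 0 ≤ y m ∧ y m ≤ 1 / 2}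

/-- The `W`-orbit of a point of `ℝ^r`. -/
def orbit (y : E r) : Set (E r) :=
  {z | ∃ l : List ℕ, (∀ a ∈ l, a ≤ r) ∧ wordAct r l y = z}

/-- `O` is a `W`-orbit in `ℝ^r`. -/
def IsOrbit (O : Set (E r)) : Prop := ∃ y, O = orbit r y

/-- `c^𝒪`: the unique point of the orbit `O` lying in the closed fundamental alcove. -/
def cpt (O : Set (E r)) : E r :=
  if h : ∃ c, c ∈ O ∧ c ∈ CplusCl r then h.choose else 0

/-- The length of an element of the affine Weyl group `W` (as a map on `ℝ^r`). -/
def wlen (g : E r → E r) : ℕ :=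
  sInf {n | ∃ l : List ℕ, (∀ a ∈ l, a ≤ r) ∧ l.length = n ∧ (fun y => wordAct r l y) = g}

/-- A choice of a shortest word `l` whose inverse maps `y` into the closed alcove;
the corresponding element of `W` is `g_y`. -/
def gW (y : E r) : List ℕ :=
  if h : ∃ l : List ℕ, (∀ a ∈ l, a ≤ r) ∧ wordAct r l.reverse y ∈ CplusCl r ∧
      ∀ l' : List ℕ, (∀ a ∈ l', a ≤ r) → wordAct r l'.reverse y ∈ CplusCl r →
        l.length ≤ l'.length
  then h.choose else []

/-- `g_y`, the unique shortest element of `W` with `g_y⁻¹ y` in the closed alcove. -/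
def gfun (y : E r) : E r → E r := fun z => wordAct r (gW r y) z

/-- The Bruhat order on `(W, {s₀,…,s_r})`, via the subword characterisation. -/
def bruhatLE (u v : E r → E r) : Prop :=
  ∃ l : List ℕ, (∀ a ∈ l, a ≤ r) ∧ (fun z => wordAct r l z) = v ∧ l.length = wlen r v ∧
    ∃ l' : List ℕ, l'.Sublist l ∧ (fun z => wordAct r l' z) = u ∧ l'.length = wlen r u

/-- The partial order on `ℝ^r`: `y' ≤ y` iff `y'` and `y` lie in the same `W`-orbit and
`g_{y'} ≤_B g_y` in the Bruhat order. -/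
def qle (y' y : E r) : Prop :=
  (∃ l : List ℕ, (∀ a ∈ l, a ≤ r) ∧ wordAct r l y = y') ∧ bruhatLE r (gfun r y') (gfun r y)

/-- Strict version of `qle`. -/
def qlt (y' y : E r) : Prop := qle r y' y ∧ y' ≠ y

/-- The `F`-linear operator on `F[ℝ^r]` determined by its values on the quasi-monomials. -/
def mkOp (Ψ : E r → QA F r) : Module.End F (QA F r) :=
  Finsupp.linearCombination F Ψ ∘ₗ (AddMonoidAlgebra.coeffLinearEquiv F).toLinearMap

/-- `F[O] = span_F {x^y : y ∈ O}`. -/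
def FO (O : Set (E r)) : Submodule F (QA F r) :=
  Submodule.span F {p | ∃ y ∈ O, p = X F r y}

/-- The Laurent polynomial subalgebra `F[ℤ^r] = span_F {x^μ : μ ∈ ℤ^r}`. -/
def Lspan : Submodule F (QA F r) :=
  Submodule.span F {p | ∃ lam : Fin r → ℤ, p = X F r (zc r lam)}

/-- `span_F {x^{y'} : y' < y}`. -/
def ltSpan (y : E r) : Submodule F (QA F r) :=
  Submodule.span F {p | ∃ y', qlt r y' y ∧ p = X F r y'}

/-! ### Floors and indicator/sign functions -/

/-- the largest even integer `≤ z` -/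
def floorE (z : ℝ) : ℤ := 2 * ⌊z / 2⌋
/-- the largest odd integer `≤ z` -/
def floorO (z : ℝ) : ℤ := 2 * ⌊(z + 1) / 2⌋ - 1
/-- indicator of `ℤ ⊆ ℝ` -/
def chiZ (z : ℝ) : ℕ := if ∃ n : ℤ, z = n then 1 else 0
/-- indicator of the even integers -/
def chiE (z : ℝ) : ℕ := if ∃ n : ℤ, z = 2 * n then 1 else 0
/-- indicator of the odd integers -/
def chiO (z : ℝ) : ℕ := if ∃ n : ℤ, z = 2 * n + 1 then 1 else 0
/-- `η_e`: `1` on even integers `≥ 2`, `-1` on even integers `≤ 0`, `0` otherwise -/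
def etaE (z : ℝ) : ℤ := if ∃ n : ℤ, z = 2 * n then (if 2 ≤ z then 1 else -1) else 0
/-- `η_o`: `1` on odd integers `≥ 1`, `-1` on odd integers `≤ -1`, `0` otherwise -/
def etaO (z : ℝ) : ℤ := if ∃ n : ℤ, z = 2 * n + 1 then (if 1 ≤ z then 1 else -1) else 0
/-- `η = η_e + η_o` -/
def eta (z : ℝ) : ℤ := etaE z + etaO z

/-- `geomS c v m` is the truncated geometric series `(1 - (c·x^v)^m)/(1 - c·x^v)`,
a genuine element of `F[ℝ^r]`; it is the unique element with
`(1 - c·x^v) * geomS c v m = 1 - c^m·x^{m v}`. -/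
def geomS (c : F) (v : E r) (m : ℤ) : QA F r :=
  if 0 ≤ m then ∑ t ∈ Finset.range m.toNat, c ^ (t : ℤ) • X F r ((t : ℝ) • v)
  else -∑ t ∈ Finset.range (-m).toNat, c ^ (-(t : ℤ) - 1) • X F r ((-(t : ℝ) - 1) • v)

/-! ### Truncated divided difference operators and Demazure–Lusztig operators -/

/-- `∇_i(x^y) = ((1 - (x_{i+1}/x_i)^{⌊y_i - y_{i+1}⌋})/(1 - x_i/x_{i+1}))·x^y`. -/
def nablaIel (i : ℕ) (y : E r) : QA F r :=
  geomS F r 1 (epsV r i - epsV r (i + 1)) (-⌊cd r y i - cd r y (i + 1)⌋) * X F r y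

/-- `∇_r^e(x^y) = ((1 - x_r^{-⌊2y_r⌋_e})/(1 - x_r^2))·x^y`. -/
def nablaReEl (y : E r) : QA F r :=
  geomS F r 1 ((2 : ℝ) • epsV r r) (-floorE (2 * cd r y r) / 2) * X F r y

/-- `∇_r^o(x^y) = ((x_r - x_r^{-⌊2y_r⌋_o})/(1 - x_r^2))·x^y`. -/
def nablaRoEl (y : E r) : QA F r :=
  X F r (epsV r r) *
    geomS F r 1 ((2 : ℝ) • epsV r r) ((-floorO (2 * cd r y r) - 1) / 2) * X F r y

def nablaIop (i : ℕ) : Module.End F (QA F r) := mkOp F r (nablaIel F r i)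
def nablaReOp : Module.End F (QA F r) := mkOp F r (nablaReEl F r)
def nablaRoOp : Module.End F (QA F r) := mkOp F r (nablaRoEl F r)

/-- The value of the truncated Demazure–Lusztig operator `T_i` (`1 ≤ i ≤ r`) on `x^y`. -/
def Tel (k kr ur : F) (i : ℕ) (y : E r) : QA F r :=
  if i = r then
    (kr ^ chiE (2 * cd r y r) * ur ^ chiO (2 * cd r y r)) • X F r (sW r r y)
      + (kr - kr⁻¹) • nablaReEl F r y + (ur - ur⁻¹) • nablaRoEl F r y
  else
    k ^ chiZ (cd r y i - cd r y (i + 1)) • X F r (sW r i y)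
      + (k - k⁻¹) • nablaIel F r i y

/-- The truncated Demazure–Lusztig operators `T_1, …, T_r` on `F[ℝ^r]`. -/
def Top (k kr ur : F) (i : ℕ) : Module.End F (QA F r) := mkOp F r (Tel F r k kr ur i)

/-! ### The torus and the affine generator -/

/-- `t^{ε_i}`: the `i`-th coordinate (`1`-based) of an element of the torus `T = (Fˣ)^r`. -/
def tcU (t : Fin r → Fˣ) (i : ℕ) : Fˣ := ∏ m : Fin r, if (m : ℕ) + 1 = i then t m else 1

/-- `t^λ` for `λ ∈ ℤ^r`. -/
def upow (t : Fin r → Fˣ) (lam : Fin r → ℤ) : Fˣ := ∏ m : Fin r, t m ^ lam m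

/-- `t^v` for a vector `v` with integral entries (entries read off via the floor). -/
def upowR (t : Fin r → Fˣ) (v : E r) : Fˣ := ∏ m : Fin r, t m ^ ⌊v m⌋

/-- The `W`-action on the torus `T = (Fˣ)^r`: for `g = τ(λ)w₀ ∈ W` (so `g y = w₀ y + λ`),
`(g t)_m = q^{λ_m} · t^{w₀⁻¹ ε_m}`, where `W₀` permutes and inverts coordinates and
`τ(λ) t = q^λ t`, with `q = (q^{1/2})²`. -/
def torusAct (qh : Fˣ) (g : E r → E r) (t : Fin r → Fˣ) : Fin r → Fˣ := fun m =>
  (qh * qh) ^ ⌊g 0 m⌋ * ∏ j : Fin r, t j ^ ⌊(g (eV r j) - g 0) m⌋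

/-- The action on the torus of the linear part of `g` alone (the `W₀`-action). -/
def torusAct0 (g : E r → E r) (t : Fin r → Fˣ) : Fin r → Fˣ := fun m =>
  ∏ j : Fin r, t j ^ ⌊(g (eV r j) - g 0) m⌋

/-- The simple affine roots `α₀(y) = 1 - 2y₁`, `α_i(y) = y_i - y_{i+1}` (`1 ≤ i < r`),
`α_r(y) = 2 y_r` as affine-linear functionals. -/
def alphaF (j : ℕ) (y : E r) : ℝ :=
  if j = 0 then 1 - 2 * cd r y 1
  else if j = r then 2 * cd r y r
  else cd r y j - cd r y (j + 1)

/-- `t^{α_j^∨}` where `α₀^∨ = (-ε₁, 1/2)`, `α_i^∨ = (ε_i - ε_{i+1}, 0)`, `α_r^∨ = (ε_r, 0)`. -/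
def tpowCo (qh : Fˣ) (t : Fin r → Fˣ) (j : ℕ) : Fˣ :=
  if j = 0 then qh * (tcU F r t 1)⁻¹
  else if j = r then tcU F r t r
  else tcU F r t j * (tcU F r t (j + 1))⁻¹

/-- The affine subtorus `T_𝒪 = {t ∈ T : t^{α_j^∨} = 1 whenever α_j(c^𝒪) = 0}`. -/
def TOset (qh : Fˣ) (O : Set (E r)) : Set (Fin r → Fˣ) :=
  {t | ∀ j : ℕ, j ≤ r → alphaF r j (cpt r O) = 0 → tpowCo F r qh t j = 1}

/-- `∇₀^e(x^y) = ((1 - (q^{-1/2}x₁)^{⌊-2y₁⌋_e})/(1 - q x₁^{-2}))·x^y`. -/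
def nabla0eEl (qh : F) (y : E r) : QA F r :=
  geomS F r (qh * qh) ((-2 : ℝ) • epsV r 1) (-floorE (-2 * cd r y 1) / 2) * X F r y

/-- `∇₀^o(x^y) = ((q^{1/2}x₁^{-1} - (q^{-1/2}x₁)^{⌊-2y₁⌋_o})/(1 - q x₁^{-2}))·x^y`. -/
def nabla0oEl (qh : F) (y : E r) : QA F r :=
  (qh • X F r ((-1 : ℝ) • epsV r 1)) *
    geomS F r (qh * qh) ((-2 : ℝ) • epsV r 1) ((-floorO (-2 * cd r y 1) - 1) / 2) * X F r y

/-- The value of `T₀^𝒪` on `x^y`. -/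
def T0el (qh : Fˣ) (k0 u0 : F) (t : Fin r → Fˣ) (y : E r) : QA F r :=
  (k0 ^ chiE (2 * cd r y 1) * u0 ^ chiO (2 * cd r y 1) *
      ((tcU F r (torusAct F r qh (gfun r y) t) 1 : Fˣ) : F)) • X F r (sEps1 r y)
    + (k0 - k0⁻¹) • nabla0eEl F r qh y + (u0 - u0⁻¹) • nabla0oEl F r qh y

/-- The operator `T₀^𝒪` (as a globally defined operator; on `F[𝒪]` it is the operator of
the quasi-polynomial representation). -/
def T0op (qh : Fˣ) (k0 u0 : F) (t : Fin r → Fˣ) : Module.End F (QA F r) :=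
  mkOp F r (T0el F r qh k0 u0 t)

/-- The full family `T₀^𝒪, T₁, …, T_r`. -/
def Tfull (qh : Fˣ) (k0 u0 k kr ur : F) (t : Fin r → Fˣ) (j : ℕ) : Module.End F (QA F r) :=
  if j = 0 then T0op F r qh k0 u0 t else Top F r k kr ur j

/-- The Hecke parameter `k_j` (`k₀`, `k` or `k_r`). -/
def kpar (k0 k kr : F) (j : ℕ) : F := if j = 0 then k0 else if j = r then kr else k

/-- `(T_j^𝒪)⁻¹ = T_j^𝒪 - k_j + k_j⁻¹` (the inverse on `F[𝒪]`, by the Hecke relation). -/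
def TfullInv (qh : Fˣ) (k0 u0 k kr ur : F) (t : Fin r → Fˣ) (j : ℕ) : Module.End F (QA F r) :=
  Tfull F r qh k0 u0 k kr ur t j - (kpar F r k0 k kr j - (kpar F r k0 k kr j)⁻¹) • 1

/-- The word `0, 1, …, r-1, r, r-1, …, i` used in the definition of `Y_i^𝒪`. -/
def Ylist (i : ℕ) : List ℕ :=
  0 :: (((List.range (r - 1)).map (· + 1)) ++ [r] ++ ((List.range (r - i)).map fun m => r - 1 - m))

/-- The commuting operators
`Y_i^𝒪 = (T_{i-1}^𝒪)⁻¹⋯(T₁^𝒪)⁻¹ · T₀^𝒪 · T₁^𝒪⋯T_{r-1}^𝒪 · T_r^𝒪 · T_{r-1}^𝒪⋯T_i^𝒪`. -/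
def Yop (qh : Fˣ) (k0 u0 k kr ur : F) (t : Fin r → Fˣ) (i : ℕ) : Module.End F (QA F r) :=
  ((((List.range (i - 1)).map (· + 1)).reverse.map (TfullInv F r qh k0 u0 k kr ur t)).prod) *
    (((Ylist r i).map (Tfull F r qh k0 u0 k kr ur t)).prod)

/-! ### The base points `𝔰^𝒪`, `𝔰_y` and the spectrum -/

/-- `n_i^𝒪` (with `c = c^𝒪`), resp. `m_i(y)` (with `c = y`). -/
def nO (c : E r) (m : Fin r) : ℤ :=
  (∑ j : Fin r, if m < j then eta (c m - c j) + eta (c m + c j) else 0) +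
    ∑ j : Fin r, if j < m then eta (c j + c m) - eta (c j - c m) else 0

/-- The base point `𝔰^𝒪 ∈ T`. -/
def sOtor (k0 u0 k kr ur : Fˣ) (O : Set (E r)) : Fin r → Fˣ := fun m =>
  (k0 * kr) ^ (-(chiE (2 * cpt r O m) : ℤ)) * (u0 * ur) ^ (chiO (2 * cpt r O m) : ℤ) *
    k ^ nO r (cpt r O) m

/-- The eigenvalue `γ_i^𝒪(y) = ((g_y(𝔰^𝒪·t))_i)⁻¹`. -/
def gammaO (qh k0 u0 k kr ur : Fˣ) (O : Set (E r)) (t : Fin r → Fˣ) (i : ℕ) (y : E r) : Fˣ :=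
  (tcU F r (torusAct F r qh (gfun r y) fun m => sOtor F r k0 u0 k kr ur O m * t m) i)⁻¹

/-- `𝔰_y ∈ T`. -/
def sfrak (k0 u0 k kr ur : Fˣ) (y : E r) : Fin r → Fˣ := fun m =>
  (k0 * kr) ^ etaE (2 * y m) * (u0 * ur) ^ etaO (2 * y m) * k ^ nO r y m

/-! ### Finite Weyl group combinatorics, positive roots -/

/-- The set of positive roots of type `C_r`. -/
def PhiPlus : Set (E r) :=
  {v | (∃ a b : Fin r, a < b ∧ v = eV r a - eV r b) ∨
       (∃ a b : Fin r, a < b ∧ v = eV r a + eV r b) ∨ ∃ a : Fin r, v = (2 : ℝ) • eV r a}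

/-- The root system of type `C_r`. -/
def Phi0 : Set (E r) := PhiPlus r ∪ {v | -v ∈ PhiPlus r}

/-- The normalisation factor `κ_w^𝒪 = ∏_{α ∈ Π(w)} 𝐤_α^{χ_e(α(c))}·𝐤_{α/2}^{-χ_o(α(c))}`,
where `Π(w) = {α ∈ Φ₀⁺ : wα ∈ -Φ₀⁺}`, `𝐤_α = 𝐤_{α/2} = k` for short roots and
`𝐤_α = k_r`, `𝐤_{α/2} = u_r` for long roots. -/
def kappaW (k kr ur : Fˣ) (w : E r → E r) (c : E r) : Fˣ :=
  (∏ p : Fin r × Fin r,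
      if p.1 < p.2 ∧ -w (eV r p.1 - eV r p.2) ∈ PhiPlus r then
        k ^ ((chiE (ip r (eV r p.1 - eV r p.2) c) : ℤ) - (chiO (ip r (eV r p.1 - eV r p.2) c) : ℤ))
      else 1) *
  (∏ p : Fin r × Fin r,
      if p.1 < p.2 ∧ -w (eV r p.1 + eV r p.2) ∈ PhiPlus r then
        k ^ ((chiE (ip r (eV r p.1 + eV r p.2) c) : ℤ) - (chiO (ip r (eV r p.1 + eV r p.2) c) : ℤ))
      else 1) *
  ∏ a : Fin r,
      if -w ((2 : ℝ) • eV r a) ∈ PhiPlus r then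
        kr ^ (chiE (ip r ((2 : ℝ) • eV r a) c) : ℤ) * ur ^ (-(chiO (ip r ((2 : ℝ) • eV r a) c) : ℤ))
      else 1

/-- Iterated application `T_{i₁}(T_{i₂}(⋯(T_{i_ℓ}(f))⋯))`. -/
def applyT (k kr ur : F) (l : List ℕ) (f : QA F r) : QA F r :=
  l.foldr (fun i g => Top F r k kr ur i g) f

/-- The length function of the finite Weyl group `W₀`. -/
def w0len (g : E r → E r) : ℕ :=
  sInf {n | ∃ l : List ℕ, (∀ a ∈ l, 1 ≤ a ∧ a ≤ r) ∧ l.length = n ∧ (fun y => wordAct r l y) = g}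

/-- Membership in `W₀` (as maps on `ℝ^r`). -/
def IsW0fun (w : E r → E r) : Prop :=
  ∃ l : List ℕ, (∀ a ∈ l, 1 ≤ a ∧ a ≤ r) ∧ w = fun y => wordAct r l y

/-- Membership in the parabolic subgroup `W_{0,𝒪}` generated by the `s_i`, `1 ≤ i ≤ r`,
with `α_i(c^𝒪) = 0`. -/
def IsWOOfun (O : Set (E r)) (u : E r → E r) : Prop :=
  ∃ l : List ℕ, (∀ a ∈ l, 1 ≤ a ∧ a ≤ r ∧ alphaF r a (cpt r O) = 0) ∧
    u = fun y => wordAct r l y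

/-- `v ∈ W₀^𝒪`: `v ∈ W₀` of minimal length in its coset `v·W_{0,𝒪}`. -/
def MinRep (O : Set (E r)) (v : E r → E r) : Prop :=
  IsW0fun r v ∧ ∀ u, IsWOOfun r O u → w0len r v ≤ w0len r fun y => v (u y)

/-- Membership in the affine Weyl group `W` (as maps on `ℝ^r`). -/
def IsWfun (g : E r → E r) : Prop :=
  ∃ l : List ℕ, (∀ a ∈ l, a ≤ r) ∧ g = fun y => wordAct r l y

/-- Membership in the parabolic subgroup `W_{J(𝒪)}` generated by the `s_j`, `j ∈ J(𝒪)`. -/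
def IsWJfun (O : Set (E r)) (u : E r → E r) : Prop :=
  ∃ l : List ℕ, (∀ a ∈ l, a ≤ r ∧ alphaF r a (cpt r O) = 0) ∧ u = fun y => wordAct r l y

/-- The `W`-action on the Laurent polynomials `F[ℤ^r]` by `q`-dilations and reflections:
`w(x^μ) = x^{wμ}` for `w ∈ W₀`, `τ(λ)(x^μ) = q^{-⟨μ,λ⟩} x^μ` (globally defined via the
linear/translation parts of `g`). -/
def LWact (qh : Fˣ) (g : E r → E r) : Module.End F (QA F r) :=
  mkOp F r fun v => (((qh * qh) ^ (-⌊ip r (g v - g 0) (g 0)⌋) : Fˣ) : F) • X F r (g v - g 0)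

/-! ### roots `ᾱ_j`, torus reflections -/

/-- The finite simple roots `ᾱ₀ = -2ε₁`, `ᾱ_i = ε_i - ε_{i+1}`, `ᾱ_r = 2ε_r`
(as integral vectors). -/
def abarI (j : ℕ) : Fin r → ℤ := fun m =>
  if j = 0 then (if (m : ℕ) = 0 then -2 else 0)
  else if j = r then (if (m : ℕ) + 1 = r then 2 else 0)
  else if (m : ℕ) + 1 = j then 1
  else if (m : ℕ) = j then -1
  else 0

/-- The corresponding coroots `ᾱ₀^∨ = -ε₁`, `ᾱ_i^∨ = ε_i - ε_{i+1}`, `ᾱ_r^∨ = ε_r`. -/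
def abarV (j : ℕ) : Fin r → ℤ := fun m =>
  if j = 0 then (if (m : ℕ) = 0 then -1 else 0)
  else if j = r then (if (m : ℕ) + 1 = r then 1 else 0)
  else if (m : ℕ) + 1 = j then 1
  else if (m : ℕ) = j then -1
  else 0

/-- `ᾱ_j` as a real vector. -/
def abarR (j : ℕ) : E r := fun m => ((abarI r j m : ℤ) : ℝ)

/-- The constants `c₀ = u₀u_r`, `c_i = k²`, `c_r = k₀k_r`. -/
def cpar (k0 u0 k kr ur : Fˣ) (j : ℕ) : Fˣ :=
  if j = 0 then u0 * ur else if j = r then k0 * kr else k * k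

/-- The action of the reflection `s_{ᾱ_j} ∈ W₀` on the torus `T` (with `s_{ᾱ₀} = s_{ε₁}`). -/
def sTor (j : ℕ) (t : Fin r → Fˣ) : Fin r → Fˣ := fun m =>
  if j = 0 then (if (m : ℕ) = 0 then (t m)⁻¹ else t m)
  else if j = r then (if (m : ℕ) + 1 = r then (t m)⁻¹ else t m)
  else if (m : ℕ) + 1 = j then tcU F r t (j + 1)
  else if (m : ℕ) = j then tcU F r t j
  else t m

/-! ### The operators `G_t^𝒪(a)` for affine roots `a = (α, n)` -/

/-- The coroot `α^∨ = 2α/⟨α,α⟩`. -/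
def coroot (v : E r) : E r := ((2 : ℝ) / ip r v v) • v

/-- The scalar `q^{2n/⟨α,α⟩}` appearing in `x^{a^∨}` for `a = (α,n)`. -/
def qsc (qh : Fˣ) (v : E r) (n : ℤ) : Fˣ := if ip r v v = 4 then qh ^ n else (qh * qh) ^ n

/-- `𝐤_a`: `k` if `α` is short; `k_r` if `α` long, `n` even; `k₀` if `α` long, `n` odd. -/
def kaf (k0 k kr : Fˣ) (v : E r) (n : ℤ) : Fˣ :=
  if ip r v v = 4 then (if Even n then kr else k0) else k

/-- `𝐤_{a/2}`: `k` if `α` is short; `u_r` if `α` long, `n` even; `u₀` if `α` long, `n` odd. -/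
def khaf (u0 k ur : Fˣ) (v : E r) (n : ℤ) : Fˣ :=
  if ip r v v = 4 then (if Even n then ur else u0) else k

/-- The reflection `s_α(y) = y - α(y)·α^∨`. -/
def sRefl (v y : E r) : E r := y - ip r v y • coroot r v

/-- `s_{a,t}(x^y) = (g_y t)^{-n α^∨} · x^{s_α y}`. -/
def saTel (qh : Fˣ) (t : Fin r → Fˣ) (v : E r) (n : ℤ) (y : E r) : QA F r :=
  ((upowR F r (torusAct F r qh (gfun r y) t) (((-n : ℤ) : ℝ) • coroot r v) : Fˣ) : F) •
    X F r (sRefl r v y)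

/-- The twisted reflection operator `s_{a,t}`. -/
def SaOp (qh : Fˣ) (t : Fin r → Fˣ) (v : E r) (n : ℤ) : Module.End F (QA F r) :=
  mkOp F r (saTel F r qh t v n)

/-- The value `G_t^𝒪(a)(x^y)` for the affine root `a = (v, n)`. -/
def Gel (qh k0 u0 k kr ur : Fˣ) (t : Fin r → Fˣ) (v : E r) (n : ℤ) (y : E r) : QA F r :=
  (((kaf F r k0 k kr v n : Fˣ) : F) ^ chiE (ip r v y) *
      ((khaf F r u0 k ur v n : Fˣ) : F) ^ chiO (ip r v y)) • X F r y
    + ((((kaf F r k0 k kr v n : Fˣ) : F) - ((kaf F r k0 k kr v n : Fˣ) : F)⁻¹) •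
          geomS F r (((qsc F r qh v n)⁻¹ * (qsc F r qh v n)⁻¹ : Fˣ) : F)
            ((-2 : ℝ) • coroot r v) (-floorE (ip r v y) / 2)
        + (((khaf F r u0 k ur v n : Fˣ) : F) - ((khaf F r u0 k ur v n : Fˣ) : F)⁻¹) •
          ((((qsc F r qh v n)⁻¹ : Fˣ) : F) • X F r ((-1 : ℝ) • coroot r v) *
            geomS F r (((qsc F r qh v n)⁻¹ * (qsc F r qh v n)⁻¹ : Fˣ) : F)
              ((-2 : ℝ) • coroot r v) (-(floorO (ip r v y) + 1) / 2))) *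
      saTel F r qh t v n y

/-- The operator `G_t^𝒪(a)` for `a = (v, n)`. -/
def Gop (qh k0 u0 k kr ur : Fˣ) (t : Fin r → Fˣ) (v : E r) (n : ℤ) : Module.End F (QA F r) :=
  mkOp F r (Gel F r qh k0 u0 k kr ur t v n)

/-- The twisted action `g_t` of `g ∈ W` on `F[𝒪]`:
`g_t(x^y) = (g_{w₀ y} t)^{-λ} x^{w₀ y}` for `g = τ(λ) w₀`. -/
def Wtw (qh : Fˣ) (t : Fin r → Fˣ) (g : E r → E r) : Module.End F (QA F r) :=
  mkOp F r fun y =>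
    (((upowR F r (torusAct F r qh (gfun r (g y - g 0)) t) (g 0))⁻¹ : Fˣ) : F) •
      X F r (g y - g 0)

/-! ### The operators `D_j` -/

/-- The palindromic word `1, …, r-1, r, r-1, …, 1`. -/
def palin : List ℕ :=
  ((List.range (r - 1)).map (· + 1)) ++ [r] ++ ((List.range (r - 1)).map (· + 1)).reverse

/-- Multiplication by `x^{-ε₁}`. -/
def Mop : Module.End F (QA F r) := mkOp F r fun y => X F r ((-1 : ℝ) • epsV r 1) * X F r y

/-- `D₀ = (T₁^𝒪 ⋯ T_{r-1}^𝒪 T_r^𝒪 T_{r-1}^𝒪 ⋯ T₁^𝒪)⁻¹ ∘ M`. -/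
def D0op (qh : Fˣ) (k0 u0 k kr ur : F) (t : Fin r → Fˣ) : Module.End F (QA F r) :=
  ((palin r).map (TfullInv F r qh k0 u0 k kr ur t)).prod * Mop F r

/-- `D_j`: `D₀` for `j = 0` and `T_j^𝒪` for `1 ≤ j ≤ r`. -/
def Dop (qh : Fˣ) (k0 u0 k kr ur : F) (t : Fin r → Fˣ) (j : ℕ) : Module.End F (QA F r) :=
  if j = 0 then D0op F r qh k0 u0 k kr ur t else Tfull F r qh k0 u0 k kr ur t j

/-- Iterated application `D_{j₁}(D_{j₂}(⋯(D_{j_ℓ}(f))⋯))`. -/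
def applyD (qh : Fˣ) (k0 u0 k kr ur : F) (t : Fin r → Fˣ) (l : List ℕ) (f : QA F r) : QA F r :=
  l.foldr (fun j g => Dop F r qh k0 u0 k kr ur t j g) f

/-- The coefficients `k_{s_j}(y)`. -/
def ksj (k kr ur : Fˣ) (j : ℕ) (y : E r) : Fˣ :=
  if j = 0 then
    kr ^ (-etaE (2 * cd r y 1)) * ur ^ (-etaO (2 * cd r y 1)) *
      ∏ m : Fin r,
        (if 1 ≤ (m : ℕ) then k ^ (-eta (cd r y 1 - y m) - eta (cd r y 1 + y m)) else 1)
  else if j = r then kr ^ (-etaE (2 * cd r y r)) * ur ^ (-etaO (2 * cd r y r))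
  else k ^ (-eta (cd r y j - cd r y (j + 1)))

/-- `k_w(c) = ∏_m k_{s_{j_m}}(s_{j_{m+1}} ⋯ s_{j_ℓ} c)` for the word `w = s_{j₁} ⋯ s_{j_ℓ}`. -/
def kword (k kr ur : Fˣ) (l : List ℕ) (z : E r) : Fˣ :=
  (l.foldr (fun j p => (genF r j p.1, ksj F r k kr ur j p.1 * p.2)) (z, (1 : Fˣ))).2


section geometry
variable {r}

theorem cd_fin (y : E r) (m : Fin r) (i : ℕ) (h : i = (m : ℕ) + 1) : cd r y i = y m := by
  unfold cd
  rw [Finset.sum_eq_single m]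
  · simp [h]
  · intro b _ hb
    rw [if_neg]
    intro h'
    exact hb (Fin.ext (by omega))
  · simp

theorem cd_oob (y : E r) (i : ℕ) (h : i = 0 ∨ r < i) : cd r y i = 0 := by
  unfold cd
  apply Finset.sum_eq_zero
  intro m _
  rw [if_neg]
  have := m.2
  omega

theorem cd_add (y z : E r) (i : ℕ) : cd r (y + z) i = cd r y i + cd r z i := by
  unfold cd
  rw [← Finset.sum_add_distrib]
  apply Finset.sum_congr rfl
  intro m _
  split_ifs <;> simp

theorem cd_smul (c : ℝ) (y : E r) (i : ℕ) : cd r (c • y) i = c * cd r y i := by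
  unfold cd
  rw [Finset.mul_sum]
  apply Finset.sum_congr rfl
  intro m _
  split_ifs <;> simp

theorem cd_neg (y : E r) (i : ℕ) : cd r (-y) i = - cd r y i := by
  have := cd_smul (-1) y i
  simpa using this

theorem cd_sub (y z : E r) (i : ℕ) : cd r (y - z) i = cd r y i - cd r z i := by
  rw [sub_eq_add_neg, cd_add, cd_neg, sub_eq_add_neg]

theorem cd_eps (i j : ℕ) (hi : 1 ≤ i) (hi' : i ≤ r) :
    cd r (epsV r i) j = if j = i then 1 else 0 := by
  by_cases hj : j = 0 ∨ r < j
  · rw [cd_oob _ _ hj, if_neg]; omega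
  · have hjr : j - 1 < r := by omega
    rw [cd_fin _ ⟨j - 1, hjr⟩ j (by simp; omega)]
    unfold epsV
    have : (j - 1 + 1 = i) ↔ j = i := by omega
    simp only [this]

/-- linear part of the simple affine roots -/
def pj (j : ℕ) (y : E r) : ℝ :=
  if j = 0 then -2 * cd r y 1
  else if j = r then 2 * cd r y r
  else cd r y j - cd r y (j + 1)

variable (r) in
/-- the simple coroots -/
def vv (j : ℕ) : E r :=
  if j = 0 then -epsV r 1
  else if j = r then epsV r r
  else epsV r j - epsV r (j + 1)

/-- linear part of the simple reflections -/
def sbar (j : ℕ) (y : E r) : E r := y - pj j y • vv r j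

theorem alphaF_eq (j : ℕ) (y : E r) : alphaF r j y = pj j y + if j = 0 then 1 else 0 := by
  unfold alphaF pj
  split_ifs <;> ring

theorem pj_add (j : ℕ) (y z : E r) : pj j (y + z) = pj j y + pj j z := by
  unfold pj
  simp only [cd_add]
  split_ifs <;> ring

theorem pj_smul (j : ℕ) (c : ℝ) (y : E r) : pj j (c • y) = c * pj j y := by
  unfold pj
  simp only [cd_smul]
  split_ifs <;> ring

theorem pj_neg (j : ℕ) (y : E r) : pj j (-y) = - pj j y := by
  have := pj_smul j (-1) y
  simpa using this

theorem pj_sub (j : ℕ) (y z : E r) : pj j (y - z) = pj j y - pj j z := by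
  rw [sub_eq_add_neg, pj_add, pj_neg, sub_eq_add_neg]

theorem pj_vv (hr : 2 ≤ r) (j : ℕ) (hj : j ≤ r) : pj j (vv r j) = 2 := by
  unfold pj vv
  by_cases h0 : j = 0
  · simp [h0, cd_neg, cd_eps (r := r) 1 1 le_rfl (by omega)]
  · by_cases h1 : j = r
    · subst h1
      simp [h0, cd_eps j j (by omega) le_rfl]
    · simp only [h0, h1, if_false]
      simp only [cd_sub]
      rw [cd_eps j j (by omega) (by omega), cd_eps (j+1) j (by omega) (by omega),
        cd_eps j (j+1) (by omega) (by omega), cd_eps (j+1) (j+1) (by omega) (by omega)]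
      norm_num

theorem sbar_add (j : ℕ) (y z : E r) : sbar j (y + z) = sbar j y + sbar j z := by
  unfold sbar; rw [pj_add, add_smul]; abel

theorem sbar_smul (j : ℕ) (c : ℝ) (y : E r) : sbar j (c • y) = c • sbar j y := by
  unfold sbar; rw [pj_smul, smul_sub, smul_smul]

theorem sbar_neg (j : ℕ) (y : E r) : sbar j (-y) = - sbar j y := by
  have := sbar_smul j (-1) y
  simpa using this

theorem sbar_sub (j : ℕ) (y z : E r) : sbar j (y - z) = sbar j y - sbar j z := by
  rw [sub_eq_add_neg, sbar_add, sbar_neg, sub_eq_add_neg]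

theorem pj_sbar (hr : 2 ≤ r) (j : ℕ) (hj : j ≤ r) (y : E r) : pj j (sbar j y) = - pj j y := by
  unfold sbar; rw [pj_sub, pj_smul, pj_vv hr j hj]; ring

theorem sbar_vv (hr : 2 ≤ r) (j : ℕ) (hj : j ≤ r) : sbar j (vv r j) = - vv r j := by
  unfold sbar; rw [pj_vv hr j hj, two_smul]; abel

theorem sbar_sbar (hr : 2 ≤ r) (j : ℕ) (hj : j ≤ r) (y : E r) : sbar j (sbar j y) = y := by
  conv_lhs => unfold sbar
  rw [show y - pj j y • vv r j = sbar j y from rfl, pj_sbar hr j hj]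
  unfold sbar; simp

theorem epsV_apply (i : ℕ) (m : Fin r) : epsV r i m = if (m : ℕ) + 1 = i then 1 else 0 := rfl

theorem sbar_zero (hr : 2 ≤ r) (y : E r) (m : Fin r) :
    sbar 0 y m = if (m : ℕ) = 0 then - y m else y m := by
  unfold sbar pj vv
  rw [cd_fin y ⟨0, by omega⟩ 1 rfl]
  simp only [if_true, Pi.sub_apply, Pi.smul_apply, Pi.neg_apply, epsV_apply, smul_eq_mul]
  by_cases h : (m : ℕ) = 0
  · have : m = ⟨0, by omega⟩ := Fin.ext h
    rw [← this]
    simp [h]; ring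
  · simp [h]

theorem sbar_last (hr : 2 ≤ r) (y : E r) (m : Fin r) :
    sbar r y m = if (m : ℕ) + 1 = r then - y m else y m := by
  unfold sbar pj vv
  rw [cd_fin y ⟨r - 1, by omega⟩ r (by simp; omega)]
  have h0 : r ≠ 0 := by omega
  simp only [h0, if_true, if_false, Pi.sub_apply, Pi.smul_apply, epsV_apply, smul_eq_mul]
  by_cases h : (m : ℕ) + 1 = r
  · have : m = ⟨r - 1, by omega⟩ := Fin.ext (by simp; omega)
    rw [← this]
    simp [h]; ring
  · simp [h]

theorem pj_mid (a b : Fin r) (hab : (b : ℕ) = a + 1) (y : E r) :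
    pj ((a : ℕ) + 1) y = y a - y b := by
  unfold pj
  have := b.2
  rw [if_neg (by omega), if_neg (by omega), cd_fin y a _ rfl, cd_fin y b _ (by omega)]

theorem vv_mid (a b : Fin r) (hab : (b : ℕ) = a + 1) :
    vv r ((a : ℕ) + 1) = eV r a - eV r b := by
  unfold vv
  have := b.2
  rw [if_neg (by omega), if_neg (by omega)]
  funext m
  simp only [Pi.sub_apply, epsV_apply, eV, Fin.ext_iff]
  congr 1
  · simp
  · have : ((m : ℕ) + 1 = a + 1 + 1) ↔ ((m : ℕ) = b) := by omega
    simp only [this]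

theorem sbar_mid (a b : Fin r) (hab : (b : ℕ) = a + 1) (y : E r) (m : Fin r) :
    sbar ((a : ℕ) + 1) y m = y (Equiv.swap a b m) := by
  unfold sbar
  rw [pj_mid a b hab, vv_mid a b hab]
  have hne : a ≠ b := by intro h; rw [h] at hab; omega
  simp only [Pi.sub_apply, Pi.smul_apply, smul_eq_mul, eV]
  rcases eq_or_ne m a with rfl | h1
  · simp [hne]
  · rcases eq_or_ne m b with rfl | h2
    · simp [hne.symm]
    · rw [Equiv.swap_apply_of_ne_of_ne h1 h2]; simp [h1, h2]

@[elab_as_elim]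
theorem jcases (hr : 2 ≤ r) {P : ℕ → Prop} (h0 : P 0) (hl : P r)
    (hm : ∀ a b : Fin r, (b : ℕ) = a + 1 → P ((a : ℕ) + 1)) (j : ℕ) (hj : j ≤ r) : P j := by
  rcases Nat.eq_zero_or_pos j with rfl | h
  · exact h0
  · rcases hj.eq_or_lt with rfl | h'
    · exact hl
    · have := hm ⟨j - 1, by omega⟩ ⟨j, h'⟩ (by simp; omega)
      simpa [Nat.sub_add_cancel h] using this

theorem genF_sbar (hr : 2 ≤ r) (j : ℕ) (hj : j ≤ r) (y : E r) :
    genF r j y = sbar j y + (if j = 0 then epsV r 1 else 0) := by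
  refine jcases hr ?_ ?_ ?_ j hj
  · funext m
    simp only [genF, if_true, Pi.add_apply, sbar_zero hr, epsV_apply]
    by_cases h : (m : ℕ) = 0
    · simp [h]; ring
    · simp [h]
  · have h0 : r ≠ 0 := by omega
    funext m
    simp only [genF, if_neg h0, Pi.add_apply, sbar_last hr, sW, if_true]
    simp
  · intro a b hab
    funext m
    have := b.2
    rw [Pi.add_apply, sbar_mid a b hab]
    simp only [genF]
    rw [if_neg (by omega)]
    simp only [sW]
    rw [if_neg (by omega), cd_fin y a _ rfl,
      cd_fin y b _ (by omega)]
    rcases eq_or_ne m a with rfl | h1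
    · simp
    · rw [if_neg (by simpa [Fin.ext_iff] using h1)]
      rcases eq_or_ne m b with rfl | h2
      · simp [hab]
      · rw [if_neg (by rw [← hab]; simpa [Fin.ext_iff] using h2),
          Equiv.swap_apply_of_ne_of_ne h1 h2]; simp

theorem sW_eq (hr : 2 ≤ r) (j : ℕ) (hj : j ≤ r) (h1 : 1 ≤ j) (y : E r) : sW r j y = sbar j y := by
  have := genF_sbar hr j hj y
  simpa [genF, show j ≠ 0 by omega] using this

theorem sEps1_eq (hr : 2 ≤ r) (y : E r) : sEps1 r y = sbar 0 y := by
  funext m; rw [sbar_zero hr]; rfl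

theorem genF_eq (hr : 2 ≤ r) (j : ℕ) (hj : j ≤ r) (y : E r) :
    genF r j y = y - alphaF r j y • vv r j := by
  rw [genF_sbar hr j hj, alphaF_eq]
  unfold sbar
  by_cases h : j = 0
  · subst h; simp only [if_true, vv]; module
  · simp [h]

theorem genF_add (hr : 2 ≤ r) (j : ℕ) (hj : j ≤ r) (y z : E r) :
    genF r j (y + z) = genF r j y + sbar j z := by
  rw [genF_sbar hr j hj, genF_sbar hr j hj, sbar_add]; abel

theorem alphaF_genF (hr : 2 ≤ r) (j : ℕ) (hj : j ≤ r) (y : E r) :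
    alphaF r j (genF r j y) = - alphaF r j y := by
  rw [genF_eq hr j hj, alphaF_eq, pj_sub, pj_smul, pj_vv hr j hj, alphaF_eq]; ring

theorem genF_genF (hr : 2 ≤ r) (j : ℕ) (hj : j ≤ r) (y : E r) :
    genF r j (genF r j y) = y := by
  rw [genF_eq hr j hj (genF r j y), alphaF_genF hr j hj, genF_eq hr j hj]; simp

/-- each generator is an affine signed permutation -/
theorem genF_signed (hr : 2 ≤ r) (j : ℕ) (hj : j ≤ r) :
    ∃ (π : Fin r → Fin r) (sg sh : Fin r → ℤ),
      (∀ m, π (π m) = m) ∧ (∀ m, sg m = 1 ∨ sg m = -1) ∧ (∀ m, sg (π m) = sg m) ∧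
      (∀ y m, genF r j y m = sg m * y (π m) + sh m) ∧
      (∀ y m, sbar j y m = sg m * y (π m)) := by
  suffices h : ∃ (π : Fin r → Fin r) (sg : Fin r → ℤ),
      (∀ m, π (π m) = m) ∧ (∀ m, sg m = 1 ∨ sg m = -1) ∧ (∀ m, sg (π m) = sg m) ∧
      (∀ (y : E r) m, sbar j y m = sg m * y (π m)) by
    obtain ⟨π, sg, h1, h2, h3, h4⟩ := h
    refine ⟨π, sg, fun m => if j = 0 then (if (m : ℕ) = 0 then 1 else 0) else 0, h1, h2, h3, ?_, h4⟩
    intro y m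
    rw [genF_sbar hr j hj, Pi.add_apply, h4]
    by_cases h : j = 0
    · simp [h, epsV_apply]
    · simp [h]
  refine jcases hr ?_ ?_ ?_ j hj
  · refine ⟨id, fun m => if (m : ℕ) = 0 then -1 else 1, by simp, ?_, by simp, ?_⟩
    · intro m; simp only; split_ifs <;> simp
    · intro y m; rw [sbar_zero hr]; simp only; split_ifs <;> simp
  · refine ⟨id, fun m => if (m : ℕ) + 1 = r then -1 else 1, by simp, ?_, by simp, ?_⟩
    · intro m; simp only; split_ifs <;> simp
    · intro y m; rw [sbar_last hr]; simp only; split_ifs <;> simp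
  · intro a b hab
    refine ⟨Equiv.swap a b, fun _ => 1, by simp, by simp, by simp, ?_⟩
    intro y m; rw [sbar_mid a b hab]; simp

/-- affine roots with their coroots -/
def RootF (f : E r → ℝ) (v : E r) : Prop :=
  ∃ (a b : Fin r) (e d n : ℤ), (e = 1 ∨ e = -1) ∧ (d = 1 ∨ d = -1) ∧ (a = b → e = d) ∧
    (∀ y, f y = e * y a + d * y b + n) ∧
    v = if a = b then (e : ℝ) • eV r a else (e : ℝ) • eV r a + (d : ℝ) • eV r b

/-- affine reflection -/
def rf (f : E r → ℝ) (v : E r) (y : E r) : E r := y - f y • v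

theorem RootF.comp (hr : 2 ≤ r) (j : ℕ) (hj : j ≤ r) {f : E r → ℝ} {v : E r} (h : RootF f v) :
    RootF (fun y => f (genF r j y)) (sbar j v) := by
  obtain ⟨a, b, e, d, n, he, hd, hab, hf, hv⟩ := h
  obtain ⟨π, sg, sh, h1, h2, h3, h4, h5⟩ := genF_signed hr j hj
  have hE : ∀ a : Fin r, sbar j (eV r a) = (sg a : ℝ) • eV r (π a) := by
    intro a
    funext m
    rw [h5]
    simp only [eV, Pi.smul_apply, smul_eq_mul]
    by_cases hm : π m = a
    · have : m = π a := by rw [← hm, h1]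
      rw [if_pos hm, if_pos this, this, h3]
    · have : m ≠ π a := by intro h; exact hm (by rw [h, h1])
      rw [if_neg hm, if_neg this]; simp
  have hinj : ∀ {a b}, π a = π b ↔ a = b := by
    intro a b
    constructor
    · intro h; rw [← h1 a, h, h1]
    · rintro rfl; rfl
  refine ⟨π a, π b, e * sg a, d * sg b, n + e * sh a + d * sh b, ?_, ?_, ?_, ?_, ?_⟩
  · rcases he with rfl | rfl <;> rcases h2 a with h | h <;> simp [h]
  · rcases hd with rfl | rfl <;> rcases h2 b with h | h <;> simp [h]
  · intro h
    have := hinj.1 h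
    subst this
    rw [hab rfl]
  · intro y; show f (genF r j y) = _; rw [hf, h4, h4]; push_cast; ring
  · rw [hv]
    simp only [hinj]
    split_ifs with h
    · rw [sbar_smul, hE, smul_smul]; push_cast; rfl
    · rw [sbar_add, sbar_smul, sbar_smul, hE, hE, smul_smul, smul_smul]; push_cast; rfl

theorem rf_comp (hr : 2 ≤ r) (j : ℕ) (hj : j ≤ r) (f : E r → ℝ) (v y : E r) :
    genF r j (rf (fun y => f (genF r j y)) (sbar j v) y) = rf f v (genF r j y) := by
  unfold rf
  rw [sub_eq_add_neg, genF_add hr j hj, sbar_neg, sbar_smul, sbar_sbar hr j hj, ← sub_eq_add_neg]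

theorem RootF.dichot {f : E r → ℝ} {v : E r} (h : RootF f v) :
    (∀ y ∈ CplusCl r, 0 ≤ f y) ∨ (∀ y ∈ CplusCl r, f y ≤ 0) := by
  obtain ⟨a, b, e, d, n, he, hd, hab, hf, hv⟩ := h
  have key : ∀ y ∈ CplusCl r, 0 ≤ y a ∧ y a ≤ 1/2 ∧ 0 ≤ y b ∧ y b ≤ 1/2 ∧
      ((a ≤ b ∧ y b ≤ y a) ∨ (b ≤ a ∧ y a ≤ y b)) := by
    intro y hy
    refine ⟨(hy.2 a).1, (hy.2 a).2, (hy.2 b).1, (hy.2 b).2, ?_⟩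
    rcases le_total a b with h | h
    · exact Or.inl ⟨h, hy.1 _ _ h⟩
    · exact Or.inr ⟨h, hy.1 _ _ h⟩
  have hn : ∀ N : ℤ, (N : ℝ) ≤ n ∨ (n : ℝ) ≤ N - 1 := by
    intro N
    rcases le_or_gt N n with h | h
    · left; exact_mod_cast h
    · right; have : n ≤ N - 1 := by omega
      exact_mod_cast this
  rcases he with rfl | rfl <;> rcases hd with rfl | rfl
  · rcases hn 0 with h | h
    · left; intro y hy; have := key y hy; rw [hf]; push_cast at *; linarith
    · right; intro y hy; have := key y hy; rw [hf]; push_cast at *; linarith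
  · rcases le_total a b with hl | hl
    · rcases hn 0 with h | h
      · left; intro y hy; have := hy.1 _ _ hl; have := key y hy; rw [hf]; push_cast at *; linarith
      · right; intro y hy; have := hy.1 _ _ hl;have := key y hy; rw [hf]; push_cast at *; linarith
    · rcases hn 1 with h | h
      · left; intro y hy; have := hy.1 _ _ hl; have := key y hy; rw [hf]; push_cast at *; linarith
      · right; intro y hy; have := hy.1 _ _ hl;have := key y hy; rw [hf]; push_cast at *; linarith
  · rcases le_total b a with hl | hl
    · rcases hn 0 with h | h
      · left; intro y hy; have := hy.1 _ _ hl; have := key y hy; rw [hf]; push_cast at *; linarith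
      · right; intro y hy; have := hy.1 _ _ hl;have := key y hy; rw [hf]; push_cast at *; linarith
    · rcases hn 1 with h | h
      · left; intro y hy; have := hy.1 _ _ hl; have := key y hy; rw [hf]; push_cast at *; linarith
      · right; intro y hy; have := hy.1 _ _ hl;have := key y hy; rw [hf]; push_cast at *; linarith
  · rcases hn 1 with h | h
    · left; intro y hy; have := key y hy; rw [hf]; push_cast at *; linarith
    · right; intro y hy; have := key y hy; rw [hf]; push_cast at *; linarith

variable (r) in
/-- vertices of the closed alcove -/
def vtx (m : ℕ) : E r := fun i => if (i : ℕ) < m then 1 / 2 else 0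

theorem vtx_mem (m : ℕ) : vtx r m ∈ CplusCl r := by
  constructor
  · intro i j hij
    unfold vtx
    have : (i : ℕ) ≤ j := hij
    split_ifs <;> first | omega | norm_num
  · intro i; unfold vtx; split_ifs <;> norm_num

theorem alphaF_vtx (hr : 2 ≤ r) (j : ℕ) (hj : j ≤ r) (m : ℕ) (hm : m ≤ r) (hjm : m ≠ j) :
    alphaF r j (vtx r m) = 0 := by
  rw [alphaF_eq]
  revert hjm
  refine jcases hr ?_ ?_ ?_ j hj
  · intro h
    simp only [pj, if_true]
    rw [cd_fin _ ⟨0, by omega⟩ 1 rfl]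
    simp [vtx, show 0 < m by omega]
  · intro h
    have h0 : r ≠ 0 := by omega
    simp only [pj, if_true, if_neg h0]
    rw [cd_fin _ ⟨r - 1, by omega⟩ r (by simp; omega)]
    simp [vtx]; omega
  · intro a b hab h
    rw [pj_mid a b hab]
    simp only [vtx, Nat.succ_ne_zero, if_false, hab]
    split_ifs <;> first | omega | simp

theorem rf_neg (f : E r → ℝ) (v y : E r) : rf (fun y => - f y) (-v) y = rf f v y := by
  unfold rf; simp

theorem root_arith {j a b : ℕ} {e d n : ℤ} (hr : 2 ≤ r) (ha : a < r) (hb : b < r)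
    (he : e = 1 ∨ e = -1) (hd : d = 1 ∨ d = -1) (hab : a = b → e = d)
    (q0 : 0 ≠ j → e * (if a < 0 then 1 else 0) + d * (if b < 0 then 1 else 0) + 2 * n = 0)
    (q1 : r ≠ j → e * (if a < r then 1 else 0) + d * (if b < r then 1 else 0) + 2 * n = 0)
    (q2 : a ≠ j → e * (if a < a then 1 else 0) + d * (if b < a then 1 else 0) + 2 * n = 0)
    (q3 : a + 1 ≠ j → e * (if a < a + 1 then 1 else 0) + d * (if b < a + 1 then 1 else 0) + 2 * n = 0)
    (q4 : b ≠ j → e * (if a < b then 1 else 0) + d * (if b < b then 1 else 0) + 2 * n = 0)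
    (q5 : b + 1 ≠ j → e * (if a < b + 1 then 1 else 0) + d * (if b < b + 1 then 1 else 0) + 2 * n = 0) :
    (j = 0 ∧ a = b ∧ a = 0 ∧ n = -e) ∨ (j = r ∧ a = b ∧ a + 1 = r ∧ n = 0) ∨
      (j = a + 1 ∧ b = a + 1 ∧ d = -e ∧ n = 0) ∨ (j = b + 1 ∧ a = b + 1 ∧ d = -e ∧ n = 0) := by
  simp only [not_lt_zero, if_false, ha, hb, if_true, lt_irrefl, lt_add_one, mul_one, mul_zero,
    zero_add] at q0 q1 q2 q3 q4 q5
  rcases lt_trichotomy a b with h | h | h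
  · right; right; left
    simp only [h, not_lt.2 h.le, if_true, if_false, not_lt.2 (show a + 1 ≤ b from h),
      show a < b + 1 by omega, mul_one, mul_zero, zero_add, add_zero] at q2 q3 q4 q5
    have h1 : a + 1 = j := by
      by_contra h1
      have := q3 h1
      omega
    have h2 : b = j := by
      by_contra h1
      have := q4 h1
      omega
    have := q0 (by omega)
    have := q1 (by omega)
    omega
  · have := hab h
    subst h
    simp only [lt_irrefl, if_false, lt_add_one, if_true, mul_one, mul_zero, zero_add] at q2 q3 q4 q5
    by_cases h1 : a + 1 = j
    · have := q0 (by omega)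
      right; left
      by_cases h2 : r = j
      · omega
      · have := q1 h2; omega
    · have h3 := q3 h1
      left
      have h4 : a = j := by
        by_contra h4
        have := q2 h4
        omega
      have h5 : 0 = j := by
        by_contra h4
        have := q0 h4
        omega
      omega
  · right; right; right
    simp only [h, not_lt.2 h.le, if_true, if_false, not_lt.2 (show b + 1 ≤ a from h),
      show b < a + 1 by omega, mul_one, mul_zero, zero_add, add_zero] at q2 q3 q4 q5
    have h1 : b + 1 = j := by
      by_contra h1
      have := q5 h1
      omega
    have h2 : a = j := by
      by_contra h1
      have := q2 h1
      omega
    have := q0 (by omega)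
    have := q1 (by omega)
    omega

theorem root_key (hr : 2 ≤ r) (j : ℕ) (hj : j ≤ r) {f : E r → ℝ} {v : E r} (h : RootF f v)
    (h1 : ∀ y ∈ CplusCl r, 0 ≤ f y) (h2 : ∀ y ∈ CplusCl r, f (genF r j y) ≤ 0) (y : E r) :
    rf f v y = genF r j y := by
  obtain ⟨a, b, e, d, n, he, hd, hab, hf, hv⟩ := h
  have h0 : ∀ m ≤ r, m ≠ j → f (vtx r m) = 0 := by
    intro m hm hmj
    apply le_antisymm _ (h1 _ (vtx_mem m))
    have := h2 _ (vtx_mem m)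
    rwa [genF_eq hr j hj, alphaF_vtx hr j hj m hm hmj, zero_smul, sub_zero] at this
  have h3 : ∀ m ≤ r, m ≠ j →
      e * (if (a : ℕ) < m then 1 else 0) + d * (if (b : ℕ) < m then 1 else 0) + 2 * n = 0 := by
    intro m hm hmj
    have := h0 m hm hmj
    rw [hf] at this
    unfold vtx at this
    have h' : ((e * (if (a : ℕ) < m then 1 else 0) + d * (if (b : ℕ) < m then 1 else 0) + 2 * n : ℤ)
      : ℝ) = 0 := by
      push_cast
      split_ifs at this ⊢ <;> linarith
    exact_mod_cast h'
  have ha := a.2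
  have hb := b.2
  have q0 := h3 0 (by omega)
  have q1 := h3 r (by omega)
  have q2 := h3 a (by omega)
  have q3 := h3 (a+1) (by omega)
  have q4 := h3 b (by omega)
  have q5 := h3 (b+1) (by omega)
  have hab' : (a : ℕ) = b → e = d := fun h => hab (Fin.ext h)
  have main : (j = 0 ∧ (a : ℕ) = b ∧ (a : ℕ) = 0 ∧ n = -e) ∨
      (j = r ∧ (a : ℕ) = b ∧ (a : ℕ) + 1 = r ∧ n = 0) ∨
      (j = a + 1 ∧ (b : ℕ) = a + 1 ∧ d = -e ∧ n = 0) ∨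
      (j = b + 1 ∧ (a : ℕ) = b + 1 ∧ d = -e ∧ n = 0) := by
    clear h3 h0 h1 h2 hf hv hab
    exact root_arith hr ha hb he hd hab' q0 q1 q2 q3 q4 q5
  rcases main with ⟨rfl, h4, h5, h6⟩ | ⟨rfl, h4, h5, h6⟩ | ⟨rfl, h4, h5, h6⟩ | ⟨rfl, h4, h5, h6⟩
  · have := Fin.ext h4
    subst this
    have hde := hab rfl
    subst hde
    rw [genF_eq hr 0 hj]
    unfold rf
    rw [hf, hv, alphaF_eq]
    simp only [if_true, pj, vv]
    rw [cd_fin y a 1 (by omega)]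
    have hev : eV r a = epsV r 1 := by
      funext m; simp only [eV, epsV_apply, Fin.ext_iff, h5]; congr 1; simp
    rw [hev]
    rcases he with rfl | rfl <;> subst h6 <;> push_cast <;> module
  · have := Fin.ext h4
    subst this
    have hde := hab rfl
    subst hde
    rw [genF_eq hr j hj]
    unfold rf
    rw [hf, hv, alphaF_eq]
    have hj0 : j ≠ 0 := by omega
    simp only [if_true, pj, vv, hj0, if_false]
    rw [cd_fin y a j (by omega)]
    have hev : eV j a = epsV j j := by
      funext m; simp only [eV, epsV_apply, Fin.ext_iff]
      congr 1; simp only [eq_iff_iff]; omega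
    rw [hev]
    rcases he with rfl | rfl <;> subst h6 <;> push_cast <;> module
  · rw [genF_eq hr _ hj]
    unfold rf
    rw [hf, hv, alphaF_eq, vv_mid a b h4, pj_mid a b h4]
    have hne : a ≠ b := by intro h; rw [h] at h4; omega
    simp only [hne, if_false, Nat.succ_ne_zero]
    rcases he with rfl | rfl <;> subst h6 <;> subst h5 <;> push_cast <;> module
  · rw [genF_eq hr _ hj]
    unfold rf
    rw [hf, hv, alphaF_eq, vv_mid b a h4, pj_mid b a h4]
    have hne : a ≠ b := by intro h; rw [h] at h4; omega
    simp only [hne, if_false, Nat.succ_ne_zero]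
    rcases he with rfl | rfl <;> subst h6 <;> subst h5 <;> push_cast <;> module

end geometry


section words
variable {r}

theorem wordAct_cons (j : ℕ) (l : List ℕ) (y : E r) :
    wordAct r (j :: l) y = genF r j (wordAct r l y) := rfl

theorem wordAct_nil (y : E r) : wordAct r [] y = y := rfl

theorem wordAct_append (l l' : List ℕ) (y : E r) :
    wordAct r (l ++ l') y = wordAct r l (wordAct r l' y) := by
  unfold wordAct; rw [List.foldr_append]

/-- words in the generators -/
def Wd (r : ℕ) (l : List ℕ) : Prop := ∀ a ∈ l, a ≤ r

theorem Wd.cons {j : ℕ} {l : List ℕ} (hj : j ≤ r) (h : Wd r l) : Wd r (j :: l) := by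
  intro a ha
  rcases List.mem_cons.1 ha with rfl | h'
  · exact hj
  · exact h a h'

theorem Wd.head {j : ℕ} {l : List ℕ} (h : Wd r (j :: l)) : j ≤ r := h j (by simp)

theorem Wd.tail {j : ℕ} {l : List ℕ} (h : Wd r (j :: l)) : Wd r l :=
  fun a ha => h a (by simp [ha])

theorem Wd.append {l l' : List ℕ} (h : Wd r l) (h' : Wd r l') : Wd r (l ++ l') := by
  intro a ha
  rcases List.mem_append.1 ha with h1 | h1
  · exact h a h1
  · exact h' a h1

theorem Wd.reverse {l : List ℕ} (h : Wd r l) : Wd r l.reverse :=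
  fun a ha => h a (by simpa using ha)

theorem Wd.sublist {l l' : List ℕ} (h : Wd r l) (h' : l'.Sublist l) : Wd r l' :=
  fun a ha => h a (h'.subset ha)

theorem wordAct_reverse (hr : 2 ≤ r) : ∀ (l : List ℕ), Wd r l → ∀ y : E r,
    wordAct r l.reverse (wordAct r l y) = y
  | [], _, y => rfl
  | j :: l, h, y => by
    rw [List.reverse_cons, wordAct_append, wordAct_cons, wordAct_cons, wordAct_nil,
      genF_genF hr j h.head, wordAct_reverse hr l h.tail]

theorem wordAct_reverse' (hr : 2 ≤ r) (l : List ℕ) (h : Wd r l) (y : E r) :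
    wordAct r l (wordAct r l.reverse y) = y := by
  have := wordAct_reverse hr l.reverse h.reverse y
  rwa [List.reverse_reverse] at this

theorem exchange (hr : 2 ≤ r) {c : E r} (hc : c ∈ CplusCl r) : ∀ (l : List ℕ), Wd r l →
    ∀ (f : E r → ℝ) (v : E r), RootF f v → (∀ y ∈ CplusCl r, 0 ≤ f y) → f (wordAct r l c) < 0 →
    ∃ l' : List ℕ, l'.Sublist l ∧ l'.length + 1 = l.length ∧
      ∀ z, wordAct r l' z = rf f v (wordAct r l z)
  | [], _, f, v, _, h0, hlt => absurd (h0 c hc) (not_le.2 hlt)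
  | j :: l, hl, f, v, hf, h0, hlt => by
    have hf' := hf.comp hr j hl.head
    by_cases hd : ∀ y ∈ CplusCl r, f (genF r j y) ≤ 0
    · refine ⟨l, List.sublist_cons_self j l, rfl, ?_⟩
      intro z
      rw [root_key hr j hl.head hf h0 hd, wordAct_cons, genF_genF hr j hl.head]
    · have h1 := hf'.dichot.resolve_right hd
      obtain ⟨l', h2, h3, h4⟩ := exchange hr hc l hl.tail _ _ hf' h1 hlt
      refine ⟨j :: l', h2.cons_cons j, by simp [h3], ?_⟩
      intro z
      rw [wordAct_cons, h4, rf_comp hr j hl.head, wordAct_cons]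

theorem alphaF_root (hr : 2 ≤ r) (j : ℕ) (hj : j ≤ r) : RootF (alphaF r j) (vv r j) := by
  have key : RootF (fun y => pj j y + if j = 0 then 1 else 0) (vv r j) := by
    refine jcases hr ?_ ?_ ?_ j hj
    · refine ⟨⟨0, by omega⟩, ⟨0, by omega⟩, -1, -1, 1, by simp, by simp, by simp, ?_, ?_⟩
      · intro y
        simp only [pj, if_true]
        rw [cd_fin y ⟨0, by omega⟩ 1 rfl]; push_cast; ring
      · simp only [vv, if_true]
        funext m
        simp [epsV_apply, eV, Fin.ext_iff]
        split_ifs <;> simp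
    · have h0 : r ≠ 0 := by omega
      refine ⟨⟨r - 1, by omega⟩, ⟨r - 1, by omega⟩, 1, 1, 0, by simp, by simp, by simp, ?_, ?_⟩
      · intro y
        simp only [pj, if_true, h0, if_false]
        rw [cd_fin y ⟨r - 1, by omega⟩ r (by simp; omega)]; push_cast; ring
      · simp only [vv, if_true, h0, if_false]
        funext m
        simp only [epsV_apply, eV, Fin.ext_iff, Pi.smul_apply]
        have : ((m : ℕ) + 1 = r) ↔ ((m : ℕ) = r - 1) := by omega
        simp [this]
    · intro a b hab
      have hne : a ≠ b := by intro h; rw [h] at hab; omega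
      refine ⟨a, b, 1, -1, 0, by simp, by simp, fun h => absurd h hne, ?_, ?_⟩
      · intro y
        simp only [pj_mid a b hab]; simp; ring
      · rw [vv_mid a b hab, if_neg hne]; simp [sub_eq_add_neg]
  have : alphaF r j = fun y => pj j y + if j = 0 then 1 else 0 := funext (alphaF_eq j)
  rw [this]; exact key

theorem alphaF_nonneg (hr : 2 ≤ r) (j : ℕ) (hj : j ≤ r) (y : E r) (hy : y ∈ CplusCl r) :
    0 ≤ alphaF r j y := by
  rw [alphaF_eq]
  refine jcases hr ?_ ?_ ?_ j hj
  · simp only [pj, if_true]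
    rw [cd_fin y ⟨0, by omega⟩ 1 rfl]
    have := hy.2 ⟨0, by omega⟩; linarith
  · have h0 : r ≠ 0 := by omega
    simp only [pj, if_true, h0, if_false]
    rw [cd_fin y ⟨r - 1, by omega⟩ r (by simp; omega)]
    have := hy.2 ⟨r - 1, by omega⟩; linarith
  · intro a b hab
    rw [pj_mid a b hab]
    have := hy.1 a b (by show (a : ℕ) ≤ b; omega)
    simp; linarith

theorem mem_C (hr : 2 ≤ r) (y : E r) (h : ∀ j ≤ r, 0 ≤ alphaF r j y) : y ∈ CplusCl r := by
  have h1 : ∀ n (a : Fin r), ∀ b : Fin r, (b : ℕ) = a + n → y b ≤ y a := by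
    intro n
    induction n with
    | zero => intro a b hab; rw [show b = a from Fin.ext (by omega)]
    | succ n ih =>
      intro a b hab
      have hb := b.2
      have h2 := ih a ⟨a + n, by omega⟩ rfl
      have h3 := h (a + n + 1) (by omega)
      rw [alphaF_eq, pj_mid ⟨a + n, by omega⟩ b (by simp; omega)] at h3
      simp at h3
      linarith
  have h2 : ∀ a b : Fin r, a ≤ b → y b ≤ y a := fun a b hab =>
    h1 (b - a) a b (by have : (a : ℕ) ≤ b := hab; omega)
  refine ⟨h2, ?_⟩
  intro m
  have h3 := h 0 (by omega)
  have h4 := h r le_rfl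
  have h0 : r ≠ 0 := by omega
  rw [alphaF_eq] at h3 h4
  simp only [pj, if_true, h0, if_false] at h3 h4
  rw [cd_fin y ⟨0, by omega⟩ 1 rfl] at h3
  rw [cd_fin y ⟨r - 1, by omega⟩ r (by simp; omega)] at h4
  have h5 := h2 ⟨0, by omega⟩ m (by show 0 ≤ (m : ℕ); omega)
  have h6 := h2 m ⟨r - 1, by omega⟩ (by show (m : ℕ) ≤ r - 1; omega)
  constructor <;> linarith

theorem rf_alpha (hr : 2 ≤ r) (j : ℕ) (hj : j ≤ r) (y : E r) :
    rf (alphaF r j) (vv r j) y = genF r j y := (genF_eq hr j hj y).symm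

/-- a word of minimal length among those with the same end point -/
def IsMin (c : E r) (l : List ℕ) : Prop :=
  Wd r l ∧ ∀ l' : List ℕ, Wd r l' → wordAct r l' c = wordAct r l c → l.length ≤ l'.length

theorem genF_fix (hr : 2 ≤ r) (j : ℕ) (hj : j ≤ r) (y : E r) (h : alphaF r j y = 0) :
    genF r j y = y := by rw [genF_eq hr j hj, h]; simp

theorem exch_alpha (hr : 2 ≤ r) {c : E r} (hc : c ∈ CplusCl r) {l : List ℕ} (hl : Wd r l)
    {j : ℕ} (hj : j ≤ r) (h : alphaF r j (wordAct r l c) < 0) :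
    ∃ l' : List ℕ, l'.Sublist l ∧ l'.length + 1 = l.length ∧
      ∀ z, wordAct r l' z = genF r j (wordAct r l z) := by
  obtain ⟨l', h1, h2, h3⟩ := exchange hr hc l hl _ _ (alphaF_root hr j hj)
    (alphaF_nonneg hr j hj) h
  exact ⟨l', h1, h2, fun z => by rw [h3, rf_alpha hr j hj]⟩

theorem IsMin.tail (_hr : 2 ≤ r) {c : E r} {j : ℕ} {l : List ℕ} (h : IsMin c (j :: l)) : IsMin c l := by
  refine ⟨h.1.tail, fun l' hl' he => ?_⟩
  have := h.2 (j :: l') (Wd.cons h.1.head hl') (by rw [wordAct_cons, he, wordAct_cons])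
  simpa using this

theorem IsMin.pos (hr : 2 ≤ r) {c : E r} (hc : c ∈ CplusCl r) {j : ℕ} {l : List ℕ}
    (h : IsMin c (j :: l)) : 0 < alphaF r j (wordAct r l c) := by
  by_contra hn
  rcases (not_lt.1 hn).lt_or_eq with h1 | h1
  · obtain ⟨l', h2, h3, h4⟩ := exch_alpha hr hc h.1.tail h.1.head h1
    have := h.2 l' (h.1.tail.sublist h2) (by rw [h4, wordAct_cons])
    simp at this; omega
  · have := h.2 l h.1.tail (by rw [wordAct_cons, genF_fix hr _ h.1.head _ h1])
    simp at this

theorem IsMin.cons (hr : 2 ≤ r) {c : E r} (hc : c ∈ CplusCl r) {j : ℕ} {l : List ℕ} (hj : j ≤ r)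
    (h : IsMin c l) (hp : 0 < alphaF r j (wordAct r l c)) : IsMin c (j :: l) := by
  refine ⟨Wd.cons hj h.1, fun n hn he => ?_⟩
  rw [wordAct_cons] at he
  have h1 : alphaF r j (wordAct r n c) < 0 := by rw [he, alphaF_genF hr j hj]; linarith
  obtain ⟨n', h2, h3, h4⟩ := exch_alpha hr hc hn hj h1
  have := h.2 n' (hn.sublist h2) (by rw [h4, he, genF_genF hr j hj])
  simp; omega

theorem prune (hr : 2 ≤ r) {c : E r} (hc : c ∈ CplusCl r) : ∀ (l : List ℕ), Wd r l →
    ∃ l' : List ℕ, l'.Sublist l ∧ IsMin c l' ∧ wordAct r l' c = wordAct r l c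
  | [], _ => ⟨[], List.Sublist.refl _, ⟨by simp [Wd], by simp⟩, rfl⟩
  | j :: l, hl => by
    obtain ⟨m, h1, h2, h3⟩ := prune hr hc l hl.tail
    rcases lt_trichotomy (alphaF r j (wordAct r m c)) 0 with h | h | h
    · obtain ⟨m', h4, h5, h6⟩ := exch_alpha hr hc h2.1 hl.head h
      refine ⟨m', (h4.trans h1).cons j, ⟨h2.1.sublist h4, ?_⟩, by rw [h6, h3, wordAct_cons]⟩
      intro n hn he
      have := h2.2 (j :: n) (Wd.cons hl.head hn)
        (by rw [wordAct_cons, he, h6, genF_genF hr j hl.head])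
      simp at this; omega
    · exact ⟨m, h1.cons j, h2, by rw [wordAct_cons, ← h3, genF_fix hr j hl.head _ h]⟩
    · exact ⟨j :: m, h1.cons_cons j, h2.cons hr hc hl.head h, by rw [wordAct_cons, h3, wordAct_cons]⟩

theorem C_unique (hr : 2 ≤ r) {c : E r} (hc : c ∈ CplusCl r) (l : List ℕ) (hl : Wd r l)
    (h : wordAct r l c ∈ CplusCl r) : wordAct r l c = c := by
  obtain ⟨m, h1, h2, h3⟩ := prune hr hc l hl
  rw [← h3] at h ⊢
  cases m with
  | nil => rfl
  | cons j m =>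
    have h4 := h2.pos hr hc
    have h5 := alphaF_nonneg hr j h2.1.head _ h
    rw [wordAct_cons, alphaF_genF hr j h2.1.head] at h5
    linarith

theorem min_unique (hr : 2 ≤ r) {c : E r} (hc : c ∈ CplusCl r) : ∀ (l l' : List ℕ), IsMin c l →
    IsMin c l' → wordAct r l c = wordAct r l' c → ∀ z, wordAct r l z = wordAct r l' z
  | [], l', h, h', he, z => by
    have := h'.2 [] (by simp [Wd]) he
    simp at this
    rw [this]
  | j :: l, l', h, h', he, z => by
    have h1 := h.pos hr hc
    have h2 : alphaF r j (wordAct r l' c) < 0 := by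
      rw [← he, wordAct_cons, alphaF_genF hr j h.1.head]; linarith
    obtain ⟨n, h3, h4, h5⟩ := exch_alpha hr hc h'.1 h.1.head h2
    have h6 : IsMin c n := by
      refine ⟨h'.1.sublist h3, fun p hp hpe => ?_⟩
      have := h'.2 (j :: p) (Wd.cons h.1.head hp)
        (by rw [wordAct_cons, hpe, h5, genF_genF hr j h.1.head])
      simp at this; omega
    have h7 := min_unique hr hc l n (h.tail hr) h6
      (by rw [h5, ← he, wordAct_cons, genF_genF hr j h.1.head])
    rw [wordAct_cons, h7, h5, genF_genF hr j h.1.head]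

theorem orbit_self (y : E r) : y ∈ orbit r y := ⟨[], by simp, rfl⟩

theorem coord_form (hr : 2 ≤ r) (y : E r) : ∀ l : List ℕ, Wd r l → ∀ m : Fin r,
    ∃ (i : Fin r) (n : ℤ), wordAct r l y m = y i + n ∨ wordAct r l y m = - y i + n
  | [], _, m => ⟨m, 0, Or.inl (by simp [wordAct_nil])⟩
  | j :: l, hl, m => by
    obtain ⟨π, sg, sh, h1, h2, h3, h4, h5⟩ := genF_signed hr j hl.head
    obtain ⟨i, n, h⟩ := coord_form hr y l hl.tail (π m)
    rw [wordAct_cons, h4]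
    rcases h2 m with h6 | h6 <;> rcases h with h | h <;> rw [h6, h]
    · exact ⟨i, n + sh m, Or.inl (by push_cast; ring)⟩
    · exact ⟨i, n + sh m, Or.inr (by push_cast; ring)⟩
    · exact ⟨i, -n + sh m, Or.inr (by push_cast; ring)⟩
    · exact ⟨i, -n + sh m, Or.inl (by push_cast; ring)⟩

theorem int_near_finite (x B : ℝ) : {n : ℤ | |x + n| ≤ B}.Finite := by
  apply (Set.finite_Icc ⌊-B - x⌋ ⌈B - x⌉).subset
  intro n hn
  have hn' : |x + n| ≤ B := hn
  rw [abs_le] at hn'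
  constructor
  · have : ((⌊-B - x⌋ : ℤ) : ℝ) ≤ n := (Int.floor_le _).trans (by linarith)
    exact_mod_cast this
  · have : (n : ℝ) ≤ ((⌈B - x⌉ : ℤ) : ℝ) := le_trans (by linarith) (Int.le_ceil _)
    exact_mod_cast this

theorem orbit_box_finite (hr : 2 ≤ r) (y : E r) (B : ℝ) :
    {z | z ∈ orbit r y ∧ ∀ m, |z m| ≤ B}.Finite := by
  have h1 : {x : ℝ | ∃ i : Fin r, ∃ n : ℤ, (x = y i + n ∨ x = - y i + n) ∧ |x| ≤ B}.Finite := by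
    have : {x : ℝ | ∃ i : Fin r, ∃ n : ℤ, (x = y i + n ∨ x = - y i + n) ∧ |x| ≤ B} ⊆
        ⋃ i : Fin r, ((fun n : ℤ => y i + n) '' {n : ℤ | |y i + n| ≤ B} ∪
          (fun n : ℤ => - y i + n) '' {n : ℤ | |- y i + n| ≤ B}) := by
      rintro x ⟨i, n, h | h, hB⟩
      · exact Set.mem_iUnion.2 ⟨i, Or.inl ⟨n, by simpa [h] using hB, h.symm⟩⟩
      · exact Set.mem_iUnion.2 ⟨i, Or.inr ⟨n, by simpa [h] using hB, h.symm⟩⟩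
    apply Set.Finite.subset _ this
    apply Set.finite_iUnion
    intro i
    exact ((int_near_finite _ _).image _).union ((int_near_finite _ _).image _)
  apply (Set.Finite.pi' (fun _ : Fin r => h1)).subset
  rintro z ⟨⟨l, hl, rfl⟩, hz⟩ m
  obtain ⟨i, n, h⟩ := coord_form hr y l hl m
  exact ⟨i, n, h, hz m⟩

/-- squared distance to an interior point of the alcove -/
def dst (y : E r) : ℝ := ∑ m : Fin r, (y m - (r - m : ℝ) / (2 * r + 2)) ^ 2

theorem dst_decr (hr : 2 ≤ r) (j : ℕ) (hj : j ≤ r) (y : E r) (h : alphaF r j y < 0) :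
    dst (genF r j y) < dst y := by
  have hrr : (2 : ℝ) ≤ r := by exact_mod_cast hr
  rw [alphaF_eq] at h
  revert h
  refine jcases hr ?_ ?_ ?_ j hj
  · intro h
    simp only [pj, if_true] at h
    rw [cd_fin y ⟨0, by omega⟩ 1 rfl] at h
    unfold dst
    apply Finset.sum_lt_sum
    · intro m _
      by_cases hm : (m : ℕ) = 0
      · have : m = ⟨0, by omega⟩ := Fin.ext hm
        rw [← this] at h
        simp only [genF, if_true, hm]
        have h1 : ((r : ℝ) - ((0 : ℕ) : ℝ)) / (2 * r + 2) < 1 / 2 := by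
          rw [div_lt_div_iff₀ (by positivity) (by norm_num)]; simp; linarith
        set u := ((r : ℝ) - ((0 : ℕ) : ℝ)) / (2 * r + 2)
        nlinarith
      · simp [genF, hm]
    · refine ⟨⟨0, by omega⟩, Finset.mem_univ _, ?_⟩
      simp only [genF, if_true]
      have h1 : ((r : ℝ) - ((0 : ℕ) : ℝ)) / (2 * r + 2) < 1 / 2 := by
        rw [div_lt_div_iff₀ (by positivity) (by norm_num)]; simp; linarith
      set u := ((r : ℝ) - ((0 : ℕ) : ℝ)) / (2 * r + 2)
      nlinarith
  · intro h
    have h0 : r ≠ 0 := by omega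
    simp only [pj, if_true, h0, if_false] at h
    rw [cd_fin y ⟨r - 1, by omega⟩ r (by simp; omega)] at h
    rw [genF_sbar hr r le_rfl]
    simp only [h0, if_false, add_zero]
    have key : ∀ m : Fin r, (m : ℕ) + 1 = r → y m < 0 ∧ 0 < ((r : ℝ) - m) / (2 * r + 2) := by
      intro m hm
      have : m = ⟨r - 1, by omega⟩ := Fin.ext (by simp; omega)
      rw [← this] at h
      refine ⟨by linarith, div_pos ?_ (by positivity)⟩
      have : (m : ℝ) + 1 = r := by exact_mod_cast hm
      linarith
    unfold dst
    apply Finset.sum_lt_sum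
    · intro m _
      rw [sbar_last hr]
      split_ifs with hm
      · have := key m hm
        nlinarith [mul_pos_of_neg_of_neg this.1 (neg_lt_zero.2 this.2)]
      · exact le_rfl
    · refine ⟨⟨r - 1, by omega⟩, Finset.mem_univ _, ?_⟩
      have hm : ((⟨r - 1, by omega⟩ : Fin r) : ℕ) + 1 = r := by simp; omega
      rw [sbar_last hr, if_pos hm]
      have := key _ hm
      nlinarith [mul_pos_of_neg_of_neg this.1 (neg_lt_zero.2 this.2)]
  · intro a b hab h
    have hb := b.2
    have hne : a ≠ b := by intro h; rw [h] at hab; omega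
    rw [pj_mid a b hab] at h
    simp only [Nat.succ_ne_zero, if_false, add_zero] at h
    rw [genF_sbar hr _ (by omega)]
    simp only [Nat.succ_ne_zero, if_false, add_zero]
    unfold dst
    simp only [sbar_mid a b hab]
    rw [← Finset.add_sum_erase _ _ (Finset.mem_univ a),
      ← Finset.add_sum_erase _ _ (Finset.mem_univ a),
      ← Finset.add_sum_erase _ _ (Finset.mem_erase.2 ⟨hne.symm, Finset.mem_univ b⟩),
      ← Finset.add_sum_erase _ _ (Finset.mem_erase.2 ⟨hne.symm, Finset.mem_univ b⟩)]
    rw [← add_assoc, ← add_assoc]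
    apply add_lt_add_of_lt_of_le
    · rw [Equiv.swap_apply_left, Equiv.swap_apply_right]
      have : ((r : ℝ) - b) / (2 * r + 2) < ((r : ℝ) - a) / (2 * r + 2) := by
        apply div_lt_div_of_pos_right _ (by positivity)
        have : (b : ℝ) = a + 1 := by exact_mod_cast hab
        linarith
      nlinarith
    · apply le_of_eq
      apply Finset.sum_congr rfl
      intro m hm
      simp only [Finset.mem_erase, Finset.mem_univ, and_true] at hm
      rw [Equiv.swap_apply_of_ne_of_ne hm.2 hm.1]

theorem orbit_meets (hr : 2 ≤ r) (y : E r) : ∃ c, c ∈ orbit r y ∧ c ∈ CplusCl r := by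
  have hfin : {z | z ∈ orbit r y ∧ dst z ≤ dst y}.Finite := by
    apply (orbit_box_finite hr y (Real.sqrt (dst y) + 1)).subset
    rintro z ⟨h1, h2⟩
    refine ⟨h1, fun m => ?_⟩
    have h3 : (z m - (r - m : ℝ) / (2 * r + 2)) ^ 2 ≤ dst z :=
      Finset.single_le_sum (f := fun m : Fin r => (z m - (r - m : ℝ) / (2 * r + 2)) ^ 2)
        (fun _ _ => sq_nonneg _) (Finset.mem_univ m)
    have h4 := Real.abs_le_sqrt (h3.trans h2)
    have hm : (m : ℝ) < r := by exact_mod_cast m.2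
    have h5 : 0 ≤ (r - m : ℝ) / (2 * r + 2) := div_nonneg (by linarith) (by positivity)
    have h6 : (r - m : ℝ) / (2 * r + 2) ≤ 1 := by
      have : (0 : ℝ) ≤ m := by positivity
      rw [div_le_one (by positivity)]; linarith
    rw [abs_le] at h4 ⊢
    constructor <;> linarith
  obtain ⟨c, ⟨h1, h2⟩, h3⟩ := Set.exists_min_image _ dst hfin ⟨y, orbit_self y, le_rfl⟩
  refine ⟨c, h1, mem_C hr c fun j hj => ?_⟩
  by_contra hn
  have h4 := dst_decr hr j hj c (not_le.1 hn)
  have h5 := h3 (genF r j c) ⟨?_, h4.le.trans h2⟩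
  · linarith
  · obtain ⟨l, hl, rfl⟩ := h1
    exact ⟨j :: l, Wd.cons hj hl, rfl⟩

end words


section orbits
variable {r}

theorem orbit_genF {O : Set (E r)} (hO : IsOrbit r O) {y : E r} (hy : y ∈ O) {j : ℕ} (hj : j ≤ r) :
    genF r j y ∈ O := by
  obtain ⟨x, rfl⟩ := hO
  obtain ⟨l, hl, rfl⟩ := hy
  exact ⟨j :: l, Wd.cons hj hl, rfl⟩

theorem orbit_word {O : Set (E r)} (hO : IsOrbit r O) {y : E r} (hy : y ∈ O) :
    ∀ l : List ℕ, Wd r l → wordAct r l y ∈ O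
  | [], _ => hy
  | _ :: l, hl => orbit_genF hO (orbit_word hO hy l hl.tail) hl.head

theorem orbit_genF_iff (hr : 2 ≤ r) {O : Set (E r)} (hO : IsOrbit r O) {y : E r} {j : ℕ}
    (hj : j ≤ r) : genF r j y ∈ O ↔ y ∈ O := by
  refine ⟨fun h => ?_, fun h => orbit_genF hO h hj⟩
  have := orbit_genF hO h hj
  rwa [genF_genF hr j hj] at this

theorem cpt_mem (hr : 2 ≤ r) {O : Set (E r)} (hO : IsOrbit r O) :
    cpt r O ∈ O ∧ cpt r O ∈ CplusCl r := by
  have h : ∃ c, c ∈ O ∧ c ∈ CplusCl r := by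
    obtain ⟨x, rfl⟩ := hO
    exact orbit_meets hr x
  unfold cpt
  rw [dif_pos h]
  exact h.choose_spec

theorem orbit_from (hr : 2 ≤ r) {O : Set (E r)} (hO : IsOrbit r O) {x y : E r} (hx : x ∈ O)
    (hy : y ∈ O) : ∃ l : List ℕ, Wd r l ∧ wordAct r l x = y := by
  obtain ⟨z, rfl⟩ := hO
  obtain ⟨l, hl, rfl⟩ := hx
  obtain ⟨m, hm, rfl⟩ := hy
  refine ⟨m ++ l.reverse, Wd.append hm (Wd.reverse hl), ?_⟩
  rw [wordAct_append, wordAct_reverse hr l hl]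

theorem gW_spec (hr : 2 ≤ r) {O : Set (E r)} (hO : IsOrbit r O) {y : E r} (hy : y ∈ O) :
    IsMin (cpt r O) (gW r y) ∧ wordAct r (gW r y) (cpt r O) = y := by
  obtain ⟨hc1, hc2⟩ := cpt_mem hr hO
  have hex : ∃ l : List ℕ, (∀ a ∈ l, a ≤ r) ∧ wordAct r l.reverse y ∈ CplusCl r ∧
      ∀ l' : List ℕ, (∀ a ∈ l', a ≤ r) → wordAct r l'.reverse y ∈ CplusCl r →
        l.length ≤ l'.length := by
    have h1 : ∃ n : ℕ, ∃ l : List ℕ, Wd r l ∧ wordAct r l.reverse y ∈ CplusCl r ∧ l.length = n := by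
      obtain ⟨l, hl, he⟩ := orbit_from hr hO hc1 hy
      refine ⟨l.length, l, hl, ?_, rfl⟩
      rw [← he, wordAct_reverse hr l hl]
      exact hc2
    obtain ⟨l, h2, h3, h4⟩ := Nat.find_spec h1
    refine ⟨l, h2, h3, fun l' h5 h6 => ?_⟩
    rw [h4]
    exact Nat.find_min' h1 ⟨l', h5, h6, rfl⟩
  have hs : gW r y = hex.choose := by unfold gW; rw [dif_pos hex]
  obtain ⟨h1, h2, h3⟩ := hex.choose_spec
  rw [← hs] at h1 h2 h3
  have h4 : wordAct r (gW r y).reverse y = cpt r O := by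
    obtain ⟨l, hl, he⟩ := orbit_from hr hO hc1 hy
    have h5 := C_unique hr hc2 ((gW r y).reverse ++ l) ((Wd.reverse h1).append hl)
      (by rw [wordAct_append, he]; exact h2)
    rwa [wordAct_append, he] at h5
  have h5 : wordAct r (gW r y) (cpt r O) = y := by
    rw [← h4, wordAct_reverse' hr _ h1]
  refine ⟨⟨h1, fun l' hl' he => ?_⟩, h5⟩
  apply h3 l' hl'
  rw [← h5, ← he, wordAct_reverse hr l' hl']
  exact hc2

theorem gfun_of_min (hr : 2 ≤ r) {O : Set (E r)} (hO : IsOrbit r O) {y : E r} (hy : y ∈ O)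
    {l : List ℕ} (hl : IsMin (cpt r O) l) (he : wordAct r l (cpt r O) = y) (z : E r) :
    gfun r y z = wordAct r l z := by
  obtain ⟨h1, h2⟩ := gW_spec hr hO hy
  exact min_unique hr (cpt_mem hr hO).2 _ _ h1 hl (h2.trans he.symm) z

theorem ml_of_min (hr : 2 ≤ r) {O : Set (E r)} (hO : IsOrbit r O) {y : E r} (hy : y ∈ O)
    {l : List ℕ} (hl : IsMin (cpt r O) l) (he : wordAct r l (cpt r O) = y) :
    (gW r y).length = l.length := by
  obtain ⟨h1, h2⟩ := gW_spec hr hO hy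
  exact le_antisymm (h1.2 l hl.1 (he.trans h2.symm)) (hl.2 _ h1.1 (h2.trans he.symm))

theorem wlen_min (hr : 2 ≤ r) {c : E r} {l : List ℕ} (hl : IsMin c l) :
    wlen r (fun z => wordAct r l z) = l.length := by
  apply le_antisymm
  · exact Nat.sInf_le ⟨l, hl.1, rfl, rfl⟩
  · unfold wlen
    refine le_csInf ⟨l.length, ⟨l, hl.1, rfl, rfl⟩⟩ ?_
    rintro n ⟨l', h1, rfl, h3⟩
    exact hl.2 l' h1 (congrFun h3 c)

theorem gfun_step (hr : 2 ≤ r) {O : Set (E r)} (hO : IsOrbit r O) {y : E r} (hy : y ∈ O)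
    {j : ℕ} (hj : j ≤ r) (hp : 0 < alphaF r j y) (z : E r) :
    gfun r (genF r j y) z = genF r j (gfun r y z) := by
  obtain ⟨h1, h2⟩ := gW_spec hr hO hy
  have h3 := h1.cons hr (cpt_mem hr hO).2 hj (by rwa [h2])
  rw [gfun_of_min hr hO (orbit_genF hO hy hj) h3 (by rw [wordAct_cons, h2])]
  rfl

theorem gfun_cpt (hr : 2 ≤ r) {O : Set (E r)} (hO : IsOrbit r O) (z : E r) :
    gfun r (cpt r O) z = z :=
  gfun_of_min hr hO (cpt_mem hr hO).1 (l := []) ⟨by simp [Wd], by simp⟩ rfl z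

/-- induction along minimal words -/
theorem orbit_induction (hr : 2 ≤ r) {O : Set (E r)} (hO : IsOrbit r O) {P : E r → Prop}
    (h0 : P (cpt r O)) (hs : ∀ y ∈ O, ∀ j ≤ r, 0 < alphaF r j y → P y → P (genF r j y)) :
    ∀ y ∈ O, P y := by
  have key : ∀ l : List ℕ, IsMin (cpt r O) l → P (wordAct r l (cpt r O)) := by
    intro l
    induction l with
    | nil => intro _; exact h0
    | cons j l ih =>
      intro h
      rw [wordAct_cons]
      exact hs _ (orbit_word hO (cpt_mem hr hO).1 l h.1.tail) j h.1.head
        (h.pos hr (cpt_mem hr hO).2) (ih (h.tail hr))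
  intro y hy
  obtain ⟨h1, h2⟩ := gW_spec hr hO hy
  rw [← h2]
  exact key _ h1

/-- elementary lowering -/
def Rl (y' y : E r) : Prop :=
  ∃ (f : E r → ℝ) (v : E r), RootF f v ∧ (∀ z ∈ CplusCl r, 0 ≤ f z) ∧ f y < 0 ∧ y' = rf f v y

/-- strict order generated by elementary lowerings -/
def Rt : E r → E r → Prop := Relation.TransGen Rl

theorem Rt_sub (hr : 2 ≤ r) {c : E r} (hc : c ∈ CplusCl r) {y y' : E r} (h : Rt y' y)
    {l : List ℕ} (hl : Wd r l) (he : wordAct r l c = y) :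
    ∃ l' : List ℕ, l'.Sublist l ∧ l'.length < l.length ∧ wordAct r l' c = y' := by
  have step : ∀ {a b : E r} {l : List ℕ}, Wd r l → wordAct r l c = b → Rl a b →
      ∃ l' : List ℕ, l'.Sublist l ∧ l'.length < l.length ∧ wordAct r l' c = a := by
    rintro a b l hl he ⟨f, v, h1, h2, h3, h4⟩
    rw [← he] at h3
    obtain ⟨l', h5, h6, h7⟩ := exchange hr hc l hl f v h1 h2 h3
    exact ⟨l', h5, by omega, by rw [h7, he, h4]⟩
  induction h using Relation.TransGen.head_induction_on with
  | single h => exact step hl he h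
  | head h1 h2 ih =>
    obtain ⟨l', h3, h4, h5⟩ := ih
    obtain ⟨l'', h6, h7, h8⟩ := step (hl.sublist h3) h5 h1
    exact ⟨l'', h6.trans h3, by omega, h8⟩

theorem Rt_finite (hr : 2 ≤ r) {O : Set (E r)} (hO : IsOrbit r O) {y : E r} (hy : y ∈ O) :
    {y' | Rt y' y}.Finite := by
  obtain ⟨h1, h2⟩ := gW_spec hr hO hy
  apply ((gW r y).sublists.toFinset.finite_toSet.image
    (fun l => wordAct r l (cpt r O))).subset
  intro y' h
  obtain ⟨l', h3, h4, h5⟩ := Rt_sub hr (cpt_mem hr hO).2 h h1.1 h2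
  exact ⟨l', by simpa using h3, h5⟩

theorem Rt_facts (hr : 2 ≤ r) {O : Set (E r)} (hO : IsOrbit r O) {y y' : E r} (hy : y ∈ O)
    (h : Rt y' y) : y' ∈ O ∧ (gW r y').length < (gW r y).length ∧ qlt r y' y := by
  obtain ⟨hc1, hc2⟩ := cpt_mem hr hO
  obtain ⟨h1, h2⟩ := gW_spec hr hO hy
  obtain ⟨l', h3, h4, h5⟩ := Rt_sub hr hc2 h h1.1 h2
  obtain ⟨m, h6, h7, h8⟩ := prune hr hc2 l' (h1.1.sublist h3)
  have hy' : y' ∈ O := by rw [← h5]; exact orbit_word hO hc1 _ (h1.1.sublist h3)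
  have h9 := ml_of_min hr hO hy' h7 (h8.trans h5)
  have h10 := h6.length_le
  have h11 : (gW r y').length < (gW r y).length := by omega
  refine ⟨hy', h11, ⟨⟨orbit_from hr hO hy hy', ?_⟩, ?_⟩⟩
  · refine ⟨gW r y, h1.1, rfl, (wlen_min hr h1).symm, m, h6.trans h3, ?_, ?_⟩
    · funext z; rw [gfun_of_min hr hO hy' h7 (h8.trans h5)]
    · have : gfun r y' = fun z => wordAct r m z :=
        funext fun z => gfun_of_min hr hO hy' h7 (h8.trans h5) z
      rw [this, wlen_min hr h7]
  · rintro rfl; omega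

theorem qlt_facts (hr : 2 ≤ r) {O : Set (E r)} (hO : IsOrbit r O) {y y' : E r} (hy : y ∈ O)
    (h : qlt r y' y) : y' ∈ O ∧ (gW r y').length < (gW r y).length := by
  obtain ⟨⟨⟨p, hp, hpe⟩, l, h1, h2, h3, l', h4, h5, h6⟩, h7⟩ := h
  have hy' : y' ∈ O := by rw [← hpe]; exact orbit_word hO hy p hp
  obtain ⟨q1, q2⟩ := gW_spec hr hO hy
  obtain ⟨q3, q4⟩ := gW_spec hr hO hy'
  have q5 : wlen r (gfun r y) = (gW r y).length := wlen_min hr q1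
  have q6 : wlen r (gfun r y') = (gW r y').length := wlen_min hr q3
  refine ⟨hy', ?_⟩
  rw [← q5, ← q6, ← h3, ← h6]
  apply lt_of_le_of_ne h4.length_le
  intro h8
  have := h4.eq_of_length h8
  subst this
  apply h7
  rw [← q4, ← q2]
  exact congrFun (h5.symm.trans h2) (cpt r O)

/-- positive finite roots with coroots -/
def PosR (β : E r → ℝ) (w : E r) : Prop :=
  (∃ a b : Fin r, a < b ∧ (∀ y, β y = y a - y b) ∧ w = eV r a - eV r b) ∨
  (∃ a b : Fin r, a < b ∧ (∀ y, β y = y a + y b) ∧ w = eV r a + eV r b) ∨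
  (∃ a : Fin r, (∀ y, β y = 2 * y a) ∧ w = eV r a)

theorem PosR.lower {β : E r → ℝ} {w : E r} (h : PosR β w) (y : E r) (n : ℤ)
    (hn : (1 ≤ n ∧ n < β y) ∨ (n ≤ 0 ∧ β y < n)) : Rt (y - (β y - n) • w) y := by
  apply Relation.TransGen.single
  rcases hn with ⟨hn, hy⟩ | ⟨hn, hy⟩
  · have hn' : (1 : ℝ) ≤ n := by exact_mod_cast hn
    refine ⟨fun z => n - β z, -w, ?_, ?_, by simpa using hy, ?_⟩
    · rcases h with ⟨a, b, hab, h1, h2⟩ | ⟨a, b, hab, h1, h2⟩ | ⟨a, h1, h2⟩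
      · exact ⟨a, b, -1, 1, n, by simp, by simp, fun h => absurd h hab.ne,
          fun z => by simp only [h1]; push_cast; ring, by rw [h2, if_neg hab.ne]; push_cast; module⟩
      · exact ⟨a, b, -1, -1, n, by simp, by simp, fun h => absurd h hab.ne,
          fun z => by simp only [h1]; push_cast; ring, by rw [h2, if_neg hab.ne]; push_cast; module⟩
      · exact ⟨a, a, -1, -1, n, by simp, by simp, by simp,
          fun z => by simp only [h1]; push_cast; ring, by rw [h2]; simp⟩
    · intro z hz
      rcases h with ⟨a, b, hab, h1, h2⟩ | ⟨a, b, hab, h1, h2⟩ | ⟨a, h1, h2⟩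
      · have := hz.2 a; have := hz.2 b; simp only [h1]; linarith
      · have := hz.2 a; have := hz.2 b; simp only [h1]; linarith
      · have := hz.2 a; simp only [h1]; linarith
    · unfold rf; module
  · have hn' : (n : ℝ) ≤ 0 := by exact_mod_cast hn
    refine ⟨fun z => β z - n, w, ?_, ?_, by simpa using hy, ?_⟩
    · rcases h with ⟨a, b, hab, h1, h2⟩ | ⟨a, b, hab, h1, h2⟩ | ⟨a, h1, h2⟩
      · exact ⟨a, b, 1, -1, -n, by simp, by simp, fun h => absurd h hab.ne,
          fun z => by simp only [h1]; push_cast; ring, by rw [h2, if_neg hab.ne]; push_cast; module⟩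
      · exact ⟨a, b, 1, 1, -n, by simp, by simp, fun h => absurd h hab.ne,
          fun z => by simp only [h1]; push_cast; ring, by rw [h2, if_neg hab.ne]; push_cast; module⟩
      · exact ⟨a, a, 1, 1, -n, by simp, by simp, by simp,
          fun z => by simp only [h1]; push_cast; ring, by rw [h2]; simp⟩
    · intro z hz
      rcases h with ⟨a, b, hab, h1, h2⟩ | ⟨a, b, hab, h1, h2⟩ | ⟨a, h1, h2⟩
      · have := hz.1 a b hab.le; simp only [h1]; linarith
      · have := hz.2 a; have := hz.2 b; simp only [h1]; linarith
      · have := hz.2 a; simp only [h1]; linarith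
    · unfold rf; module

end orbits


section torus
set_option linter.unusedSectionVars false
variable {F} {r}

theorem tcU_fin (t : Fin r → Fˣ) (m : Fin r) (i : ℕ) (h : i = (m : ℕ) + 1) :
    tcU F r t i = t m := by
  unfold tcU
  rw [Finset.prod_eq_single m]
  · simp [h]
  · intro b _ hb
    rw [if_neg]
    intro h'
    exact hb (Fin.ext (by omega))
  · simp

theorem qq (qh : Fˣ) (n : ℤ) : (qh * qh) ^ n = qh ^ (2 * n) := by
  rw [mul_zpow, ← zpow_add, two_mul]

/-- action of a generator on the torus -/
def tact (qh : Fˣ) (j : ℕ) (s : Fin r → Fˣ) : Fin r → Fˣ := torusAct F r qh (genF r j) s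

/-- signed permutation data of a generator -/
structure SData (r : ℕ) (j : ℕ) where
  /-- the permutation -/
  π : Fin r → Fin r
  /-- the signs -/
  sg : Fin r → ℤ
  /-- the shifts -/
  sh : Fin r → ℤ
  h1 : ∀ m, π (π m) = m
  h2 : ∀ m, sg m = 1 ∨ sg m = -1
  h3 : ∀ m, sg (π m) = sg m
  h4 : ∀ (y : E r) m, genF r j y m = sg m * y (π m) + sh m
  h5 : ∀ (y : E r) m, sbar j y m = sg m * y (π m)

theorem exists_SData (hr : 2 ≤ r) (j : ℕ) (hj : j ≤ r) : Nonempty (SData r j) := by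
  obtain ⟨π, sg, sh, h1, h2, h3, h4, h5⟩ := genF_signed hr j hj
  exact ⟨⟨π, sg, sh, h1, h2, h3, h4, h5⟩⟩

/-- integrality of an affine map -/
def IntAff (g : E r → E r) : Prop :=
  (∀ m, ∃ n : ℤ, g 0 m = n) ∧ ∀ i m, ∃ n : ℤ, (g (eV r i) - g 0) m = n

theorem torusAct_comp {j : ℕ} (D : SData r j) (qh : Fˣ) {g : E r → E r} (hg : IntAff g)
    (t : Fin r → Fˣ) (m : Fin r) :
    torusAct F r qh (fun z => genF r j (g z)) t m =
      (qh * qh) ^ D.sh m * (torusAct F r qh g t (D.π m)) ^ D.sg m := by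
  unfold torusAct
  obtain ⟨n0, hn0⟩ := hg.1 (D.π m)
  have e1 : ⌊genF r j (g 0) m⌋ = D.sg m * ⌊g 0 (D.π m)⌋ + D.sh m := by
    rw [D.h4, hn0, Int.floor_intCast]
    exact_mod_cast Int.floor_intCast _
  have e2 : ∀ i, ⌊(genF r j (g (eV r i)) - genF r j (g 0)) m⌋ =
      D.sg m * ⌊(g (eV r i) - g 0) (D.π m)⌋ := by
    intro i
    obtain ⟨n1, hn1⟩ := hg.2 i (D.π m)
    have : (genF r j (g (eV r i)) - genF r j (g 0)) m
        = D.sg m * (g (eV r i) - g 0) (D.π m) := by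
      rw [Pi.sub_apply, D.h4, D.h4, Pi.sub_apply]; ring
    rw [this, hn1, Int.floor_intCast]
    exact_mod_cast Int.floor_intCast _
  simp only [e1, e2]
  generalize qh * qh = q
  rw [mul_zpow, ← zpow_mul, zpow_add, mul_comm (D.sg m) ⌊g 0 (D.π m)⌋, ← Finset.prod_zpow]
  simp only [← zpow_mul]
  rw [mul_comm (q ^ (⌊g 0 (D.π m)⌋ * D.sg m)), mul_assoc]
  congr 2
  apply Finset.prod_congr rfl
  intro i _
  rw [mul_comm (D.sg m)]

theorem eV_apply (i m : Fin r) : eV r i m = if m = i then 1 else 0 := rfl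

theorem intAff_id : IntAff (fun z : E r => z) := by
  refine ⟨fun m => ⟨0, by simp⟩, fun i m => ?_⟩
  simp only [sub_zero, eV_apply]
  split_ifs
  · exact ⟨1, by simp⟩
  · exact ⟨0, by simp⟩

theorem torusAct_id (qh : Fˣ) (t : Fin r → Fˣ) : torusAct F r qh (fun z => z) t = t := by
  funext m
  unfold torusAct
  simp only [Pi.zero_apply, Int.floor_zero, zpow_zero, one_mul, sub_zero, eV_apply]
  rw [Finset.prod_eq_single m]
  · simp
  · intro b _ hb; simp [hb.symm]
  · simp

theorem tact_apply {j : ℕ} (D : SData r j) (qh : Fˣ) (s : Fin r → Fˣ) (m : Fin r) :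
    tact qh j s m = (qh * qh) ^ D.sh m * (s (D.π m)) ^ D.sg m := by
  have := torusAct_comp D qh intAff_id s m
  rw [torusAct_id] at this
  exact this

theorem intAff_comp {j : ℕ} (D : SData r j) {g : E r → E r} (hg : IntAff g) :
    IntAff (fun z => genF r j (g z)) := by
  refine ⟨fun m => ?_, fun i m => ?_⟩
  · obtain ⟨n, hn⟩ := hg.1 (D.π m)
    exact ⟨D.sg m * n + D.sh m, by show genF r j (g 0) m = _; rw [D.h4, hn]; push_cast; rfl⟩
  · obtain ⟨n, hn⟩ := hg.2 i (D.π m)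
    refine ⟨D.sg m * n, ?_⟩
    show genF r j (g (eV r i)) m - genF r j (g 0) m = _
    rw [D.h4, D.h4]
    rw [Pi.sub_apply] at hn
    push_cast
    rw [← hn]; ring

theorem intAff_word (hr : 2 ≤ r) : ∀ l : List ℕ, Wd r l → IntAff (fun z : E r => wordAct r l z)
  | [], _ => intAff_id
  | j :: l, h => by
    obtain ⟨D⟩ := exists_SData hr j h.head
    exact intAff_comp D (intAff_word hr l h.tail)

theorem torusAct_genF (hr : 2 ≤ r) {j : ℕ} (hj : j ≤ r) (qh : Fˣ) {g : E r → E r} (hg : IntAff g)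
    (t : Fin r → Fˣ) :
    torusAct F r qh (fun z => genF r j (g z)) t = tact qh j (torusAct F r qh g t) := by
  obtain ⟨D⟩ := exists_SData hr j hj
  funext m
  rw [torusAct_comp D qh hg, tact_apply D]

theorem SData.sh_rel (hr : 2 ≤ r) {j : ℕ} (hj : j ≤ r) (D : SData r j) (m : Fin r) :
    D.sh m + D.sg m * D.sh (D.π m) = 0 := by
  have h : genF r j (genF r j 0) m = (0 : E r) m := by rw [genF_genF hr j hj]
  rw [D.h4, D.h4] at h
  simp only [Pi.zero_apply, mul_zero, zero_add] at h
  have h' : ((D.sg m * D.sh (D.π m) + D.sh m : ℤ) : ℝ) = 0 := by push_cast; exact h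
  have : D.sg m * D.sh (D.π m) + D.sh m = 0 := by exact_mod_cast h'
  omega

theorem SData.sq {j : ℕ} (D : SData r j) (m : Fin r) : D.sg m * D.sg m = 1 := by
  rcases D.h2 m with h | h <;> rw [h] <;> norm_num

theorem tact_tact (hr : 2 ≤ r) {j : ℕ} (hj : j ≤ r) (qh : Fˣ) (s : Fin r → Fˣ) :
    tact qh j (tact qh j s) = s := by
  obtain ⟨D⟩ := exists_SData hr j hj
  funext m
  rw [tact_apply D, tact_apply D, D.h1]
  generalize qh * qh = q
  rw [mul_zpow, ← zpow_mul, ← zpow_mul, D.h3, D.sq, zpow_one,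
    ← mul_assoc, ← zpow_add, mul_comm (D.sh (D.π m)), D.sh_rel hr hj, zpow_zero, one_mul]

/-- compatibility of a torus element with a point -/
def Compat (qh : Fˣ) (y : E r) (s : Fin r → Fˣ) : Prop :=
  (∀ (i j : Fin r) (e d n : ℤ), (e = 1 ∨ e = -1) → (d = 1 ∨ d = -1) →
    (e * y i + d * y j : ℝ) = n → s i ^ e * s j ^ d = (qh * qh) ^ n) ∧
  ∀ (i : Fin r) (n : ℤ), 2 * y i = n → s i = qh ^ n

theorem Compat.step {j : ℕ} (D : SData r j) {qh : Fˣ} {y : E r} {s : Fin r → Fˣ}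
    (h : Compat qh y s) : Compat qh (genF r j y) (tact qh j s) := by
  constructor
  · intro i i' e d n he hd hn
    rw [D.h4, D.h4] at hn
    have h1 := h.1 (D.π i) (D.π i') (e * D.sg i) (d * D.sg i') (n - e * D.sh i - d * D.sh i')
      (by rcases he with rfl | rfl <;> rcases D.h2 i with h | h <;> simp [h])
      (by rcases hd with rfl | rfl <;> rcases D.h2 i' with h | h <;> simp [h])
      (by push_cast; linarith)
    rw [tact_apply D, tact_apply D]
    generalize qh * qh = q at h1 ⊢
    rw [mul_zpow, mul_zpow, ← zpow_mul, ← zpow_mul, ← zpow_mul,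
      ← zpow_mul, mul_comm (D.sg i) e, mul_comm (D.sg i') d, mul_mul_mul_comm, h1, ← zpow_add,
      ← zpow_add]
    congr 1; ring
  · intro i n hn
    rw [D.h4] at hn
    have hs : ((D.sg i : ℝ)) * D.sg i = 1 := by exact_mod_cast D.sq i
    have h1 := h.2 (D.π i) (D.sg i * (n - 2 * D.sh i)) (by
      push_cast; rw [← hn]; linear_combination (-2 * y (D.π i)) * hs)
    rw [tact_apply D, h1, ← zpow_mul, mul_right_comm, D.sq, one_mul, qq, ← zpow_add]
    congr 1; ring

theorem Compat.fix {j : ℕ} (D : SData r j) {qh : Fˣ} {y : E r} {s : Fin r → Fˣ}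
    (h : Compat qh y s) (hf : genF r j y = y) : tact qh j s = s := by
  funext m
  have h0 := congrFun hf m
  rw [D.h4] at h0
  have h1 := h.1 m (D.π m) 1 (- D.sg m) (D.sh m) (by simp)
    (by rcases D.h2 m with h | h <;> simp [h]) (by push_cast; linarith)
  rw [tact_apply D, ← h1, zpow_one, mul_assoc, ← zpow_add]; simp

theorem compat_base (hr : 2 ≤ r) {qh : Fˣ} {O : Set (E r)} (hO : IsOrbit r O) {t : Fin r → Fˣ}
    (ht : t ∈ TOset F r qh O) : Compat qh (cpt r O) t := by
  have hC := (cpt_mem hr hO).2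
  set c := cpt r O with hc
  have h0 : r ≠ 0 := by omega
  have mid : ∀ a b : Fin r, (b : ℕ) = a + 1 → c a = c b → t a = t b := by
    intro a b hab h
    have hb := b.2
    have := ht (a + 1) (by omega) (by rw [alphaF_eq, pj_mid a b hab, ← hc, h]; simp)
    simp only [tpowCo, Nat.succ_ne_zero, if_false] at this
    rw [if_neg (by omega), tcU_fin t a _ rfl, tcU_fin t b _ (by omega)] at this
    exact mul_inv_eq_one.1 this
  have chain : ∀ n (a b : Fin r), (b : ℕ) = a + n → c a = c b → t a = t b := by
    intro n
    induction n with
    | zero => intro a b hab _; rw [show b = a from Fin.ext (by omega)]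
    | succ n ih =>
      intro a b hab h
      have hb := b.2
      set d : Fin r := ⟨a + n, by omega⟩
      have h1 := hC.1 a d (by show (a : ℕ) ≤ a + n; omega)
      have h2 := hC.1 d b (by show (a : ℕ) + n ≤ b; omega)
      have h3 : c d = c b := by linarith
      rw [ih a d rfl (by linarith), mid d b (by simp [d]; omega) h3]
  have eqt : ∀ a b : Fin r, c a = c b → t a = t b := by
    intro a b h
    rcases le_total (a : ℕ) b with h1 | h1
    · exact chain (b - a) a b (by omega) h
    · exact (chain (a - b) b a (by omega) h.symm).symm
  have z0 : ∀ a : Fin r, c a = 0 → t a = 1 := by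
    intro a h
    set l : Fin r := ⟨r - 1, by omega⟩
    have h1 := hC.1 a l (by show (a : ℕ) ≤ r - 1; omega)
    have h2 := (hC.2 l).1
    have h3 : c l = 0 := by linarith
    rw [eqt a l (by rw [h, h3])]
    have := ht r le_rfl (by
      rw [alphaF_eq, ← hc]; simp only [pj, if_true, h0, if_false]
      rw [cd_fin c l r (by simp [l]; omega), h3]; simp)
    simp only [tpowCo, h0, if_false, if_true] at this
    rwa [tcU_fin t l r (by simp [l]; omega)] at this
  have zh : ∀ a : Fin r, c a = 1 / 2 → t a = qh := by
    intro a h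
    set l : Fin r := ⟨0, by omega⟩
    have h1 := hC.1 l a (by show 0 ≤ (a : ℕ); omega)
    have h2 := (hC.2 l).2
    have h3 : c l = 1 / 2 := by linarith
    rw [eqt a l (by rw [h, h3])]
    have := ht 0 (by omega) (by
      rw [alphaF_eq, ← hc]; simp only [pj, if_true]
      rw [cd_fin c l 1 rfl, h3]; norm_num)
    simp only [tpowCo, if_true] at this
    rw [tcU_fin t l 1 rfl] at this
    exact (mul_inv_eq_one.1 this).symm
  have hsum : ∀ (i j : Fin r) (n : ℤ), c i + c j = n → t i * t j = (qh * qh) ^ n := by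
    intro i j n hn
    have hi := hC.2 i
    have hj := hC.2 j
    have n0 : 0 ≤ n := by
      have : (0 : ℝ) ≤ n := by linarith
      exact_mod_cast this
    have n1 : n ≤ 1 := by
      have : (n : ℝ) ≤ 1 := by linarith
      exact_mod_cast this
    have : n = 0 ∨ n = 1 := by omega
    rcases this with rfl | rfl
    · push_cast at hn
      rw [z0 i (by linarith), z0 j (by linarith)]; simp
    · push_cast at hn
      rw [zh i (by linarith), zh j (by linarith)]; simp
  have hdiff : ∀ (i j : Fin r) (n : ℤ), c i - c j = n → t i * (t j)⁻¹ = (qh * qh) ^ n := by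
    intro i j n hn
    have hi := hC.2 i
    have hj := hC.2 j
    have n0 : -1 < n := by
      have : ((-1 : ℤ) : ℝ) < n := by push_cast; linarith
      exact_mod_cast this
    have n1 : n < 1 := by
      have : (n : ℝ) < (1 : ℤ) := by push_cast; linarith
      exact_mod_cast this
    have : n = 0 := by omega
    subst this
    push_cast at hn
    rw [eqt i j (by linarith)]; simp
  constructor
  · intro i j e d n he hd hn
    rcases he with rfl | rfl <;> rcases hd with rfl | rfl
    · simpa using hsum i j n (by push_cast at hn; linarith)
    · simpa using hdiff i j n (by push_cast at hn; linarith)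
    · have := hdiff j i n (by push_cast at hn; linarith)
      rw [mul_comm] at this
      simpa using this
    · have := hsum i j (-n) (by push_cast at hn ⊢; linarith)
      have h2 := congrArg (fun x => x⁻¹) this
      simp only [mul_inv, zpow_neg, inv_inv] at h2
      simpa using h2
  · intro i n hn
    have hi := hC.2 i
    have n0 : 0 ≤ n := by
      have : (0 : ℝ) ≤ n := by linarith
      exact_mod_cast this
    have n1 : n ≤ 1 := by
      have : (n : ℝ) ≤ 1 := by linarith
      exact_mod_cast this
    have : n = 0 ∨ n = 1 := by omega
    rcases this with rfl | rfl
    · push_cast at hn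
      rw [z0 i (by linarith)]; simp
    · push_cast at hn
      rw [zh i (by linarith)]; simp

/-- `θ(y) = g_y t` -/
def theta (qh : Fˣ) (t : Fin r → Fˣ) (y : E r) : Fin r → Fˣ := torusAct F r qh (gfun r y) t

theorem theta_cpt (hr : 2 ≤ r) {O : Set (E r)} (hO : IsOrbit r O) (qh : Fˣ) (t : Fin r → Fˣ) :
    theta qh t (cpt r O) = t := by
  unfold theta
  rw [show gfun r (cpt r O) = fun z => z from funext (gfun_cpt hr hO), torusAct_id]

theorem theta_step (hr : 2 ≤ r) {O : Set (E r)} (hO : IsOrbit r O) (qh : Fˣ) (t : Fin r → Fˣ)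
    {y : E r} (hy : y ∈ O) {j : ℕ} (hj : j ≤ r) (hp : 0 < alphaF r j y) :
    theta qh t (genF r j y) = tact qh j (theta qh t y) := by
  unfold theta
  rw [show gfun r (genF r j y) = fun z => genF r j (gfun r y z) from
    funext (gfun_step hr hO hy hj hp)]
  exact torusAct_genF hr hj qh (intAff_word hr _ (gW_spec hr hO hy).1.1) t

theorem theta_compat (hr : 2 ≤ r) {qh : Fˣ} {O : Set (E r)} (hO : IsOrbit r O) {t : Fin r → Fˣ}
    (ht : t ∈ TOset F r qh O) : ∀ y ∈ O, Compat qh y (theta qh t y) := by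
  refine orbit_induction hr hO (P := fun y => Compat qh y (theta qh t y)) ?_ ?_
  · show Compat qh (cpt r O) (theta qh t (cpt r O))
    rw [theta_cpt hr hO]; exact compat_base hr hO ht
  · intro y hy j hj hp h
    obtain ⟨D⟩ := exists_SData hr j hj
    show Compat qh (genF r j y) (theta qh t (genF r j y))
    rw [theta_step hr hO qh t hy hj hp]
    exact h.step D

theorem theta_equiv (hr : 2 ≤ r) {qh : Fˣ} {O : Set (E r)} (hO : IsOrbit r O) {t : Fin r → Fˣ}
    (ht : t ∈ TOset F r qh O) {y : E r} (hy : y ∈ O) {j : ℕ} (hj : j ≤ r) :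
    theta qh t (genF r j y) = tact qh j (theta qh t y) := by
  rcases lt_trichotomy (alphaF r j y) 0 with h | h | h
  · have h1 := theta_step hr hO qh t (orbit_genF hO hy hj) hj (by rw [alphaF_genF hr j hj]; linarith)
    rw [genF_genF hr j hj] at h1
    rw [h1, tact_tact hr hj]
  · have hf := genF_fix hr j hj y h
    obtain ⟨D⟩ := exists_SData hr j hj
    rw [hf, (theta_compat hr hO ht y hy).fix D hf]
  · exact theta_step hr hO qh t hy hj h

/-- a global equivariant torus-valued function -/
structure GoodTheta (qh : Fˣ) (Θ : E r → Fin r → Fˣ) : Prop where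
  equiv : ∀ (y : E r) (j : ℕ), j ≤ r → Θ (genF r j y) = tact qh j (Θ y)
  half : ∀ (y : E r) (m : Fin r) (n : ℤ), 2 * y m = n → Θ y m = qh ^ n

/-- symmetric rounding of `2x` -/
def phi (x : ℝ) : ℤ := ⌊x + 1 / 2⌋ + ⌈x - 1 / 2⌉

theorem phi_neg (x : ℝ) : phi (-x) = - phi x := by
  unfold phi
  rw [show -x + 1 / 2 = -(x - 1 / 2) by ring, show -x - 1 / 2 = -(x + 1 / 2) by ring, Int.floor_neg,
    Int.ceil_neg]; ring

theorem phi_add (x : ℝ) (n : ℤ) : phi (x + n) = phi x + 2 * n := by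
  unfold phi
  rw [show x + n + 1 / 2 = (x + 1 / 2) + n by ring, show x + n - 1 / 2 = (x - 1 / 2) + n by ring,
    Int.floor_add_intCast, Int.ceil_add_intCast]; ring

theorem phi_half (x : ℝ) (n : ℤ) (h : 2 * x = n) : phi x = n := by
  unfold phi
  rcases Int.even_or_odd' n with ⟨k, rfl | rfl⟩
  · have hx : x = k := by push_cast at h; linarith
    have h1 : ⌊x + 1 / 2⌋ = k := by rw [Int.floor_eq_iff]; constructor <;> linarith
    have h2 : ⌈x - 1 / 2⌉ = k := by rw [Int.ceil_eq_iff]; constructor <;> linarith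
    rw [h1, h2]; ring
  · have hx : x = k + 1 / 2 := by push_cast at h; linarith
    have h1 : ⌊x + 1 / 2⌋ = k + 1 := by
      rw [Int.floor_eq_iff]; push_cast; constructor <;> linarith
    have h2 : ⌈x - 1 / 2⌉ = k := by rw [Int.ceil_eq_iff]; constructor <;> linarith
    rw [h1, h2]; ring

/-- global extension of `θ` -/
def Theta (qh : Fˣ) (O : Set (E r)) (t : Fin r → Fˣ) (y : E r) : Fin r → Fˣ :=
  if y ∈ O then theta qh t y else fun m => qh ^ phi (y m)

theorem goodTheta (hr : 2 ≤ r) {qh : Fˣ} {O : Set (E r)} (hO : IsOrbit r O) {t : Fin r → Fˣ}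
    (ht : t ∈ TOset F r qh O) : GoodTheta qh (Theta qh O t) := by
  constructor
  · intro y j hj
    unfold Theta
    by_cases hy : y ∈ O
    · rw [if_pos hy, if_pos (orbit_genF hO hy hj), theta_equiv hr hO ht hy hj]
    · rw [if_neg hy, if_neg (by rwa [orbit_genF_iff hr hO hj])]
      obtain ⟨D⟩ := exists_SData hr j hj
      funext m
      rw [tact_apply D, D.h4, phi_add, qq, ← zpow_mul, ← zpow_add]
      congr 1
      rcases D.h2 m with h | h <;> rw [h] <;> simp [phi_neg] <;> ring
  · intro y m n hn
    unfold Theta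
    by_cases hy : y ∈ O
    · rw [if_pos hy]; exact (theta_compat hr hO ht y hy).2 m n hn
    · rw [if_neg hy, phi_half _ _ hn]

end torus


section torus2
set_option linter.unusedSectionVars false
variable {F} {r}

/-- maps given by words -/
def IsWM (g : E r → E r) : Prop := ∃ l, Wd r l ∧ ∀ y, wordAct r l y = g y

theorem IsWM.comp {g h : E r → E r} (hg : IsWM g) (hh : IsWM h) : IsWM fun y => g (h y) := by
  obtain ⟨l, hl, e⟩ := hg
  obtain ⟨l', hl', e'⟩ := hh
  exact ⟨l ++ l', hl.append hl', fun y => by rw [wordAct_append, e', e]⟩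

theorem isWM_gen {j : ℕ} (hj : j ≤ r) : IsWM (genF r j) := ⟨[j], by
  intro a ha; simp at ha; omega, fun y => rfl⟩

theorem genF_mid (hr : 2 ≤ r) (a b : Fin r) (hab : (b : ℕ) = a + 1) (y : E r) (m : Fin r) :
    genF r (a + 1) y m = y (Equiv.swap a b m) := by
  have := b.2
  rw [genF_sbar hr _ (by omega), ← sbar_mid a b hab y]; simp

/-- negation of one coordinate -/
def ng (a : Fin r) (y : E r) : E r := fun i => if i = a then - y i else y i

theorem isWM_ng (hr : 2 ≤ r) : ∀ (n : ℕ) (a : Fin r), (a : ℕ) + n + 1 = r → IsWM (ng a)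
  | 0, a, h => by
    have : ng a = genF r r := by
      funext y m
      rw [genF_sbar hr r le_rfl, Pi.add_apply, sbar_last hr, if_neg (show r ≠ 0 by omega)]
      simp only [ng, Fin.ext_iff, Pi.zero_apply, add_zero]
      congr 1
      exact propext ⟨fun h => by omega, fun h => by omega⟩
    rw [this]; exact isWM_gen le_rfl
  | n + 1, a, h => by
    have hb : (a : ℕ) + 1 < r := by omega
    set b : Fin r := ⟨a + 1, hb⟩
    have hne : a ≠ b := by intro h; have := congrArg Fin.val h; simp [b] at this
    have e : ng a = fun y => genF r (a + 1) (ng b (genF r (a + 1) y)) := by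
      funext y m
      rw [genF_mid hr a b rfl]
      simp only [ng]
      rw [genF_mid hr a b rfl, Equiv.swap_apply_self]
      congr 1
      rw [Equiv.swap_apply_eq_iff, Equiv.swap_apply_right]
    rw [e]
    exact (isWM_gen (by omega)).comp ((isWM_ng hr n b (by simp [b]; omega)).comp
      (isWM_gen (by omega)))

theorem isWM_tr (hr : 2 ≤ r) : ∀ (n : ℕ) (a : Fin r), (a : ℕ) = n → IsWM (fun y => y + eV r a)
  | 0, a, h => by
    have : (fun y => y + eV r a) = fun y => genF r 0 (ng a y) := by
      funext y m
      simp only [genF, if_true, ng, eV_apply, Pi.add_apply]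
      by_cases hm : m = a
      · subst hm; simp [h]; ring
      · rw [if_neg hm, if_neg hm, if_neg (by intro h'; exact hm (Fin.ext (by omega)))]; simp
    rw [this]
    exact (isWM_gen (by omega)).comp (isWM_ng hr (r - 1) a (by omega))
  | n + 1, b, h => by
    have hb := b.2
    set a : Fin r := ⟨n, by omega⟩
    have hab : (b : ℕ) = a + 1 := h
    have e : (fun y => y + eV r b) = fun y => genF r (a + 1) (genF r (a + 1) y + eV r a) := by
      funext y m
      rw [genF_mid hr a b hab]
      simp only [Pi.add_apply]
      rw [genF_mid hr a b hab, Equiv.swap_apply_self, eV_apply, eV_apply]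
      congr 2
      rw [Equiv.swap_apply_eq_iff, Equiv.swap_apply_left]
    rw [e]
    exact (isWM_gen (by simp [a]; omega)).comp ((isWM_tr hr n a rfl).comp
      (isWM_gen (by simp [a]; omega)))

theorem GoodTheta.word (hr : 2 ≤ r) {qh : Fˣ} {Θ : E r → Fin r → Fˣ} (h : GoodTheta qh Θ)
    (y : E r) : ∀ l : List ℕ, Wd r l →
      Θ (wordAct r l y) = torusAct F r qh (fun z => wordAct r l z) (Θ y)
  | [], _ => (torusAct_id qh (Θ y)).symm
  | j :: l, hl => by
    rw [wordAct_cons, h.equiv _ j hl.head, h.word hr y l hl.tail]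
    exact (torusAct_genF hr hl.head qh (intAff_word hr l hl.tail) _).symm

theorem GoodTheta.map (hr : 2 ≤ r) {qh : Fˣ} {Θ : E r → Fin r → Fˣ} (h : GoodTheta qh Θ)
    {g : E r → E r} (hg : IsWM g) (y : E r) : Θ (g y) = torusAct F r qh g (Θ y) := by
  obtain ⟨l, hl, e⟩ := hg
  rw [← e, h.word hr y l hl, funext e]

theorem torusAct_eq (qh : Fˣ) (g : E r → E r) (t : Fin r → Fˣ) (m m' : Fin r) (n d : ℤ)
    (h0 : ⌊g 0 m⌋ = n) (h : ∀ x, ⌊(g (eV r x) - g 0) m⌋ = if m' = x then d else 0) :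
    torusAct F r qh g t m = (qh * qh) ^ n * t m' ^ d := by
  unfold torusAct
  rw [h0]
  congr 1
  rw [Finset.prod_eq_single m']
  · rw [h, if_pos rfl]
  · intro b _ hb; rw [h, if_neg hb.symm, zpow_zero]
  · simp

theorem GoodTheta.add (hr : 2 ≤ r) {qh : Fˣ} {Θ : E r → Fin r → Fˣ} (h : GoodTheta qh Θ)
    (y : E r) (a m : Fin r) :
    Θ (y + eV r a) m = if m = a then qh * qh * Θ y m else Θ y m := by
  rw [h.map hr (isWM_tr hr a a rfl) y]
  rw [torusAct_eq qh _ (Θ y) m m (if m = a then 1 else 0) 1]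
  · split_ifs <;> simp
  · simp only [zero_add, eV_apply]
    split_ifs <;> simp
  · intro x
    show ⌊(eV r x + eV r a - (0 + eV r a)) m⌋ = _
    simp only [zero_add, add_sub_cancel_right, eV_apply]
    split_ifs <;> simp

theorem GoodTheta.sub (hr : 2 ≤ r) {qh : Fˣ} {Θ : E r → Fin r → Fˣ} (h : GoodTheta qh Θ)
    (y : E r) (a m : Fin r) :
    Θ (y - eV r a) m = if m = a then (qh * qh)⁻¹ * Θ y m else Θ y m := by
  have := h.add hr (y - eV r a) a m
  rw [sub_add_cancel] at this
  rw [this]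
  split_ifs <;> simp [mul_assoc]

theorem GoodTheta.mid (hr : 2 ≤ r) {qh : Fˣ} {Θ : E r → Fin r → Fˣ} (h : GoodTheta qh Θ)
    (y : E r) (a b : Fin r) (hab : (b : ℕ) = a + 1) (m : Fin r) :
    Θ (sbar (a + 1) y) m = Θ y (Equiv.swap a b m) := by
  have hb := b.2
  have e : sbar (a + 1) y = genF r (a + 1) y := by rw [genF_sbar hr _ (by omega)]; simp
  rw [e, h.equiv y _ (by omega)]
  unfold tact torusAct
  simp only [Pi.sub_apply, genF_mid hr a b hab, Pi.zero_apply, Int.floor_zero, zpow_zero, one_mul,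
    sub_zero, eV_apply]
  rw [Finset.prod_eq_single (Equiv.swap a b m)]
  · simp
  · intro b _ hb; simp [hb.symm]
  · simp

theorem GoodTheta.ng (hr : 2 ≤ r) {qh : Fˣ} {Θ : E r → Fin r → Fˣ} (h : GoodTheta qh Θ)
    (y : E r) (a m : Fin r) :
    Θ (ng a y) m = if m = a then (Θ y m)⁻¹ else Θ y m := by
  have ha := a.2
  rw [h.map hr (isWM_ng hr (r - 1 - a) a (by omega)) y]
  rw [torusAct_eq qh _ (Θ y) m m 0 (if m = a then -1 else 1)]
  · split_ifs <;> simp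
  · simp [QP.ng]
  · intro x
    simp only [QP.ng, Pi.sub_apply, eV_apply, Pi.zero_apply, neg_zero, ite_self, sub_zero]
    split_ifs
    · exact_mod_cast Int.floor_intCast (R := ℝ) (-1)
    all_goals simp

theorem sbar_zero_ng (hr : 2 ≤ r) (y : E r) : sbar 0 y = ng (⟨0, by omega⟩ : Fin r) y := by
  funext m; rw [sbar_zero hr]; simp [ng, Fin.ext_iff]

/-- the twist factor -/
def tw (Θ : E r → Fin r → Fˣ) (j : ℕ) (y : E r) : Fˣ := if j = 0 then tcU F r (Θ y) 1 else 1

theorem tw_zero (hr : 2 ≤ r) (Θ : E r → Fin r → Fˣ) (y : E r) :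
    tw Θ 0 y = Θ y ⟨0, by omega⟩ := by
  simp only [tw, if_true]; exact tcU_fin _ _ _ rfl

theorem tw_pos (Θ : E r → Fin r → Fˣ) {j : ℕ} (hj : j ≠ 0) (y : E r) : tw Θ j y = 1 := by
  simp [tw, hj]

/-- the constant `c_j` -/
def cc (qh : Fˣ) (j : ℕ) : Fˣ := if j = 0 then qh else 1

theorem tw_sbar (hr : 2 ≤ r) {qh : Fˣ} {Θ : E r → Fin r → Fˣ} (h : GoodTheta qh Θ) (j : ℕ)
    (y : E r) : tw Θ j (sbar j y) * tw Θ j y = 1 := by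
  by_cases hj : j = 0
  · subst hj
    rw [tw_zero hr, tw_zero hr, sbar_zero_ng hr, h.ng hr]; simp
  · simp [tw_pos, hj]

/-- shift of the twist along the root -/
theorem tw_vv (hr : 2 ≤ r) {qh : Fˣ} {Θ : E r → Fin r → Fˣ} (h : GoodTheta qh Θ) (j : ℕ)
    (y : E r) : cc qh j * cc qh j * tw Θ j (y + vv r j) = tw Θ j y := by
  by_cases hj : j = 0
  · subst hj
    have e : y + vv r 0 = y - eV r ⟨0, by omega⟩ := by
      rw [sub_eq_add_neg]; congr 1
      unfold vv; rw [if_pos rfl]; congr 1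
      funext m; simp [epsV_apply, eV_apply, Fin.ext_iff]
    rw [e, tw_zero hr, tw_zero hr, h.sub hr]; simp [cc, mul_assoc]
  · simp [tw_pos, hj, cc]

/-- value of the twist at integral points -/
theorem tw_int (hr : 2 ≤ r) {qh : Fˣ} {Θ : E r → Fin r → Fˣ} (h : GoodTheta qh Θ) (j : ℕ)
    (y : E r) (n : ℤ) (hn : pj j y = n) : tw Θ j y = cc qh j ^ (-n) := by
  by_cases hj : j = 0
  · subst hj
    simp only [pj, if_true] at hn
    rw [cd_fin y ⟨0, by omega⟩ 1 rfl] at hn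
    rw [tw_zero hr, h.half y _ (-n) (by push_cast; linarith)]; simp [cc]
  · simp [tw_pos, hj, cc]

/-- invariance of the twist under orthogonal integral shifts -/
theorem tw_orth (hr : 2 ≤ r) {qh : Fˣ} {Θ : E r → Fin r → Fˣ} (h : GoodTheta qh Θ) (j : ℕ)
    (y : E r) (a : Fin r) (ha : pj j (eV r a) = 0) : tw Θ j (y + eV r a) = tw Θ j y := by
  by_cases hj : j = 0
  · subst hj
    simp only [pj, if_true] at ha
    rw [cd_fin _ ⟨0, by omega⟩ 1 rfl, eV_apply] at ha
    rw [tw_zero hr, tw_zero hr, h.add hr, if_neg]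
    intro h; rw [if_pos h] at ha; norm_num at ha
  · simp [tw_pos, hj]

end torus2


section ops
set_option linter.unusedSectionVars false
variable {F} {r}

/-- signed sums -/
def Sg {V : Type*} [AddCommGroup V] (h : ℤ → V) (n : ℤ) : V :=
  if 0 ≤ n then ∑ t ∈ Finset.range n.toNat, h t
  else -∑ t ∈ Finset.range (-n).toNat, h (-(t : ℤ) - 1)

variable {V : Type*} [AddCommGroup V]

theorem Sg_zero (h : ℤ → V) : Sg h 0 = 0 := by simp [Sg]

theorem Sg_succ (h : ℤ → V) (n : ℤ) : Sg h (n + 1) = Sg h n + h n := by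
  unfold Sg
  rcases le_or_gt 0 n with hn | hn
  · rw [if_pos hn, if_pos (by omega), show (n + 1).toNat = n.toNat + 1 by omega,
      Finset.sum_range_succ]
    congr 2; omega
  · rw [if_neg (not_le.2 hn)]
    by_cases h1 : n = -1
    · subst h1; simp
    · rw [if_neg (by omega), show (-n).toNat = (-(n + 1)).toNat + 1 by omega,
        Finset.sum_range_succ]
      rw [show (-(((-(n + 1)).toNat : ℕ) : ℤ) - 1) = n by omega]
      abel

theorem Sg_unique (h : ℤ → V) (f : ℤ → V) (h0 : f 0 = 0) (hs : ∀ n, f (n + 1) = f n + h n)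
    (n : ℤ) : f n = Sg h n := by
  induction n using Int.induction_on with
  | zero => rw [h0, Sg_zero]
  | succ n ih => rw [hs, Sg_succ, ih]
  | pred n ih =>
    have h1 := hs (-n - 1)
    have h2 := Sg_succ h (-n - 1)
    rw [sub_add_cancel] at h1 h2
    rw [h1, h2] at ih
    exact add_right_cancel ih

theorem Sg_one (h : ℤ → V) : Sg h 1 = h 0 := by
  have := Sg_succ h 0; rw [Sg_zero, zero_add, zero_add] at this; exact this

theorem Sg_neg_one (h : ℤ → V) : Sg h (-1) = - h (-1) := by
  have := Sg_succ h (-1); simp only [Int.reduceNeg, neg_add_cancel, Sg_zero] at this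
  exact (neg_eq_of_add_eq_zero_left this.symm).symm

/-- shift of the summation variable -/
theorem Sg_shift (h : ℤ → V) (d n : ℤ) : Sg (fun m => h (m + d)) n = Sg h (n + d) - Sg h d := by
  symm
  apply Sg_unique (fun m => h (m + d)) (fun n => Sg h (n + d) - Sg h d)
  · simp
  · intro n
    show Sg h (n + 1 + d) - Sg h d = Sg h (n + d) - Sg h d + h (n + d)
    rw [show n + 1 + d = n + d + 1 by ring, Sg_succ]; abel

theorem Sg_map {V' : Type*} [AddCommGroup V'] (L : V →+ V') (h : ℤ → V) (n : ℤ) :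
    L (Sg h n) = Sg (fun m => L (h m)) n := by
  apply Sg_unique (fun m => L (h m)) (fun n => L (Sg h n))
  · simp [Sg_zero]
  · intro n; show L (Sg h (n + 1)) = _; rw [Sg_succ, map_add]

theorem Sg_parity (h : ℤ → V) (n : ℤ) :
    Sg (fun m => h (2 * m)) ((n + 1) / 2) + Sg (fun m => h (2 * m + 1)) (n / 2) = Sg h n := by
  apply Sg_unique h (fun n => Sg (fun m => h (2 * m)) ((n + 1) / 2) +
    Sg (fun m => h (2 * m + 1)) (n / 2))
  · simp [Sg_zero]
  · intro n
    show Sg (fun m => h (2 * m)) ((n + 1 + 1) / 2) + Sg (fun m => h (2 * m + 1)) ((n + 1) / 2) =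
      Sg (fun m => h (2 * m)) ((n + 1) / 2) + Sg (fun m => h (2 * m + 1)) (n / 2) + h n
    rcases Int.even_or_odd' n with ⟨k, rfl | rfl⟩
    · rw [show (2 * k + 1 + 1) / 2 = k + 1 by omega, show (2 * k + 1) / 2 = k by omega,
        show 2 * k / 2 = k by omega, Sg_succ]; abel
    · rw [show (2 * k + 1 + 1 + 1) / 2 = k + 1 by omega, show (2 * k + 1 + 1) / 2 = k + 1 by omega,
        show (2 * k + 1) / 2 = k by omega, Sg_succ (fun m => h (2 * m + 1))]; abel

/-- membership: the signed sum only involves indices between `0` and `n` -/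
theorem Sg_mem {W : Type*} [AddCommGroup W] [Module F W] (S : Submodule F W) (h : ℤ → W) (n : ℤ)
    (h1 : ∀ m, (0 ≤ m ∧ m < n) ∨ (n ≤ m ∧ m < 0) → h m ∈ S) : Sg h n ∈ S := by
  unfold Sg
  split_ifs with hn
  · exact S.sum_mem fun t ht => h1 _ (Or.inl (by have := Finset.mem_range.1 ht; omega))
  · exact S.neg_mem (S.sum_mem fun t ht => h1 _ (Or.inr (by have := Finset.mem_range.1 ht; omega)))

theorem X_mul (y z : E r) : X F r y * X F r z = X F r (y + z) := by
  simp [X, AddMonoidAlgebra.single_mul_single]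

theorem mkOp_X (Ψ : E r → QA F r) (y : E r) : mkOp F r Ψ (X F r y) = Ψ y := by
  simp [mkOp, X]

theorem X_span : ∀ f : QA F r, f ∈ Submodule.span F (Set.range (X F r)) := by
  intro f
  induction f using AddMonoidAlgebra.induction_linear with
  | zero => exact Submodule.zero_mem _
  | add f g hf hg => exact Submodule.add_mem _ hf hg
  | single y c =>
    have : AddMonoidAlgebra.single y c = c • X F r y := by simp [X]
    rw [this]
    exact Submodule.smul_mem _ _ (Submodule.subset_span ⟨y, rfl⟩)

theorem op_ext {A B : Module.End F (QA F r)} (h : ∀ y, A (X F r y) = B (X F r y)) : A = B := by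
  apply LinearMap.ext
  intro f
  have := X_span f
  refine Submodule.span_induction (p := fun f _ => A f = B f) ?_ ?_ ?_ ?_ this
  · rintro _ ⟨y, rfl⟩; exact h y
  · simp
  · intro f g _ _ h1 h2; rw [map_add, map_add, h1, h2]
  · intro c f _ h1; rw [map_smul, map_smul, h1]

theorem geomS_mul (c : F) (v : E r) (n : ℤ) (y : E r) :
    geomS F r c v n * X F r y = Sg (fun m => c ^ m • X F r (y + (m : ℝ) • v)) n := by
  unfold geomS Sg
  split_ifs with h
  · rw [Finset.sum_mul]
    apply Finset.sum_congr rfl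
    intro t _
    rw [smul_mul_assoc, X_mul, add_comm]; simp
  · rw [neg_mul, Finset.sum_mul]
    congr 1
    apply Finset.sum_congr rfl
    intro t _
    rw [smul_mul_assoc, X_mul, add_comm]; push_cast; rfl

theorem floorE_div (p : ℝ) : -floorE p / 2 = (-⌊p⌋ + 1) / 2 := by
  unfold floorE
  have : ⌊p / 2⌋ = ⌊p⌋ / 2 := by
    have := Int.floor_div_natCast p 2
    simpa using this
  rw [this]; omega

theorem floorO_div (p : ℝ) : (-floorO p - 1) / 2 = (-⌊p⌋) / 2 := by
  unfold floorO
  have : ⌊(p + 1) / 2⌋ = (⌊p⌋ + 1) / 2 := by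
    have := Int.floor_div_natCast (p + 1) 2
    rw [Int.floor_add_one] at this
    simpa using this
  rw [this]; omega

/-- the parameters -/
structure Prm (F : Type*) [Field F] where
  /-- `q^{1/2}` -/
  qh : Fˣ
  /-- `k_0` -/
  k0 : Fˣ
  /-- `u_0` -/
  u0 : Fˣ
  /-- `k` -/
  k : Fˣ
  /-- `k_r` -/
  kr : Fˣ
  /-- `u_r` -/
  ur : Fˣ

variable (r) in
/-- the Hecke parameter -/
def kj (P : Prm F) (j : ℕ) : Fˣ := if j = 0 then P.k0 else if j = r then P.kr else P.k
variable (r) in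
/-- the second Hecke parameter -/
def uj (P : Prm F) (j : ℕ) : Fˣ := if j = 0 then P.u0 else if j = r then P.ur else P.k

variable (r) in
/-- `κ_m` -/
def kap (P : Prm F) (j : ℕ) (m : ℤ) : F :=
  if Even m then (kj r P j : F) - (kj r P j : F)⁻¹ else (uj r P j : F) - (uj r P j : F)⁻¹

/-- unified Demazure-Lusztig operator on quasi-monomials -/
def TGel (P : Prm F) (Θ : E r → Fin r → Fˣ) (j : ℕ) (y : E r) : QA F r :=
  ((kj r P j : F) ^ chiE (pj j y) * (uj r P j : F) ^ chiO (pj j y) * (tw Θ j y : F)) •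
      X F r (sbar j y)
    + Sg (fun m => (kap r P j m * (cc P.qh j : F) ^ m) • X F r (y + (m : ℝ) • vv r j)) (-⌊pj j y⌋)

/-- unified Demazure-Lusztig operator -/
def TG (P : Prm F) (Θ : E r → Fin r → Fˣ) (j : ℕ) : Module.End F (QA F r) := mkOp F r (TGel P Θ j)

theorem chiE_neg (z : ℝ) : chiE (-z) = chiE z := by
  unfold chiE
  congr 1
  apply propext
  constructor
  · rintro ⟨n, h⟩; exact ⟨-n, by push_cast; linarith⟩
  · rintro ⟨n, h⟩; exact ⟨-n, by push_cast; linarith⟩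

theorem chiO_neg (z : ℝ) : chiO (-z) = chiO z := by
  unfold chiO
  congr 1
  apply propext
  constructor
  · rintro ⟨n, h⟩; exact ⟨-n - 1, by push_cast; linarith⟩
  · rintro ⟨n, h⟩; exact ⟨-n - 1, by push_cast; linarith⟩

theorem chi_add (z : ℝ) : chiE z + chiO z = chiZ z := by
  unfold chiE chiO chiZ
  by_cases h1 : ∃ n : ℤ, z = 2 * n
  · obtain ⟨n, hn⟩ := h1
    rw [if_pos ⟨n, hn⟩, if_neg, if_pos ⟨2 * n, by push_cast; exact hn⟩]
    rintro ⟨m, hm⟩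
    have : (2 * n : ℝ) = 2 * m + 1 := by rw [← hn, hm]
    have : 2 * n = 2 * m + 1 := by exact_mod_cast this
    omega
  · rw [if_neg h1]
    by_cases h2 : ∃ n : ℤ, z = 2 * n + 1
    · obtain ⟨n, hn⟩ := h2
      rw [if_pos ⟨n, hn⟩, if_pos ⟨2 * n + 1, by push_cast; exact hn⟩]
    · rw [if_neg h2, if_neg]
      rintro ⟨n, hn⟩
      rcases Int.even_or_odd' n with ⟨k, rfl | rfl⟩
      · exact h1 ⟨k, by rw [hn]; push_cast; ring⟩
      · exact h2 ⟨k, by rw [hn]; push_cast; ring⟩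

theorem long_sum (A B : F) (c : Fˣ) (v : E r) (y : E r) (p : ℝ) :
    A • (geomS F r ((c : F) * c) ((2 : ℝ) • v) (-floorE p / 2) * X F r y) +
      B • (((c : F) • X F r v) * geomS F r ((c : F) * c) ((2 : ℝ) • v) ((-floorO p - 1) / 2) *
        X F r y) =
    Sg (fun m => ((if Even m then A else B) * (c : F) ^ m) • X F r (y + (m : ℝ) • v)) (-⌊p⌋) := by
  rw [← Sg_parity, floorE_div, floorO_div, mul_assoc, geomS_mul, geomS_mul]
  congr 1
  · have := Sg_map ((A • LinearMap.id : Module.End F (QA F r)) : QA F r →+ QA F r)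
      (fun m => ((c : F) * c) ^ m • X F r (y + (m : ℝ) • (2 : ℝ) • v)) ((-⌊p⌋ + 1) / 2)
    simp only [AddMonoidHom.coe_coe, LinearMap.smul_apply,
      LinearMap.id_apply] at this
    rw [this]
    congr 1
    funext m
    rw [if_pos (by simp), smul_smul, smul_smul, mul_zpow, ← zpow_add₀ c.ne_zero, two_mul]
    push_cast
    rw [mul_comm (m : ℝ) 2, ← two_mul, show ((m : ℝ) + m) = 2 * m by ring]
  · have := Sg_map ((B • (LinearMap.mulLeft F ((c : F) • X F r v)) : Module.End F (QA F r)) :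
      QA F r →+ QA F r)
      (fun m => ((c : F) * c) ^ m • X F r (y + (m : ℝ) • (2 : ℝ) • v)) ((-⌊p⌋) / 2)
    simp only [AddMonoidHom.coe_coe, LinearMap.smul_apply,
      LinearMap.mulLeft_apply] at this
    rw [this]
    congr 1
    funext m
    rw [if_neg (by simp), smul_mul_assoc, mul_smul_comm, X_mul, smul_smul, smul_smul, mul_zpow,
      ← zpow_add₀ c.ne_zero, zpow_add₀ c.ne_zero (2 * m), two_mul, zpow_one]
    congr 1
    · ring
    · congr 1
      push_cast
      module

theorem Top_X (hr : 2 ≤ r) (P : Prm F) (Θ : E r → Fin r → Fˣ) {j : ℕ} (h1 : 1 ≤ j) (hj : j ≤ r)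
    (y : E r) : Tel F r P.k P.kr P.ur j y = TGel P Θ j y := by
  unfold Tel TGel
  rw [sW_eq hr j hj h1, tw_pos Θ (by omega)]
  have h0 : j ≠ 0 := by omega
  by_cases hjr : j = r
  · subst hjr
    rw [if_pos rfl]
    have hp : pj j y = 2 * cd j y j := by simp [pj, h0]
    have hv : vv j j = epsV j j := by simp [vv, h0]
    rw [sW_eq hr j hj h1, add_assoc, hp, hv]
    unfold nablaReEl nablaRoEl
    have := long_sum ((P.kr : F) - (P.kr : F)⁻¹) ((P.ur : F) - (P.ur : F)⁻¹) 1 (epsV j j) y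
      (2 * cd j y j)
    simp only [Units.val_one, mul_one, one_smul] at this
    rw [this]
    simp [kj, uj, kap, cc, h0]
  · rw [if_neg hjr]
    have hp : pj j y = cd r y j - cd r y (j + 1) := by simp [pj, h0, hjr]
    have hv : vv r j = epsV r j - epsV r (j + 1) := by simp [vv, h0, hjr]
    rw [← hp, ← chi_add]
    unfold nablaIel
    rw [geomS_mul, ← hp, ← hv]
    simp only [kj, uj, h0, hjr, if_false, pow_add, Units.val_one, mul_one]
    congr 1
    have := Sg_map ((((P.k : F) - (P.k : F)⁻¹) • LinearMap.id : Module.End F (QA F r)) :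
      QA F r →+ QA F r) (fun m => (1 : F) ^ m • X F r (y + (m : ℝ) • vv r j)) (-⌊pj j y⌋)
    simp only [AddMonoidHom.coe_coe, LinearMap.smul_apply,
      LinearMap.id_apply] at this
    rw [this]
    congr 1
    funext m
    simp [kap, kj, uj, h0, hjr, cc]

theorem T0_X (hr : 2 ≤ r) (P : Prm F) {O : Set (E r)} (t : Fin r → Fˣ) {y : E r} (hy : y ∈ O) :
    T0el F r P.qh P.k0 P.u0 t y = TGel P (Theta P.qh O t) 0 y := by
  unfold T0el TGel
  have hp : pj 0 y = -2 * cd r y 1 := by simp [pj]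
  have hv : vv r 0 = -epsV r 1 := by simp [vv]
  have ht : tw (Theta P.qh O t) 0 y = tcU F r (torusAct F r P.qh (gfun r y) t) 1 := by
    simp only [tw, if_true, Theta, hy, theta]
  rw [sEps1_eq hr, ht, add_assoc, hp, hv]
  unfold nabla0eEl nabla0oEl
  have := long_sum ((P.k0 : F) - (P.k0 : F)⁻¹) ((P.u0 : F) - (P.u0 : F)⁻¹) P.qh (-epsV r 1) y
    (-2 * cd r y 1)
  rw [show (-2 : ℝ) • epsV r 1 = (2 : ℝ) • -epsV r 1 by module,
    show (-1 : ℝ) • epsV r 1 = -epsV r 1 by module, this,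
    show -2 * cd r y 1 = -(2 * cd r y 1) by ring, chiE_neg, chiO_neg]
  simp [kj, uj, kap, cc]

end ops


section bern
set_option linter.unusedSectionVars false
variable {F} {r}

/-- multiplication by a quasi-monomial -/
def Mu (w : E r) : Module.End F (QA F r) := LinearMap.mulLeft F (X F r w)

theorem Mu_X (w y : E r) : Mu (F := F) w (X F r y) = X F r (y + w) := by
  simp only [Mu, LinearMap.mulLeft_apply, X_mul, add_comm]

theorem Mu_mul (w w' : E r) : Mu (F := F) w * Mu w' = Mu (w + w') := by
  apply op_ext; intro y
  rw [Module.End.mul_apply, Mu_X, Mu_X, Mu_X]; congr 1; abel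

theorem Mu_zero : Mu (F := F) (0 : E r) = 1 := by
  apply op_ext; intro y; rw [Mu_X]; simp

/-- the leading scalar -/
def ee (r : ℕ) (P : Prm F) (j : ℕ) (p : ℝ) : F :=
  (kj r P j : F) ^ chiE p * (uj r P j : F) ^ chiO p

theorem TG_X (P : Prm F) (Θ : E r → Fin r → Fˣ) (j : ℕ) (y : E r) :
    TG P Θ j (X F r y) = (ee r P j (pj j y) * (tw Θ j y : F)) • X F r (sbar j y)
    + Sg (fun m => (kap r P j m * (cc P.qh j : F) ^ m) • X F r (y + (m : ℝ) • vv r j))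
      (-⌊pj j y⌋) := by
  rw [TG, mkOp_X]; rfl

theorem chiE_add_two (p : ℝ) : chiE (p + 2) = chiE p := by
  unfold chiE
  congr 1
  apply propext
  constructor
  · rintro ⟨n, h⟩; exact ⟨n - 1, by push_cast; linarith⟩
  · rintro ⟨n, h⟩; exact ⟨n + 1, by push_cast; linarith⟩

theorem chiO_add_one (p : ℝ) : chiO (p + 1) = chiE p := by
  unfold chiE chiO
  congr 1
  apply propext
  constructor
  · rintro ⟨n, h⟩; exact ⟨n, by linarith⟩
  · rintro ⟨n, h⟩; exact ⟨n, by linarith⟩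

theorem chiE_add_one (p : ℝ) : chiE (p + 1) = chiO p := by
  have := chiO_add_one (p + 1)
  rw [← this, show p + 1 + 1 = p + 2 by ring]
  have h1 := chiE_add_two (p + 1)
  unfold chiO
  congr 1
  apply propext
  constructor
  · rintro ⟨n, h⟩; exact ⟨n - 1, by push_cast; linarith⟩
  · rintro ⟨n, h⟩; exact ⟨n + 1, by push_cast; linarith⟩

theorem ee_add_two (P : Prm F) (j : ℕ) (p : ℝ) : ee r P j (p + 2) = ee r P j p := by
  unfold ee
  rw [show p + 2 = p + 1 + 1 by ring, chiO_add_one, chiE_add_one, chiO_add_one, chiE_add_one]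

theorem ee_short (P : Prm F) {j : ℕ} (hj : kj r P j = uj r P j) (p : ℝ) :
    ee r P j (p + 1) = ee r P j p := by
  unfold ee
  rw [chiO_add_one, chiE_add_one, hj, mul_comm]

theorem kap_short (P : Prm F) {j : ℕ} (hj : kj r P j = uj r P j) (m n : ℤ) :
    kap r P j m = kap r P j n := by
  unfold kap; rw [hj]; simp

theorem kap_par (P : Prm F) (j : ℕ) (m : ℤ) : kap r P j (m + 2) = kap r P j m := by
  unfold kap; simp [Int.even_add]

/-- commutation with orthogonal monomials -/
theorem bern_orth (P : Prm F) (Θ : E r → Fin r → Fˣ) {j : ℕ} {w : E r} (hw : pj j w = 0)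
    (ht : ∀ y, tw Θ j (y + w) = tw Θ j y) : TG P Θ j * Mu w = Mu w * TG P Θ j := by
  apply op_ext; intro y
  rw [Module.End.mul_apply, Module.End.mul_apply, Mu_X, TG_X, TG_X, map_add, map_smul, Mu_X, ht,
    pj_add, hw, add_zero, sbar_add]
  congr 2
  · congr 2; unfold sbar; rw [hw]; simp
  · have := Sg_map ((Mu w : Module.End F (QA F r)) : QA F r →+ QA F r)
      (fun m => (kap r P j m * (cc P.qh j : F) ^ m) • X F r (y + (m : ℝ) • vv r j)) (-⌊pj j y⌋)
    rw [AddMonoidHom.coe_coe] at this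
    rw [this]
    congr 1
    funext m
    rw [map_smul, Mu_X]; congr 2; abel

/-- short root Bernstein relation -/
theorem bern_short (P : Prm F) (Θ : E r → Fin r → Fˣ) {j : ℕ} (hj0 : j ≠ 0)
    (hj : kj r P j = uj r P j) {w : E r} (hw : pj j w = 1) :
    TG P Θ j * Mu w = Mu (w - vv r j) * (TG P Θ j - kap r P j 0 • 1) := by
  apply op_ext; intro y
  rw [Module.End.mul_apply, Module.End.mul_apply, Mu_X, LinearMap.sub_apply, LinearMap.smul_apply,
    Module.End.one_apply, TG_X, TG_X, map_sub, map_add, map_smul, map_smul, Mu_X, Mu_X,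
    tw_pos Θ hj0, tw_pos Θ hj0, pj_add, hw, ee_short P hj, sbar_add, add_sub_assoc]
  have hs : sbar j w = w - vv r j := by unfold sbar; rw [hw, one_smul]
  rw [hs]
  congr 1
  have := Sg_map ((Mu (w - vv r j) : Module.End F (QA F r)) : QA F r →+ QA F r)
      (fun m => (kap r P j m * (cc P.qh j : F) ^ m) • X F r (y + (m : ℝ) • vv r j)) (-⌊pj j y⌋)
  rw [AddMonoidHom.coe_coe] at this
  rw [this]
  have e1 : ∀ m : ℤ, Mu (w - vv r j) ((kap r P j m * (cc P.qh j : F) ^ m) •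
      X F r (y + (m : ℝ) • vv r j)) =
      kap r P j 0 • X F r (y + w + ((m : ℝ) - 1) • vv r j) := by
    intro m
    rw [map_smul, Mu_X, kap_short P hj m 0]
    simp only [cc, hj0, if_false, Units.val_one, one_zpow, mul_one]
    congr 2; module
  have e2 : (fun m : ℤ => (kap r P j m * (cc P.qh j : F) ^ m) • X F r (y + w + (m : ℝ) • vv r j)) =
      fun m : ℤ => (fun n : ℤ => kap r P j 0 • X F r (y + w + ((n : ℝ) - 1) • vv r j)) (m + 1) := by
    funext m
    rw [kap_short P hj m 0]
    simp [cc, hj0]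
  simp only [e1]
  rw [e2, Sg_shift (fun n : ℤ => kap r P j 0 • X F r (y + w + ((n : ℝ) - 1) • vv r j)) 1, Sg_one,
    Int.floor_add_one]
  congr 1
  · congr 1; ring
  · congr 2; push_cast; module

/-- long root Bernstein relation -/
theorem bern_long (hr : 2 ≤ r) (P : Prm F) {Θ : E r → Fin r → Fˣ} (hΘ : GoodTheta P.qh Θ) {j : ℕ}
    (hj : j ≤ r) :
    TG P Θ j * ((cc P.qh j : F) • Mu (vv r j)) =
      ((cc P.qh j : F)⁻¹ • Mu (-vv r j)) * (TG P Θ j - kap r P j 0 • 1) - kap r P j 1 • 1 := by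
  apply op_ext; intro y
  rw [Module.End.mul_apply, LinearMap.smul_apply, Mu_X, map_smul, TG_X, LinearMap.sub_apply,
    Module.End.mul_apply, LinearMap.smul_apply, LinearMap.sub_apply, LinearMap.smul_apply,
    Module.End.one_apply, LinearMap.smul_apply, Module.End.one_apply, TG_X, map_sub, map_add,
    map_smul, map_smul, Mu_X, Mu_X, pj_add, pj_vv hr j hj, ee_add_two, sbar_add, sbar_vv hr j hj]
  have hc : (cc P.qh j : F) ≠ 0 := (cc P.qh j).ne_zero
  have ht : (tw Θ j y : F) = (cc P.qh j : F) * cc P.qh j * tw Θ j (y + vv r j) := by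
    rw [← tw_vv hr hΘ j y]; push_cast; rfl
  rw [ht, smul_add, smul_sub, smul_add, smul_smul, smul_smul, add_sub_assoc, add_sub_assoc]
  congr 1
  · congr 1; field_simp
  have := Sg_map (((cc P.qh j : F)⁻¹ • Mu (-vv r j) : Module.End F (QA F r)) : QA F r →+ QA F r)
      (fun m => (kap r P j m * (cc P.qh j : F) ^ m) • X F r (y + (m : ℝ) • vv r j)) (-⌊pj j y⌋)
  rw [AddMonoidHom.coe_coe, LinearMap.smul_apply] at this
  rw [this]
  have := Sg_map (((cc P.qh j : F) • LinearMap.id : Module.End F (QA F r)) : QA F r →+ QA F r)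
      (fun m => (kap r P j m * (cc P.qh j : F) ^ m) • X F r (y + vv r j + (m : ℝ) • vv r j))
      (-⌊pj j y + 2⌋)
  rw [AddMonoidHom.coe_coe, LinearMap.smul_apply, LinearMap.id_apply] at this
  rw [this]
  set G : ℤ → QA F r := fun m => (kap r P j (m + 1) * (cc P.qh j : F) ^ m) •
    X F r (y + (m : ℝ) • vv r j) with hG
  have e1 : ∀ m : ℤ, ((cc P.qh j : F)⁻¹ • Mu (-vv r j)) ((kap r P j m * (cc P.qh j : F) ^ m) •
      X F r (y + (m : ℝ) • vv r j)) = G (m + -1) := by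
    intro m
    rw [LinearMap.smul_apply, map_smul, Mu_X, smul_smul]
    simp only [hG]
    congr 1
    · rw [show m + -1 + 1 = m by ring, zpow_add₀ hc, zpow_neg_one]; ring
    · congr 1; push_cast; module
  have e2 : ∀ m : ℤ, ((cc P.qh j : F) • LinearMap.id : Module.End F (QA F r))
      ((kap r P j m * (cc P.qh j : F) ^ m) • X F r (y + vv r j + (m : ℝ) • vv r j)) =
      G (m + 1) := by
    intro m
    rw [LinearMap.smul_apply, LinearMap.id_apply, smul_smul]
    simp only [hG]
    congr 1
    · rw [show m + 1 + 1 = m + 2 by ring, kap_par, zpow_add₀ hc, zpow_one]; ring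
    · congr 1; push_cast; module
  simp only [AddMonoidHom.coe_coe, e1, e2]
  rw [Sg_shift, Sg_shift, Sg_one, Sg_neg_one, show (⌊pj j y + 2⌋ : ℤ) = ⌊pj j y⌋ + 2 by
    exact_mod_cast Int.floor_add_intCast (pj j y) 2]
  rw [show -(⌊pj j y⌋ + 2) + 1 = -⌊pj j y⌋ + -1 by ring]
  simp only [hG]
  rw [show (-1 + 1 : ℤ) = 0 by norm_num, show (0 + 1 : ℤ) = 1 by norm_num, zpow_zero, zpow_neg_one,
    smul_smul, mul_comm (kap r P j 0)]
  push_cast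
  simp only [zero_smul, add_zero, mul_one, neg_smul, one_smul]
  abel

/-- the scalar on the box -/
def gg (r : ℕ) (P : Prm F) (j : ℕ) (p : ℝ) : Fˣ :=
  if p = 0 then kj r P j else if p = 1 then (uj r P j)⁻¹ else 1

theorem chi_frac {p : ℝ} (h0 : 0 < p) (h1 : p < 1) : chiE p = 0 ∧ chiO p = 0 := by
  have key : ∀ n : ℤ, p ≠ n := by
    intro n hn
    rw [hn] at h0 h1
    have a : 0 < n := by exact_mod_cast h0
    have b : n < 1 := by exact_mod_cast h1
    omega
  unfold chiE chiO
  constructor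
  · rw [if_neg]; rintro ⟨n, hn⟩; exact key (2 * n) (by push_cast; exact hn)
  · rw [if_neg]; rintro ⟨n, hn⟩; exact key (2 * n + 1) (by push_cast; exact hn)

theorem chi_zero : chiE 0 = 1 ∧ chiO 0 = 0 := by
  have h := chi_add 0
  have h1 : chiE 0 = 1 := by unfold chiE; rw [if_pos ⟨0, by simp⟩]
  have h2 : chiZ 0 = 1 := by unfold chiZ; rw [if_pos ⟨0, by simp⟩]
  omega

theorem chi_one : chiE 1 = 0 ∧ chiO 1 = 1 := by
  have h := chi_add 1
  have h1 : chiO 1 = 1 := by unfold chiO; rw [if_pos ⟨0, by simp⟩]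
  have h2 : chiZ 1 = 1 := by unfold chiZ; rw [if_pos ⟨1, by simp⟩]
  omega

theorem box_pos (hr : 2 ≤ r) (P : Prm F) {Θ : E r → Fin r → Fˣ} (hΘ : GoodTheta P.qh Θ) {j : ℕ}
    {y : E r} (h0 : 0 ≤ pj j y) (h1 : pj j y ≤ 1) :
    TG P Θ j (X F r y) = ((gg r P j (pj j y) * tw Θ j y : Fˣ) : F) • X F r (sbar j y) := by
  rw [TG_X]
  unfold ee gg
  rcases h0.eq_or_lt with h | h
  · rw [← h]
    simp [chi_zero.1, chi_zero.2, Sg_zero]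
  · rcases h1.eq_or_lt with h' | h'
    · rw [h']
      have ht := tw_int hr hΘ j y 1 (by simpa using h')
      have hs : sbar j y = y + ((-1 : ℤ) : ℝ) • vv r j := by
        unfold sbar; rw [h']; push_cast; module
      simp only [chi_one.1, chi_one.2, Int.floor_one, Sg_neg_one, ht, pow_zero, pow_one, one_mul]
      rw [hs, ← neg_smul, ← add_smul]
      congr 1
      simp [kap]
      ring
    · rw [(chi_frac h h').1, (chi_frac h h').2, Int.floor_eq_zero_iff.2 ⟨h0, h'⟩]
      simp [h.ne', h'.ne, Sg_zero]

theorem box_neg (P : Prm F) (Θ : E r → Fin r → Fˣ) {j : ℕ}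
    {y : E r} (h0 : -1 ≤ pj j y) (h1 : pj j y < 0) :
    TG P Θ j (X F r y) = (((gg r P j (-pj j y))⁻¹ * tw Θ j y : Fˣ) : F) • X F r (sbar j y) +
      kap r P j 0 • X F r y := by
  rw [TG_X]
  have hf : ⌊pj j y⌋ = -1 := by
    rw [Int.floor_eq_iff]; push_cast; exact ⟨h0, by linarith⟩
  rw [hf, neg_neg, Sg_one]
  congr 1
  · unfold ee gg
    rw [← chiE_neg, ← chiO_neg, if_neg (by linarith)]
    rcases (show -pj j y ≤ 1 by linarith).eq_or_lt with h | h
    · rw [h, chi_one.1, chi_one.2]; simp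
    · rw [(chi_frac (by linarith) h).1, (chi_frac (by linarith) h).2]; simp [h.ne]
  · simp

/-- the box -/
def Box (y : E r) : Prop := ∀ m, -(1 / 2) ≤ y m ∧ y m ≤ 1 / 2

theorem Box.sbar (hr : 2 ≤ r) {j : ℕ} (hj : j ≤ r) {y : E r} (h : Box y) : Box (sbar j y) := by
  obtain ⟨D⟩ := exists_SData hr j hj
  intro m
  rw [D.h5]
  have := h (D.π m)
  rcases D.h2 m with h | h <;> rw [h] <;> push_cast <;> constructor <;> linarith

theorem Box.pj (hr : 2 ≤ r) {j : ℕ} (hj : j ≤ r) {y : E r} (h : Box y) :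
    -1 ≤ pj j y ∧ pj j y ≤ 1 := by
  refine jcases hr ?_ ?_ ?_ j hj
  · simp only [QP.pj, if_true]
    rw [cd_fin y ⟨0, by omega⟩ 1 rfl]
    have := h ⟨0, by omega⟩
    constructor <;> linarith
  · have h0 : r ≠ 0 := by omega
    simp only [QP.pj, if_true, h0, if_false]
    rw [cd_fin y ⟨r - 1, by omega⟩ r (by simp; omega)]
    have := h ⟨r - 1, by omega⟩
    constructor <;> linarith
  · intro a b hab
    rw [pj_mid a b hab]
    have := h a
    have := h b
    constructor <;> linarith

theorem box_ind {K : E r → Prop} (h1 : ∀ y a, K y → K (y + eV r a))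
    (h2 : ∀ y a, K y → K (y - eV r a)) (hb : ∀ y, Box y → K y) (y : E r) : K y := by
  have step : ∀ (z : E r) (a : Fin r) (n : ℤ), K z → K (z + (n : ℝ) • eV r a) := by
    intro z a n hz
    induction n using Int.induction_on with
    | zero => simpa using hz
    | succ n ih =>
      have := h1 _ a ih
      convert this using 1
      push_cast; module
    | pred n ih =>
      have := h2 _ a ih
      convert this using 1
      push_cast; module
  have all : ∀ (s : Finset (Fin r)) (n : Fin r → ℤ) (z : E r), K z →
      K (z + ∑ a ∈ s, (n a : ℝ) • eV r a) := by
    intro s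
    induction s using Finset.induction_on with
    | empty => intro n z hz; simpa using hz
    | insert a s ha ih =>
      intro n z hz
      rw [Finset.sum_insert ha, ← add_assoc]
      exact ih n _ (step z a _ hz)
  have h3 := all Finset.univ (fun m => round (y m)) (fun m => y m - round (y m)) (hb _ fun m => by
    have := abs_sub_round (y m)
    rw [abs_le] at this
    exact ⟨this.1, this.2⟩)
  convert h3 using 1
  funext m
  simp only [Pi.add_apply, Finset.sum_apply, Pi.smul_apply, eV_apply, smul_eq_mul]
  rw [Finset.sum_eq_single m]
  · simp
  · intro b _ hb; simp [hb.symm]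
  · simp

end bern


section hecke
set_option linter.unusedSectionVars false
variable {F} {r}

theorem Mu_Mu (w w' : E r) (f : QA F r) : Mu w (Mu w' f) = Mu (w + w') f := by
  rw [← Module.End.mul_apply, Mu_mul]

theorem Mu_neg_l (w : E r) (f : QA F r) : Mu (-w) (Mu w f) = f := by
  rw [Mu_Mu, neg_add_cancel, Mu_zero, Module.End.one_apply]

theorem Mu_neg_r (w : E r) (f : QA F r) : Mu w (Mu (-w) f) = f := by
  rw [Mu_Mu, add_neg_cancel, Mu_zero, Module.End.one_apply]

theorem vv_zero (hr : 2 ≤ r) : vv r 0 = - eV r ⟨0, by omega⟩ := by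
  unfold vv; rw [if_pos rfl]; congr 1
  funext m; simp [epsV_apply, eV_apply, Fin.ext_iff]

theorem vv_last (hr : 2 ≤ r) : vv r r = eV r ⟨r - 1, by omega⟩ := by
  unfold vv; rw [if_neg (by omega), if_pos rfl]
  funext m
  have : ((m : ℕ) + 1 = r) ↔ (m : ℕ) = r - 1 := by omega
  simp [epsV_apply, eV_apply, Fin.ext_iff, this]

theorem pj_zero (hr : 2 ≤ r) (y : E r) : pj 0 y = -2 * y ⟨0, by omega⟩ := by
  unfold pj; rw [if_pos rfl, cd_fin y ⟨0, by omega⟩ 1 rfl]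

theorem pj_last (hr : 2 ≤ r) (y : E r) : pj r y = 2 * y ⟨r - 1, by omega⟩ := by
  unfold pj; rw [if_neg (by omega), if_pos rfl, cd_fin y ⟨r - 1, by omega⟩ r (by simp; omega)]

theorem kj_mid (P : Prm F) (a b : Fin r) (hab : (b : ℕ) = a + 1) :
    kj r P (a + 1) = P.k ∧ uj r P (a + 1) = P.k := by
  have := b.2
  unfold kj uj
  rw [if_neg (by omega), if_neg (by omega), if_neg (by omega), if_neg (by omega)]
  exact ⟨rfl, rfl⟩

theorem ne_mid {a b : Fin r} (hab : (b : ℕ) = a + 1) : a ≠ b := by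
  intro h; rw [h] at hab; omega

theorem TG_mid1 (P : Prm F) (Θ : E r → Fin r → Fˣ) (a b : Fin r) (hab : (b : ℕ) = a + 1)
    (f : QA F r) : TG P Θ (a + 1) (Mu (eV r a) f) =
      Mu (eV r b) (TG P Θ (a + 1) f - kap r P (a + 1) 0 • f) := by
  have hk := kj_mid P a b hab
  have := bern_short P Θ (j := a + 1) (by omega) (by rw [hk.1, hk.2]) (w := eV r a) (by
    rw [pj_mid a b hab, eV_apply, eV_apply]; simp [(ne_mid hab).symm])
  rw [vv_mid a b hab, sub_sub_cancel] at this
  simpa using congrArg (fun A : Module.End F (QA F r) => A f) this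

theorem TG_mid2 (P : Prm F) (Θ : E r → Fin r → Fˣ) (a b : Fin r) (hab : (b : ℕ) = a + 1)
    (f : QA F r) : TG P Θ (a + 1) (Mu (-eV r b) f) =
      Mu (-eV r a) (TG P Θ (a + 1) f - kap r P (a + 1) 0 • f) := by
  have hk := kj_mid P a b hab
  have := bern_short P Θ (j := a + 1) (by omega) (by rw [hk.1, hk.2]) (w := -eV r b) (by
    rw [pj_neg, pj_mid a b hab, eV_apply, eV_apply]; simp [(ne_mid hab)])
  rw [vv_mid a b hab, show -eV r b - (eV r a - eV r b) = -eV r a by abel] at this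
  simpa using congrArg (fun A : Module.End F (QA F r) => A f) this

theorem TG_mid3 (P : Prm F) (Θ : E r → Fin r → Fˣ) (a b : Fin r) (hab : (b : ℕ) = a + 1)
    (f : QA F r) : TG P Θ (a + 1) (Mu (eV r b) f) =
      Mu (eV r a) (TG P Θ (a + 1) f) + kap r P (a + 1) 0 • Mu (eV r b) f := by
  have := congrArg (Mu (eV r a)) (TG_mid2 P Θ a b hab (Mu (eV r b) f))
  rw [Mu_neg_l, Mu_neg_r] at this
  rw [this]; abel

theorem TG_mid4 (P : Prm F) (Θ : E r → Fin r → Fˣ) (a b : Fin r) (hab : (b : ℕ) = a + 1)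
    (f : QA F r) : TG P Θ (a + 1) (Mu (-eV r a) f) =
      Mu (-eV r b) (TG P Θ (a + 1) f) + kap r P (a + 1) 0 • Mu (-eV r a) f := by
  have := congrArg (Mu (-eV r b)) (TG_mid1 P Θ a b hab (Mu (-eV r a) f))
  rw [Mu_neg_l, Mu_neg_r] at this
  rw [this]; abel

/-- `Z_j` -/
def Zl (P : Prm F) (j : ℕ) : Module.End F (QA F r) := (cc P.qh j : F) • Mu (vv r j)
/-- `Z_j⁻¹` -/
def Zi (P : Prm F) (j : ℕ) : Module.End F (QA F r) := (cc P.qh j : F)⁻¹ • Mu (-vv r j)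

theorem Zi_Zl (P : Prm F) (j : ℕ) (f : QA F r) : Zi P j (Zl P j f) = f := by
  unfold Zi Zl
  rw [LinearMap.smul_apply, LinearMap.smul_apply, map_smul, Mu_neg_l, smul_smul,
    inv_mul_cancel₀ (cc P.qh j).ne_zero, one_smul]

theorem Zl_Zi (P : Prm F) (j : ℕ) (f : QA F r) : Zl P j (Zi P j f) = f := by
  unfold Zi Zl
  rw [LinearMap.smul_apply, LinearMap.smul_apply, map_smul, Mu_neg_r, smul_smul,
    mul_inv_cancel₀ (cc P.qh j).ne_zero, one_smul]

variable (hr : 2 ≤ r) (P : Prm F) {Θ : E r → Fin r → Fˣ} (hΘ : GoodTheta P.qh Θ)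
include hr hΘ

theorem TG_Zl {j : ℕ} (hj : j ≤ r) (f : QA F r) : TG P Θ j (Zl P j f) =
    Zi P j (TG P Θ j f - kap r P j 0 • f) - kap r P j 1 • f := by
  have := congrArg (fun A : Module.End F (QA F r) => A f) (bern_long hr P hΘ hj)
  exact this

theorem TG_Zi {j : ℕ} (hj : j ≤ r) (f : QA F r) : TG P Θ j (Zi P j f) =
    Zl P j (TG P Θ j f) + kap r P j 0 • Zi P j f + kap r P j 1 • f := by
  have := congrArg (Zl P j) (TG_Zl hr P hΘ hj (Zi P j f))
  rw [Zl_Zi, map_sub, Zl_Zi, map_smul, Zl_Zi] at this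
  rw [this]; abel

theorem TG_orth {j : ℕ} {a : Fin r} (ha : pj j (eV r a) = 0) (f : QA F r) :
    TG P Θ j (Mu (eV r a) f) = Mu (eV r a) (TG P Θ j f) := by
  exact congrArg (fun A : Module.End F (QA F r) => A f)
    (bern_orth P Θ ha (fun y => tw_orth hr hΘ j y a ha))

theorem TG_orth' {j : ℕ} {a : Fin r} (ha : pj j (eV r a) = 0) (f : QA F r) :
    TG P Θ j (Mu (-eV r a) f) = Mu (-eV r a) (TG P Θ j f) := by
  have := congrArg (Mu (-eV r a)) (TG_orth hr P hΘ ha (Mu (-eV r a) f))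
  rw [Mu_neg_l, Mu_neg_r] at this
  exact this.symm

omit hr hΘ in
/-- vanishing criterion -/
theorem vanish {B : QA F r → QA F r} (h : ∀ a : Fin r, ∃ M : Module.End F (QA F r),
      Function.Injective M ∧
        ((∀ f, B (Mu (eV r a) f) = M (B f)) ∨ (∀ f, B (Mu (-eV r a) f) = M (B f))))
    (hb : ∀ y, Box y → B (X F r y) = 0) (y : E r) : B (X F r y) = 0 := by
  refine box_ind (K := fun y => B (X F r y) = 0) ?_ ?_ hb y
  · intro y a hy
    obtain ⟨M, hM, h | h⟩ := h a
    · rw [← Mu_X, h, hy, map_zero]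
    · have := h (X F r (y + eV r a))
      rw [Mu_X, add_neg_cancel_right, hy] at this
      exact hM (by rw [← this, map_zero])
  · intro y a hy
    obtain ⟨M, hM, h | h⟩ := h a
    · have := h (X F r (y - eV r a))
      rw [Mu_X, sub_add_cancel, hy] at this
      exact hM (by rw [← this, map_zero])
    · rw [sub_eq_add_neg, ← Mu_X, h, hy, map_zero]

omit hr hΘ in
theorem Mu_inj (w : E r) : Function.Injective (Mu (F := F) w) :=
  Function.LeftInverse.injective (Mu_neg_l w)

omit hr hΘ in
theorem Zl_inj (j : ℕ) : Function.Injective (Zl (r := r) P j) :=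
  Function.LeftInverse.injective (Zi_Zl P j)

omit hr hΘ in
theorem Zi_inj (j : ℕ) : Function.Injective (Zi (r := r) P j) :=
  Function.LeftInverse.injective (Zl_Zi P j)

omit hr hΘ in
theorem kap_zero (j : ℕ) : kap r P j 0 = (kj r P j : F) - (kj r P j : F)⁻¹ := by
  simp [kap]

theorem quad_box {j : ℕ} (hj : j ≤ r) {y : E r} (hy : Box y) :
    TG P Θ j (TG P Θ j (X F r y)) - kap r P j 0 • TG P Θ j (X F r y) - X F r y = 0 := by
  have hp := hy.pj hr hj
  have hps := pj_sbar hr j hj y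
  have hss := sbar_sbar hr j hj y
  have ht : (tw Θ j (sbar j y) : F) * tw Θ j y = 1 := by
    rw [← Units.val_mul, tw_sbar hr hΘ j y, Units.val_one]
  rcases lt_trichotomy (pj j y) 0 with h | h | h
  · rw [box_neg P Θ hp.1 h, map_add, map_smul, map_smul,
      box_pos hr P hΘ (by linarith) (by linarith : pj j (sbar j y) ≤ 1), box_neg P Θ hp.1 h, hps, hss,
      smul_smul]
    push_cast
    have : ((gg r P j (-pj j y) : F))⁻¹ * (tw Θ j y : F) * ((gg r P j (-pj j y) : F) *
        (tw Θ j (sbar j y) : F)) = 1 := by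
      have := (gg r P j (-pj j y)).ne_zero
      field_simp; linear_combination ht
    rw [this]; module
  · have hs : sbar j y = y := by unfold sbar; rw [h]; simp
    rw [hs] at ht
    have ht1 : (tw Θ j y : F) = 1 := by
      have := tw_int hr hΘ j y 0 (by simpa using h)
      rw [this]; simp
    rw [box_pos hr P hΘ h.ge hp.2, map_smul, hs, box_pos hr P hΘ h.ge hp.2, hs, h]
    push_cast
    rw [ht1, kap_zero, smul_smul, smul_smul, ← sub_smul]
    have h1 := (kj r P j).ne_zero
    simp only [gg, if_true]
    have : (kj r P j : F) * 1 * ((kj r P j : F) * 1) - ((kj r P j : F) - (kj r P j : F)⁻¹) *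
      ((kj r P j : F) * 1) = 1 := by field_simp; ring
    rw [this]; simp
  · rw [box_pos hr P hΘ h.le hp.2, map_smul,
      box_neg P Θ (by linarith : -1 ≤ pj j (sbar j y)) (by linarith), hss, hps, neg_neg, smul_add,
      smul_smul]
    push_cast
    have : ((gg r P j (pj j y) : F)) * (tw Θ j y : F) * ((gg r P j (pj j y) : F)⁻¹ *
        (tw Θ j (sbar j y) : F)) = 1 := by
      have := (gg r P j (pj j y)).ne_zero
      field_simp; linear_combination ht
    rw [this]; module

omit hΘ in
/-- how basis vectors pair with a simple root -/
theorem basis_cases {j : ℕ} (hj : j ≤ r) (c : Fin r) {Q : Prop} (ho : pj j (eV r c) = 0 → Q)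
    (hm : ∀ a b : Fin r, (b : ℕ) = a + 1 → j = a + 1 → (c = a ∨ c = b) → Q)
    (hl : (j = 0 ∧ (c : ℕ) = 0 ∧ vv r j = -eV r c) ∨
      (j = r ∧ (c : ℕ) = r - 1 ∧ vv r j = eV r c) → Q) : Q := by
  revert ho hm hl
  refine jcases hr ?_ ?_ ?_ j hj
  · intro ho hm hl
    by_cases hc : (c : ℕ) = 0
    · refine hl (Or.inl ⟨rfl, hc, ?_⟩)
      rw [vv_zero hr]; congr 2; exact Fin.ext hc.symm
    · apply ho; rw [pj_zero hr, eV_apply, if_neg]; · simp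
      intro h; exact hc (by rw [← h])
  · intro ho hm hl
    by_cases hc : (c : ℕ) = r - 1
    · refine hl (Or.inr ⟨rfl, hc, ?_⟩)
      rw [vv_last hr]; congr 1; exact Fin.ext hc.symm
    · apply ho; rw [pj_last hr, eV_apply, if_neg]; · simp
      intro h; exact hc (by rw [← h])
  · intro a b hab ho hm hl
    by_cases hc : c = a ∨ c = b
    · exact hm a b hab rfl hc
    · push Not at hc
      apply ho; rw [pj_mid a b hab, eV_apply, eV_apply, if_neg hc.1.symm, if_neg hc.2.symm]; simp

/-- quadratic relation -/
theorem TG_quad {j : ℕ} (hj : j ≤ r) (f : QA F r) :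
    TG P Θ j (TG P Θ j f) = kap r P j 0 • TG P Θ j f + f := by
  suffices h : ∀ y, TG P Θ j (TG P Θ j (X F r y)) - kap r P j 0 • TG P Θ j (X F r y) - X F r y = 0 by
    have : TG P Θ j * TG P Θ j = kap r P j 0 • TG P Θ j + 1 := by
      apply op_ext; intro y
      have := h y
      rw [sub_sub, sub_eq_zero] at this
      exact this
    exact congrArg (fun A : Module.End F (QA F r) => A f) this
  refine vanish (B := fun f => TG P Θ j (TG P Θ j f) - kap r P j 0 • TG P Θ j f - f) ?_
    (fun y hy => quad_box hr P hΘ hj hy)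
  intro c
  refine basis_cases hr hj c ?_ ?_ ?_
  · intro ho
    refine ⟨Mu (eV r c), Mu_inj _, Or.inl fun f => ?_⟩
    simp only [TG_orth hr P hΘ ho, map_sub, map_smul]
  · rintro a b hab rfl (rfl | rfl)
    · refine ⟨Mu (eV r c), Mu_inj _, Or.inl fun f => ?_⟩
      simp only [TG_mid1 P Θ c b hab, TG_mid3 P Θ c b hab, map_sub, map_smul]
      module
    · refine ⟨Mu (eV r c), Mu_inj _, Or.inl fun f => ?_⟩
      simp only [TG_mid1 P Θ a c hab, TG_mid3 P Θ a c hab, map_sub, map_smul, map_add]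
      module
  · intro h
    have key : ∀ f, TG P Θ j (TG P Θ j (Zl P j f)) - kap r P j 0 • TG P Θ j (Zl P j f) - Zl P j f =
        Zl P j (TG P Θ j (TG P Θ j f) - kap r P j 0 • TG P Θ j f - f) := by
      intro f
      simp only [TG_Zl hr P hΘ hj, TG_Zi hr P hΘ hj, map_sub, map_smul]
      module
    have key2 : ∀ f, TG P Θ j (TG P Θ j (Mu (vv r j) f)) - kap r P j 0 • TG P Θ j (Mu (vv r j) f)
        - Mu (vv r j) f = Mu (vv r j) (TG P Θ j (TG P Θ j f) - kap r P j 0 • TG P Θ j f - f) := by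
      intro f
      have := key f
      simp only [Zl, LinearMap.smul_apply, map_smul] at this
      rw [smul_comm (kap r P j 0), ← smul_sub, ← smul_sub] at this
      exact smul_right_injective _ (cc P.qh j).ne_zero this
    rcases h with ⟨_, _, h⟩ | ⟨_, _, h⟩
    · rw [h] at key2
      exact ⟨_, Mu_inj _, Or.inr key2⟩
    · rw [h] at key2
      exact ⟨_, Mu_inj _, Or.inl key2⟩

end hecke


section braid
set_option linter.unusedSectionVars false
set_option linter.unusedSimpArgs false
variable {F} {r}

/-- sorting in type `A₂` -/
theorem sortA {K : E r → Prop} {s1 s2 : E r → E r} {p1 p2 : E r → ℝ}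
    (h11 : ∀ y : E r, p1 (s1 y) = - p1 y) (h12 : ∀ y : E r, p1 (s2 y) = p1 y + p2 y)
    (h21 : ∀ y : E r, p2 (s1 y) = p2 y + p1 y) (h22 : ∀ y : E r, p2 (s2 y) = - p2 y)
    (r1 : ∀ y : E r, p1 y < 0 → K (s1 y) → K y) (r2 : ∀ y : E r, p2 y < 0 → K (s2 y) → K y)
    (h0 : ∀ y : E r, 0 ≤ p1 y → 0 ≤ p2 y → K y) (y : E r) : K y := by
  have L2 : ∀ y : E r, 0 ≤ p1 y → 0 ≤ p1 y + p2 y → K y := by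
    intro y a b
    rcases le_or_gt 0 (p2 y) with h | h
    · exact h0 y a h
    · exact r2 y h (h0 _ (by rw [h12]; exact b) (by rw [h22]; linarith))
  have L2' : ∀ y : E r, 0 ≤ p2 y → 0 ≤ p1 y + p2 y → K y := by
    intro y a b
    rcases le_or_gt 0 (p1 y) with h | h
    · exact h0 y h a
    · exact r1 y h (h0 _ (by rw [h11]; linarith) (by rw [h21]; linarith))
  have L3 : ∀ y : E r, 0 ≤ p1 y → K y := by
    intro y a
    rcases le_or_gt 0 (p1 y + p2 y) with h | h
    · exact L2 y a h
    · exact r2 y (by linarith) (L2' _ (by rw [h22]; linarith) (by rw [h22, h12]; linarith))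
  rcases le_or_gt 0 (p1 y) with h | h
  · exact L3 y h
  · exact r1 y h (L3 _ (by rw [h11]; linarith))

/-- sorting in type `B₂` -/
theorem sortB {K : E r → Prop} {s1 s2 : E r → E r} {p1 p2 : E r → ℝ}
    (h11 : ∀ y : E r, p1 (s1 y) = - p1 y) (h12 : ∀ y : E r, p1 (s2 y) = p1 y + p2 y)
    (h21 : ∀ y : E r, p2 (s1 y) = p2 y + 2 * p1 y) (h22 : ∀ y : E r, p2 (s2 y) = - p2 y)
    (r1 : ∀ y : E r, p1 y < 0 → K (s1 y) → K y) (r2 : ∀ y : E r, p2 y < 0 → K (s2 y) → K y)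
    (h0 : ∀ y : E r, 0 ≤ p1 y → 0 ≤ p2 y → K y) (y : E r) : K y := by
  have L2 : ∀ y : E r, 0 ≤ p1 y → 0 ≤ p1 y + p2 y → K y := by
    intro y a b
    rcases le_or_gt 0 (p2 y) with h | h
    · exact h0 y a h
    · exact r2 y h (h0 _ (by rw [h12]; exact b) (by rw [h22]; linarith))
  have L2' : ∀ y : E r, 0 ≤ p2 y → 0 ≤ p2 y + 2 * p1 y → K y := by
    intro y a b
    rcases le_or_gt 0 (p1 y) with h | h
    · exact h0 y h a
    · exact r1 y h (h0 _ (by rw [h11]; linarith) (by rw [h21]; linarith))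
  have L3 : ∀ y : E r, 0 ≤ p1 y → 0 ≤ 2 * p1 y + p2 y → K y := by
    intro y a b
    rcases le_or_gt 0 (p1 y + p2 y) with h | h
    · exact L2 y a h
    · exact r2 y (by linarith) (L2' _ (by rw [h22]; linarith) (by rw [h22, h12]; linarith))
  have L3' : ∀ y : E r, 0 ≤ p2 y → 0 ≤ p1 y + p2 y → K y := by
    intro y a b
    rcases le_or_gt 0 (2 * p1 y + p2 y) with h | h
    · exact L2' y a (by linarith)
    · exact r1 y (by linarith) (L2 _ (by rw [h11]; linarith) (by rw [h11, h21]; linarith))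
  have L4 : ∀ y : E r, 0 ≤ p1 y → K y := by
    intro y a
    rcases le_or_gt 0 (2 * p1 y + p2 y) with h | h
    · exact L3 y a h
    · exact r2 y (by linarith) (L3' _ (by rw [h22]; linarith) (by rw [h22, h12]; linarith))
  rcases le_or_gt 0 (p1 y) with h | h
  · exact L4 y h
  · exact r1 y h (L4 _ (by rw [h11]; linarith))

variable (hr : 2 ≤ r) (P : Prm F) {Θ : E r → Fin r → Fˣ} (hΘ : GoodTheta P.qh Θ)
include hr hΘ

theorem red {j : ℕ} (hj : j ≤ r) {B N : Module.End F (QA F r)}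
    (hN : ∀ f, B (TG P Θ j f) = N (B f)) {y : E r} (hy : Box y) (hp : pj j y < 0)
    (h : B (X F r (sbar j y)) = 0) : B (X F r y) = 0 := by
  have h1 := hy.pj hr hj
  have h2 := pj_sbar hr j hj y
  have := hN (X F r (sbar j y))
  rw [box_pos hr P hΘ (by linarith) (by linarith), h, map_zero, sbar_sbar hr j hj, map_smul] at this
  exact (smul_eq_zero.1 this).resolve_left (Units.ne_zero _)

omit hr hΘ in
theorem sbar_eq (j : ℕ) (y : E r) : sbar j y = y - pj j y • vv r j := rfl

/-- A₂ braid operator on the box -/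
theorem braidA_box {i j : ℕ} (hi : i ≤ r) (hj : j ≤ r) (hi0 : i ≠ 0) (hj0 : j ≠ 0)
    (hk : kj r P i = kj r P j) (hu : uj r P i = uj r P j)
    (hij : pj i (vv r j) = -1) (hji : pj j (vv r i) = -1) {y : E r} (hy : Box y) :
    TG P Θ i (TG P Θ j (TG P Θ i (X F r y))) = TG P Θ j (TG P Θ i (TG P Θ j (X F r y))) := by
  set κ := kap r P i 0 with hκ
  have hκ' : kap r P j 0 = κ := by rw [hκ, kap_zero, kap_zero, hk]
  have qi := TG_quad hr P hΘ hi
  have qj := TG_quad hr P hΘ hj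
  rw [← hκ] at qi
  rw [hκ'] at qj
  set B : Module.End F (QA F r) := TG P Θ i * TG P Θ j * TG P Θ i - TG P Θ j * TG P Θ i * TG P Θ j
    with hB
  have hBf : ∀ f, B f = TG P Θ i (TG P Θ j (TG P Θ i f)) - TG P Θ j (TG P Θ i (TG P Θ j f)) :=
    fun f => rfl
  have h11 := pj_sbar hr i hi
  have h22 := pj_sbar hr j hj
  have h12 : ∀ y : E r, pj i (sbar j y) = pj i y + pj j y := by
    intro y; rw [sbar_eq, pj_sub, pj_smul, hij]; ring
  have h21 : ∀ y : E r, pj j (sbar i y) = pj j y + pj i y := by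
    intro y; rw [sbar_eq, pj_sub, pj_smul, hji]; ring
  suffices h : B (X F r y) = 0 by rw [hBf, sub_eq_zero] at h; exact h
  refine sortA (K := fun y => Box y → B (X F r y) = 0) h11 h12 h21 h22 ?_ ?_ ?_ y hy
  · intro y hp h hy
    refine red hr P hΘ hi (N := κ • 1 - TG P Θ j) ?_ hy hp (h (hy.sbar hr hi))
    intro f
    simp only [hBf, LinearMap.sub_apply, LinearMap.smul_apply, Module.End.one_apply, map_sub, qi,
      qj, map_add, map_smul]
    module
  · intro y hp h hy
    refine red hr P hΘ hj (N := κ • 1 - TG P Θ i) ?_ hy hp (h (hy.sbar hr hj))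
    intro f
    simp only [hBf, LinearMap.sub_apply, LinearMap.smul_apply, Module.End.one_apply, map_sub, qi,
      qj, map_add, map_smul]
    module
  · intro y hp1 hp2 hy
    have b1 := hy.sbar hr hi
    have b2 := b1.sbar hr hj
    have c1 := hy.sbar hr hj
    have c2 := c1.sbar hr hi
    have e1 : pj j (sbar i y) = pj i y + pj j y := by rw [h21]; ring
    have e2 : pj i (sbar j (sbar i y)) = pj j y := by rw [h12, h21, h11]; ring
    have f1 : pj i (sbar j y) = pj i y + pj j y := by rw [h12]
    have f2 : pj j (sbar i (sbar j y)) = pj i y := by rw [h21, h12, h22]; ring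
    have e3 : sbar j (sbar i (sbar j y)) = sbar i (sbar j (sbar i y)) := by
      rw [sbar_eq j, f2, sbar_eq i (sbar j y), f1, sbar_eq j y, sbar_eq i (sbar j (sbar i y)), e2,
        sbar_eq j (sbar i y), e1, sbar_eq i y]
      module
    rw [hBf, box_pos hr P hΘ hp1 (hy.pj hr hi).2, map_smul, box_pos hr P hΘ (by rw [e1]; linarith)
      (b1.pj hr hj).2, map_smul, map_smul, box_pos hr P hΘ (by rw [e2]; linarith) (b2.pj hr hi).2,
      box_pos hr P hΘ hp2 (hy.pj hr hj).2, map_smul, box_pos hr P hΘ (by rw [f1]; linarith)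
      (c1.pj hr hi).2, map_smul, map_smul, box_pos hr P hΘ (by rw [f2]; linarith) (c2.pj hr hj).2,
      e1, e2, f1, f2, e3]
    simp only [tw_pos Θ hi0, tw_pos Θ hj0, mul_one, gg, hk, hu, smul_smul]
    rw [← sub_smul]
    convert zero_smul F _
    ring

/-- B₂ braid operator on the box -/
theorem braidB_box {i j : ℕ} (hi : i ≤ r) (hj : j ≤ r) (hi0 : i ≠ 0)
    (hij : pj i (vv r j) = -1) (hji : pj j (vv r i) = -2)
    (ht1 : ∀ y : E r, tw Θ j (sbar i (sbar j (sbar i y))) = tw Θ j y)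
    {y : E r} (hy : Box y) :
    TG P Θ j (TG P Θ i (TG P Θ j (TG P Θ i (X F r y)))) =
      TG P Θ i (TG P Θ j (TG P Θ i (TG P Θ j (X F r y)))) := by
  have ht2 : ∀ y : E r, tw Θ j (sbar i (sbar j y)) = tw Θ j (sbar i y) := by
    intro y; have := ht1 (sbar i y); rw [sbar_sbar hr i hi] at this; exact this
  set κ := kap r P i 0 with hκ
  set μ := kap r P j 0 with hμ
  have qi := TG_quad hr P hΘ hi
  have qj := TG_quad hr P hΘ hj
  rw [← hκ] at qi
  rw [← hμ] at qj
  set B : Module.End F (QA F r) := TG P Θ j * TG P Θ i * TG P Θ j * TG P Θ i -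
    TG P Θ i * TG P Θ j * TG P Θ i * TG P Θ j
    with hB
  have hBf : ∀ f, B f = TG P Θ j (TG P Θ i (TG P Θ j (TG P Θ i f))) -
      TG P Θ i (TG P Θ j (TG P Θ i (TG P Θ j f))) :=
    fun f => rfl
  have h11 := pj_sbar hr i hi
  have h22 := pj_sbar hr j hj
  have h12 : ∀ y : E r, pj i (sbar j y) = pj i y + pj j y := by
    intro y; rw [sbar_eq, pj_sub, pj_smul, hij]; ring
  have h21 : ∀ y : E r, pj j (sbar i y) = pj j y + 2 * pj i y := by
    intro y; rw [sbar_eq, pj_sub, pj_smul, hji]; ring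
  suffices h : B (X F r y) = 0 by rw [hBf, sub_eq_zero] at h; exact h
  refine sortB (K := fun y => Box y → B (X F r y) = 0) h11 h12 h21 h22 ?_ ?_ ?_ y hy
  · intro y hp h hy
    refine red hr P hΘ hi (N := κ • 1 - TG P Θ i) ?_ hy hp (h (hy.sbar hr hi))
    intro f
    simp only [hBf, LinearMap.sub_apply, LinearMap.smul_apply, Module.End.one_apply, map_sub, qi,
      qj, map_add, map_smul]
    module
  · intro y hp h hy
    refine red hr P hΘ hj (N := μ • 1 - TG P Θ j) ?_ hy hp (h (hy.sbar hr hj))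
    intro f
    simp only [hBf, LinearMap.sub_apply, LinearMap.smul_apply, Module.End.one_apply, map_sub, qi,
      qj, map_add, map_smul]
    module
  · intro y hp1 hp2 hy
    have b1 := hy.sbar hr hi
    have b2 := b1.sbar hr hj
    have b3 := b2.sbar hr hi
    have c1 := hy.sbar hr hj
    have c2 := c1.sbar hr hi
    have c3 := c2.sbar hr hj
    have e1 : pj j (sbar i y) = 2 * pj i y + pj j y := by rw [h21]; ring
    have e2 : pj i (sbar j (sbar i y)) = pj i y + pj j y := by rw [h12, h21, h11]; ring
    have e3 : pj j (sbar i (sbar j (sbar i y))) = pj j y := by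
      rw [h21, e2, h22, e1]; ring
    have f1 : pj i (sbar j y) = pj i y + pj j y := by rw [h12]
    have f2 : pj j (sbar i (sbar j y)) = 2 * pj i y + pj j y := by rw [h21, h12, h22]; ring
    have f3 : pj i (sbar j (sbar i (sbar j y))) = pj i y := by
      rw [h12, f2, h11, f1]; ring
    have e4 : sbar i (sbar j (sbar i (sbar j y))) = sbar j (sbar i (sbar j (sbar i y))) := by
      rw [sbar_eq i (sbar j (sbar i (sbar j y))), f3, sbar_eq j (sbar i (sbar j y)), f2,
        sbar_eq i (sbar j y), f1, sbar_eq j y, sbar_eq j (sbar i (sbar j (sbar i y))), e3,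
        sbar_eq i (sbar j (sbar i y)), e2, sbar_eq j (sbar i y), e1, sbar_eq i y]
      module
    have t1 := box_pos hr P hΘ hp1 (hy.pj hr hi).2
    have t2 := box_pos hr P hΘ (by rw [e1]; linarith) (b1.pj hr hj).2
    have t3 := box_pos hr P hΘ (by rw [e2]; linarith) (b2.pj hr hi).2
    have t4 := box_pos hr P hΘ (by rw [e3]; linarith) (b3.pj hr hj).2
    have u1 := box_pos hr P hΘ hp2 (hy.pj hr hj).2
    have u2 := box_pos hr P hΘ (by rw [f1]; linarith) (c1.pj hr hi).2
    have u3 := box_pos hr P hΘ (by rw [f2]; linarith) (c2.pj hr hj).2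
    have u4 := box_pos hr P hΘ (by rw [f3]; linarith) (c3.pj hr hi).2
    simp only [hBf, t1, t2, t3, t4, u1, u2, u3, u4, map_smul]
    rw [e1, e2, e3, f1, f2, f3, e4, ht1, ht2]
    simp only [tw_pos Θ hi0, mul_one, smul_smul]
    rw [← sub_smul]
    convert zero_smul F _
    push_cast
    ring

/-- commuting operators on the box -/
theorem comm_box {i j : ℕ} (hi : i ≤ r) (hj : j ≤ r) (hi0 : i ≠ 0)
    (hij : pj i (vv r j) = 0) (hji : pj j (vv r i) = 0)
    (ht1 : ∀ y : E r, tw Θ j (sbar i y) = tw Θ j y)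
    {y : E r} (hy : Box y) :
    TG P Θ j (TG P Θ i (X F r y)) = TG P Θ i (TG P Θ j (X F r y)) := by
  set κ := kap r P i 0 with hκ
  set μ := kap r P j 0 with hμ
  have qi := TG_quad hr P hΘ hi
  have qj := TG_quad hr P hΘ hj
  rw [← hκ] at qi
  rw [← hμ] at qj
  set B : Module.End F (QA F r) := TG P Θ j * TG P Θ i - TG P Θ i * TG P Θ j
    with hB
  have hBf : ∀ f, B f = TG P Θ j (TG P Θ i f) - TG P Θ i (TG P Θ j f) :=
    fun f => rfl
  have h11 := pj_sbar hr i hi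
  have h22 := pj_sbar hr j hj
  have h12 : ∀ y : E r, pj i (sbar j y) = pj i y := by
    intro y; rw [sbar_eq, pj_sub, pj_smul, hij]; ring
  have h21 : ∀ y : E r, pj j (sbar i y) = pj j y := by
    intro y; rw [sbar_eq, pj_sub, pj_smul, hji]; ring
  suffices h : B (X F r y) = 0 by rw [hBf, sub_eq_zero] at h; exact h
  have r1 : ∀ y : E r, pj i y < 0 → Box y → B (X F r (sbar i y)) = 0 → B (X F r y) = 0 := by
    intro y hp hy h
    refine red hr P hΘ hi (N := κ • 1 - TG P Θ i) ?_ hy hp h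
    intro f
    simp only [hBf, LinearMap.sub_apply, LinearMap.smul_apply, Module.End.one_apply, map_sub, qi,
      qj, map_add, map_smul]
    module
  have r2 : ∀ y : E r, pj j y < 0 → Box y → B (X F r (sbar j y)) = 0 → B (X F r y) = 0 := by
    intro y hp hy h
    refine red hr P hΘ hj (N := μ • 1 - TG P Θ j) ?_ hy hp h
    intro f
    simp only [hBf, LinearMap.sub_apply, LinearMap.smul_apply, Module.End.one_apply, map_sub, qi,
      qj, map_add, map_smul]
    module
  have h0 : ∀ y : E r, 0 ≤ pj i y → 0 ≤ pj j y → Box y → B (X F r y) = 0 := by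
    intro y hp1 hp2 hy
    have b1 := hy.sbar hr hi
    have c1 := hy.sbar hr hj
    have e4 : sbar i (sbar j y) = sbar j (sbar i y) := by
      rw [sbar_eq i (sbar j y), h12, sbar_eq j (sbar i y), h21, sbar_eq i y, sbar_eq j y]
      module
    rw [hBf, box_pos hr P hΘ hp1 (hy.pj hr hi).2, map_smul, box_pos hr P hΘ (by rw [h21]; linarith)
      (b1.pj hr hj).2, box_pos hr P hΘ hp2 (hy.pj hr hj).2, map_smul, box_pos hr P hΘ
      (by rw [h12]; linarith) (c1.pj hr hi).2, h12, h21, e4, ht1]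
    simp only [tw_pos Θ hi0, mul_one, smul_smul]
    rw [← sub_smul]
    convert zero_smul F _
    push_cast
    ring
  have h1 : ∀ y : E r, 0 ≤ pj i y → Box y → B (X F r y) = 0 := by
    intro y hp hy
    rcases le_or_gt 0 (pj j y) with h | h
    · exact h0 y hp h hy
    · exact r2 y h hy (h0 _ (by rw [h12]; exact hp) (by rw [h22]; linarith) (hy.sbar hr hj))
  rcases le_or_gt 0 (pj i y) with h | h
  · exact h1 y h hy
  · exact r1 y h hy (h1 _ (by rw [h11]; linarith) (hy.sbar hr hi))

end braid


section braid2
set_option linter.unusedSectionVars false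
set_option linter.unusedSimpArgs false
set_option linter.unusedVariables false
variable {F} {r}

theorem absB {V : Type*} [AddCommGroup V] [Module F V] {S L x1 x2 y1 y2 : Module.End F V}
    {κ μ ν : F} (sx1 : ∀ f, S (x1 f) = x2 (S f - κ • f)) (sx2 : ∀ f, S (x2 f) = x1 (S f) + κ • x2 f)
    (sy2 : ∀ f, S (y2 f) = y1 (S f - κ • f)) (sy1 : ∀ f, S (y1 f) = y2 (S f) + κ • y1 f)
    (lx1 : ∀ f, L (x1 f) = x1 (L f)) (ly1 : ∀ f, L (y1 f) = y1 (L f))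
    (lx2 : ∀ f, L (x2 f) = y2 (L f - μ • f) - ν • f)
    (ly2 : ∀ f, L (y2 f) = x2 (L f) + μ • y2 f + ν • f)
    (qS : ∀ f, S (S f) = κ • S f + f) (qL : ∀ f, L (L f) = μ • L f + f) (f : V) :
    (L (S (L (S (x1 f)))) - S (L (S (L (x1 f)))) = y1 (L (S (L (S f))) - S (L (S (L f))))) ∧
    (L (S (L (S (x2 f)))) - S (L (S (L (x2 f)))) = y2 (L (S (L (S f))) - S (L (S (L f))))) := by
  constructor
  · simp only [sx1, sx2, sy1, sy2, lx1, lx2, ly1, ly2, map_sub, map_add, map_smul, qS, qL]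
    module
  · simp only [sx1, sx2, sy1, sy2, lx1, lx2, ly1, ly2, map_sub, map_add, map_smul, qS, qL]
    module

theorem absA {V : Type*} [AddCommGroup V] [Module F V] {S L x1 x2 x3 : Module.End F V}
    {κ : F} (sx1 : ∀ f, S (x1 f) = x2 (S f - κ • f)) (sx2 : ∀ f, S (x2 f) = x1 (S f) + κ • x2 f)
    (lx2 : ∀ f, L (x2 f) = x3 (L f - κ • f)) (lx3 : ∀ f, L (x3 f) = x2 (L f) + κ • x3 f)
    (lx1 : ∀ f, L (x1 f) = x1 (L f)) (sx3 : ∀ f, S (x3 f) = x3 (S f))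
    (qS : ∀ f, S (S f) = κ • S f + f) (qL : ∀ f, L (L f) = κ • L f + f) (f : V) :
    (S (L (S (x1 f))) - L (S (L (x1 f))) = x3 (S (L (S f)) - L (S (L f)))) ∧
    (S (L (S (x2 f))) - L (S (L (x2 f))) = x2 (S (L (S f)) - L (S (L f)))) ∧
    (S (L (S (x3 f))) - L (S (L (x3 f))) = x1 (S (L (S f)) - L (S (L f)))) := by
  refine ⟨?_, ?_, ?_⟩
  · simp only [sx1, sx2, sx3, lx1, lx2, lx3, map_sub, map_add, map_smul, qS, qL]
    module
  · simp only [sx1, sx2, sx3, lx1, lx2, lx3, map_sub, map_add, map_smul, qS, qL]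
    module
  · simp only [sx1, sx2, sx3, lx1, lx2, lx3, map_sub, map_add, map_smul, qS, qL]
    module

theorem op_zero {B : Module.End F (QA F r)} (h : ∀ y, B (X F r y) = 0) (f : QA F r) : B f = 0 := by
  have : B = 0 := by apply op_ext; intro y; rw [h]; rfl
  rw [this]; rfl

variable (hr : 2 ≤ r) (P : Prm F) {Θ : E r → Fin r → Fˣ} (hΘ : GoodTheta P.qh Θ)
include hr hΘ

theorem braidA (a b c : Fin r) (hab : (b : ℕ) = a + 1) (hbc : (c : ℕ) = b + 1) (f : QA F r) :
    TG P Θ (a + 1) (TG P Θ (b + 1) (TG P Θ (a + 1) f)) =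
      TG P Θ (b + 1) (TG P Θ (a + 1) (TG P Θ (b + 1) f)) := by
  have hc := c.2
  have hac : a ≠ c := by intro h; rw [h] at hab; omega
  have nab := ne_mid hab
  have nbc := ne_mid hbc
  have ka := kj_mid P a b hab
  have kb := kj_mid P b c hbc
  have hκ : kap r P (b + 1) 0 = kap r P (a + 1) 0 := by
    rw [kap_zero, kap_zero, ka.1, kb.1]
  set B : Module.End F (QA F r) := TG P Θ (a + 1) * TG P Θ (b + 1) * TG P Θ (a + 1) -
    TG P Θ (b + 1) * TG P Θ (a + 1) * TG P Θ (b + 1) with hB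
  have hBf : ∀ f, B f = TG P Θ (a + 1) (TG P Θ (b + 1) (TG P Θ (a + 1) f)) -
      TG P Θ (b + 1) (TG P Θ (a + 1) (TG P Θ (b + 1) f)) := fun f => rfl
  have oc : pj (a + 1) (eV r c) = 0 := by
    rw [pj_mid a b hab, eV_apply, eV_apply]; simp [hac, hac.symm, nbc, nbc.symm]
  have oa : pj (b + 1) (eV r a) = 0 := by
    rw [pj_mid b c hbc, eV_apply, eV_apply]; simp [hac, hac.symm, nab, nab.symm]
  have m1 := TG_mid1 P Θ b c hbc
  have m3 := TG_mid3 P Θ b c hbc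
  have qb := TG_quad hr P hΘ (j := b + 1) (by omega)
  rw [hκ] at m1 m3 qb
  have key := absA (TG_mid1 P Θ a b hab) (TG_mid3 P Θ a b hab) m1 m3
    (TG_orth hr P hΘ oa) (TG_orth hr P hΘ oc) (TG_quad hr P hΘ (by omega)) qb
  have : B f = 0 := by
    refine op_zero (vanish (B := B) ?_ ?_) f
    · intro d
      by_cases h1 : d = a
      · subst h1; exact ⟨_, Mu_inj _, Or.inl fun f => (key f).1⟩
      by_cases h2 : d = b
      · subst h2; exact ⟨_, Mu_inj _, Or.inl fun f => (key f).2.1⟩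
      by_cases h3 : d = c
      · subst h3; exact ⟨_, Mu_inj _, Or.inl fun f => (key f).2.2⟩
      refine ⟨_, Mu_inj (eV r d), Or.inl fun f => ?_⟩
      have o1 : pj (a + 1) (eV r d) = 0 := by
        rw [pj_mid a b hab, eV_apply, eV_apply]; simp [Ne.symm h1, Ne.symm h2, h1, h2]
      have o2 : pj (b + 1) (eV r d) = 0 := by
        rw [pj_mid b c hbc, eV_apply, eV_apply]; simp [Ne.symm h3, Ne.symm h2, h3, h2]
      simp only [hBf, TG_orth hr P hΘ o1, TG_orth hr P hΘ o2, map_sub]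
    · intro y hy
      rw [hBf, sub_eq_zero]
      refine braidA_box hr P hΘ (by omega) (by omega) (by omega) (by omega) (by rw [ka.1, kb.1])
        (by rw [ka.2, kb.2]) ?_ ?_ hy
      · rw [vv_mid b c hbc, pj_sub, oc, pj_mid a b hab, eV_apply, eV_apply]; simp [nab, nab.symm]
      · rw [vv_mid a b hab, pj_sub, oa, pj_mid b c hbc, eV_apply, eV_apply]; simp [nbc, nbc.symm]
  rw [hBf, sub_eq_zero] at this; exact this

theorem braidB_gen {i j : ℕ} (hi : i ≤ r) (hj : j ≤ r) (hi0 : i ≠ 0)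
    (hij : pj i (vv r j) = -1) (hji : pj j (vv r i) = -2)
    (ht1 : ∀ y : E r, tw Θ j (sbar i (sbar j (sbar i y))) = tw Θ j y)
    (a b : Fin r) (ho : ∀ d, d ≠ a → d ≠ b → pj i (eV r d) = 0 ∧ pj j (eV r d) = 0)
    (sg : Bool) (N1 N2 : Module.End F (QA F r)) (hN1 : Function.Injective N1)
    (hN2 : Function.Injective N2) (x : F) (hx : x ≠ 0)
    (key : ∀ f : QA F r, ∀ B, (B = fun f => TG P Θ j (TG P Θ i (TG P Θ j (TG P Θ i f))) -
      TG P Θ i (TG P Θ j (TG P Θ i (TG P Θ j f)))) →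
      (B (x • Mu (if sg then eV r a else -eV r a) f) = N1 (B f)) ∧
      (B (x • Mu (if sg then eV r b else -eV r b) f) = N2 (B f))) (f : QA F r) :
    TG P Θ j (TG P Θ i (TG P Θ j (TG P Θ i f))) = TG P Θ i (TG P Θ j (TG P Θ i (TG P Θ j f))) := by
  set B : Module.End F (QA F r) := TG P Θ j * TG P Θ i * TG P Θ j * TG P Θ i -
    TG P Θ i * TG P Θ j * TG P Θ i * TG P Θ j
    with hB
  have hBf : ∀ f, B f = TG P Θ j (TG P Θ i (TG P Θ j (TG P Θ i f))) -
      TG P Θ i (TG P Θ j (TG P Θ i (TG P Θ j f))) :=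
    fun f => rfl
  have key2 := fun f => key f B rfl
  have aux : ∀ (d : Fin r) (N : Module.End F (QA F r)), Function.Injective N →
      (∀ f, B (x • Mu (if sg then eV r d else -eV r d) f) = N (B f)) →
      ∃ M : Module.End F (QA F r), Function.Injective M ∧
        ((∀ f, B (Mu (eV r d) f) = M (B f)) ∨ (∀ f, B (Mu (-eV r d) f) = M (B f))) := by
    intro d N hN h
    refine ⟨x⁻¹ • N, ?_, ?_⟩
    · exact (smul_right_injective _ (inv_ne_zero hx)).comp hN
    · have : ∀ f, B (Mu (if sg then eV r d else -eV r d) f) = (x⁻¹ • N) (B f) := by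
        intro f
        rw [LinearMap.smul_apply, ← h, map_smul, inv_smul_smul₀ hx]
      cases sg
      · exact Or.inr (by simpa using this)
      · exact Or.inl (by simpa using this)
  have : B f = 0 := by
    refine op_zero (vanish (B := B) ?_ ?_) f
    · intro d
      by_cases h1 : d = a
      · subst h1; exact aux _ N1 hN1 fun f => (key2 f).1
      by_cases h2 : d = b
      · subst h2; exact aux _ N2 hN2 fun f => (key2 f).2
      obtain ⟨o1, o2⟩ := ho d h1 h2
      refine ⟨_, Mu_inj (eV r d), Or.inl fun f => ?_⟩
      simp only [hBf, TG_orth hr P hΘ o1, TG_orth hr P hΘ o2, map_sub]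
    · intro y hy
      rw [hBf, sub_eq_zero]
      exact braidB_box hr P hΘ hi hj hi0 hij hji ht1 hy
  rw [hBf, sub_eq_zero] at this; exact this

theorem braidB_last (a b : Fin r) (hab : (b : ℕ) = a + 1) (hb : (b : ℕ) = r - 1) (f : QA F r) :
    TG P Θ r (TG P Θ (a + 1) (TG P Θ r (TG P Θ (a + 1) f))) =
      TG P Θ (a + 1) (TG P Θ r (TG P Θ (a + 1) (TG P Θ r f))) := by
  have nab := ne_mid hab
  have hb' : (⟨r - 1, by omega⟩ : Fin r) = b := Fin.ext hb.symm
  have hv : vv r r = eV r b := by rw [vv_last hr, hb']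
  have hp : ∀ y : E r, pj r y = 2 * y b := by intro y; rw [pj_last hr, hb']
  have hZl : Zl P r = Mu (eV r b) := by
    unfold Zl cc; rw [if_neg (by omega), hv]; simp
  have hZi : Zi P r = Mu (-eV r b) := by
    unfold Zi cc; rw [if_neg (by omega), hv]; simp
  have oa : pj r (eV r a) = 0 := by rw [hp, eV_apply]; simp [nab, nab.symm]
  have key := absB (TG_mid1 P Θ a b hab) (TG_mid3 P Θ a b hab) (TG_mid2 P Θ a b hab)
    (TG_mid4 P Θ a b hab) (TG_orth hr P hΘ oa) (TG_orth' hr P hΘ oa)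
    (by have := TG_Zl hr P hΘ (le_refl r); rwa [hZl, hZi] at this)
    (by have := TG_Zi hr P hΘ (le_refl r); rwa [hZl, hZi] at this)
    (TG_quad hr P hΘ (by omega)) (TG_quad hr P hΘ (le_refl r))
  refine braidB_gen hr P hΘ (by omega) le_rfl (by omega) ?_ ?_ ?_ a b ?_ true (Mu (-eV r a))
    (Mu (-eV r b)) (Mu_inj _) (Mu_inj _) 1 one_ne_zero ?_ f
  · rw [hv, pj_mid a b hab, eV_apply, eV_apply]; simp [nab, nab.symm]
  · rw [hp, vv_mid a b hab, Pi.sub_apply, eV_apply, eV_apply]; simp [nab, nab.symm]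
  · intro y; rw [tw_pos _ (by omega), tw_pos _ (by omega)]
  · intro d h1 h2
    constructor
    · rw [pj_mid a b hab, eV_apply, eV_apply]; simp [h1, h2, h1.symm, h2.symm]
    · rw [hp, eV_apply]; simp [h2, h2.symm]
  · rintro f _ rfl
    simpa only [one_smul, if_true] using key f

theorem braidB_zero (a b : Fin r) (hab : (b : ℕ) = a + 1) (ha : (a : ℕ) = 0) (f : QA F r) :
    TG P Θ 0 (TG P Θ (a + 1) (TG P Θ 0 (TG P Θ (a + 1) f))) =
      TG P Θ (a + 1) (TG P Θ 0 (TG P Θ (a + 1) (TG P Θ 0 f))) := by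
  have nab := ne_mid hab
  have ha' : (⟨0, by omega⟩ : Fin r) = a := Fin.ext ha.symm
  have hv : vv r 0 = -eV r a := by rw [vv_zero hr, ha']
  have hp : ∀ y : E r, pj 0 y = -2 * y a := by intro y; rw [pj_zero hr, ha']
  have hq : (P.qh : F) ≠ 0 := P.qh.ne_zero
  have hZl : Zl P 0 = (P.qh : F) • Mu (-eV r a) := by
    unfold Zl cc; rw [if_pos rfl, hv]
  have hZi : Zi P 0 = (P.qh : F)⁻¹ • Mu (eV r a) := by
    unfold Zi cc; rw [if_pos rfl, hv, neg_neg]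
  have ob : pj 0 (eV r b) = 0 := by rw [hp, eV_apply]; simp [nab, nab.symm]
  have key := absB (S := TG P Θ (a + 1)) (L := TG P Θ 0) (x1 := (P.qh : F) • Mu (-eV r b))
    (x2 := (P.qh : F) • Mu (-eV r a)) (y1 := (P.qh : F)⁻¹ • Mu (eV r b))
    (y2 := (P.qh : F)⁻¹ • Mu (eV r a)) (κ := kap r P (a + 1) 0) (μ := kap r P 0 0)
    (ν := kap r P 0 1)
    (by intro f; simp only [LinearMap.smul_apply, map_smul, TG_mid2 P Θ a b hab])
    (by intro f; simp only [LinearMap.smul_apply, map_smul, TG_mid4 P Θ a b hab]; module)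
    (by intro f; simp only [LinearMap.smul_apply, map_smul, TG_mid1 P Θ a b hab])
    (by intro f; simp only [LinearMap.smul_apply, map_smul, TG_mid3 P Θ a b hab]; module)
    (by intro f; simp only [LinearMap.smul_apply, map_smul, TG_orth' hr P hΘ ob])
    (by intro f; simp only [LinearMap.smul_apply, map_smul, TG_orth hr P hΘ ob])
    (by have := TG_Zl hr P hΘ (Nat.zero_le r); rwa [hZl, hZi] at this)
    (by have := TG_Zi hr P hΘ (Nat.zero_le r); rwa [hZl, hZi] at this)
    (TG_quad hr P hΘ (by omega)) (TG_quad hr P hΘ (Nat.zero_le r))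
  refine braidB_gen hr P hΘ (by omega) (Nat.zero_le r) (by omega) ?_ ?_ ?_ b a ?_ false
    ((P.qh : F)⁻¹ • Mu (eV r b)) ((P.qh : F)⁻¹ • Mu (eV r a))
    ((smul_right_injective _ (inv_ne_zero hq)).comp (Mu_inj _))
    ((smul_right_injective _ (inv_ne_zero hq)).comp (Mu_inj _)) P.qh hq ?_ f
  · rw [hv, pj_neg, pj_mid a b hab, eV_apply, eV_apply]; simp [nab, nab.symm]
  · rw [hp, vv_mid a b hab, Pi.sub_apply, eV_apply, eV_apply]; simp [nab, nab.symm]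
  · intro y
    rw [tw_zero hr, tw_zero hr, ha', hΘ.mid hr _ a b hab, Equiv.swap_apply_left, sbar_zero_ng hr,
      ha', hΘ.ng hr, if_neg nab.symm, hΘ.mid hr _ a b hab, Equiv.swap_apply_right]
  · intro d h1 h2
    constructor
    · rw [pj_mid a b hab, eV_apply, eV_apply]; simp [h1, h2, h1.symm, h2.symm]
    · rw [hp, eV_apply]; simp [h2, h2.symm]
  · rintro f _ rfl
    simpa using key f

omit hΘ in
theorem pj_eV_ne {j : ℕ} (hj : j ≤ r) {c : Fin r} (h : pj j (eV r c) ≠ 0) :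
    (c : ℕ) + 1 = j ∨ (c : ℕ) = j := by
  refine basis_cases hr hj c (fun h' => absurd h' h) ?_ ?_
  · rintro a b hab rfl (rfl | rfl)
    · exact Or.inl rfl
    · exact Or.inr hab
  · rintro (⟨rfl, h, _⟩ | ⟨rfl, h, _⟩) <;> omega

omit hΘ in
theorem pj_vv_zero {i j : ℕ} (hi : i ≤ r)
    (hij : ∀ c : Fin r, pj i (eV r c) = 0 ∨ pj j (eV r c) = 0) : pj j (vv r i) = 0 := by
  revert hij
  refine jcases hr ?_ ?_ ?_ i hi
  · intro h
    rw [vv_zero hr, pj_neg, (h ⟨0, by omega⟩).resolve_left, neg_zero]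
    rw [pj_zero hr, eV_apply]; simp
  · intro h
    rw [vv_last hr, (h ⟨r - 1, by omega⟩).resolve_left]
    rw [pj_last hr, eV_apply]; simp
  · intro a b hab h
    have nab := ne_mid hab
    rw [vv_mid a b hab, pj_sub, (h a).resolve_left, (h b).resolve_left, sub_zero]
    · rw [pj_mid a b hab, eV_apply, eV_apply]; simp [nab, nab.symm]
    · rw [pj_mid a b hab, eV_apply, eV_apply]; simp [nab, nab.symm]

theorem comm_int {i j : ℕ} (hi : i ≤ r)
    (hij : ∀ c : Fin r, pj i (eV r c) = 0 ∨ pj j (eV r c) = 0) (c : Fin r)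
    (hc : pj j (eV r c) = 0) : ∃ M : Module.End F (QA F r),
      Function.Injective M ∧
        ((∀ f, TG P Θ j (TG P Θ i (Mu (eV r c) f)) - TG P Θ i (TG P Θ j (Mu (eV r c) f)) =
          M (TG P Θ j (TG P Θ i f) - TG P Θ i (TG P Θ j f))) ∨
        (∀ f, TG P Θ j (TG P Θ i (Mu (-eV r c) f)) - TG P Θ i (TG P Θ j (Mu (-eV r c) f)) =
          M (TG P Θ j (TG P Θ i f) - TG P Θ i (TG P Θ j f)))) := by
  refine basis_cases hr hi c ?_ ?_ ?_
  · intro ho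
    refine ⟨_, Mu_inj (eV r c), Or.inl fun f => ?_⟩
    simp only [TG_orth hr P hΘ ho, TG_orth hr P hΘ hc, map_sub]
  · intro a b hab hi' hcab
    subst hi'
    have nab := ne_mid hab
    have ha : pj j (eV r a) = 0 := (hij a).resolve_left (by
      rw [pj_mid a b hab, eV_apply, eV_apply]; simp [nab, nab.symm])
    have hb : pj j (eV r b) = 0 := (hij b).resolve_left (by
      rw [pj_mid a b hab, eV_apply, eV_apply]; simp [nab, nab.symm])
    rcases hcab with rfl | rfl
    · refine ⟨_, Mu_inj (eV r b), Or.inl fun f => ?_⟩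
      simp only [TG_orth hr P hΘ ha, TG_orth hr P hΘ hb, map_sub, map_smul, TG_mid1 P Θ c b hab]
      module
    · refine ⟨_, Mu_inj (eV r a), Or.inl fun f => ?_⟩
      simp only [TG_orth hr P hΘ ha, TG_orth hr P hΘ hb, map_sub, map_smul, map_add,
        TG_mid3 P Θ a c hab]
      module
  · intro h
    have hq := (cc P.qh i).ne_zero
    have zl : ∀ f, TG P Θ j (Zl P i f) = Zl P i (TG P Θ j f) := by
      intro f
      rcases h with ⟨_, _, h⟩ | ⟨_, _, h⟩
      · simp only [Zl, h, LinearMap.smul_apply, map_smul, TG_orth' hr P hΘ hc]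
      · simp only [Zl, h, LinearMap.smul_apply, map_smul, TG_orth hr P hΘ hc]
    have zi : ∀ f, TG P Θ j (Zi P i f) = Zi P i (TG P Θ j f) := by
      intro f
      have := congrArg (Zi P i) (zl (Zi P i f))
      rw [Zl_Zi, Zi_Zl] at this
      exact this.symm
    have key : ∀ f, TG P Θ j (TG P Θ i (Zl P i f)) - TG P Θ i (TG P Θ j (Zl P i f)) =
        Zi P i (TG P Θ j (TG P Θ i f) - TG P Θ i (TG P Θ j f)) := by
      intro f
      simp only [zl, zi, TG_Zl hr P hΘ hi, map_sub, map_smul]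
      module
    have key2 : ∀ f, TG P Θ j (TG P Θ i (Mu (vv r i) f)) - TG P Θ i (TG P Θ j (Mu (vv r i) f)) =
        ((cc P.qh i : F)⁻¹ • Zi P i) (TG P Θ j (TG P Θ i f) - TG P Θ i (TG P Θ j f)) := by
      intro f
      have := key f
      simp only [Zl, LinearMap.smul_apply, map_smul] at this
      rw [LinearMap.smul_apply, ← this, ← smul_sub, inv_smul_smul₀ hq]
    have inj : Function.Injective ((cc P.qh i : F)⁻¹ • Zi (r := r) P i) :=
      (smul_right_injective _ (inv_ne_zero hq)).comp (Zi_inj P i)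
    rcases h with ⟨_, _, h⟩ | ⟨_, _, h⟩
    · rw [h] at key2
      exact ⟨_, inj, Or.inr key2⟩
    · rw [h] at key2
      exact ⟨_, inj, Or.inl key2⟩

theorem TG_comm {i j : ℕ} (hj : j ≤ r) (hij : i + 2 ≤ j) (f : QA F r) :
    TG P Θ i (TG P Θ j f) = TG P Θ j (TG P Θ i f) := by
  have hi : i ≤ r := by omega
  have hc : ∀ c : Fin r, pj j (eV r c) = 0 ∨ pj i (eV r c) = 0 := by
    intro c
    by_contra h
    push Not at h
    have h1 := pj_eV_ne hr hj h.1
    have h2 := pj_eV_ne hr hi h.2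
    omega
  have hc' := fun c => (hc c).symm
  set B : Module.End F (QA F r) := TG P Θ i * TG P Θ j - TG P Θ j * TG P Θ i
    with hB
  have hBf : ∀ f, B f = TG P Θ i (TG P Θ j f) - TG P Θ j (TG P Θ i f) :=
    fun f => rfl
  have : B f = 0 := by
    refine op_zero (vanish (B := B) ?_ ?_) f
    · intro c
      rcases hc c with h | h
      · obtain ⟨M, hM, h⟩ := comm_int hr P hΘ hi hc' c h
        refine ⟨M, hM, ?_⟩
        rcases h with h | h
        · refine Or.inl fun f => ?_
          rw [hBf, hBf, ← neg_sub, h, ← map_neg, neg_sub]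
        · refine Or.inr fun f => ?_
          rw [hBf, hBf, ← neg_sub, h, ← map_neg, neg_sub]
      · exact comm_int hr P hΘ hj hc c h
    · intro y hy
      rw [hBf, sub_eq_zero]
      refine comm_box hr P hΘ hj hi (by omega) (pj_vv_zero hr hi hc') (pj_vv_zero hr hj hc) ?_ hy
      intro y
      by_cases h0 : i = 0
      · subst h0
        rw [tw_zero hr, tw_zero hr]
        by_cases hjr : j = r
        · subst hjr
          have e : sbar j y = ng ⟨j - 1, by omega⟩ y := by
            funext m; rw [sbar_last hr]; simp only [ng, Fin.ext_iff]
            have : ((m : ℕ) + 1 = j) ↔ (m : ℕ) = j - 1 := by omega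
            simp only [this]
          rw [e, hΘ.ng hr, if_neg]
          intro h; have := Fin.ext_iff.1 h; simp at this; omega
        · obtain ⟨d, rfl⟩ : ∃ d, j = d + 1 := ⟨j - 1, by omega⟩
          have := hΘ.mid hr y ⟨d, by omega⟩ ⟨d + 1, by omega⟩ rfl ⟨0, by omega⟩
          rw [Equiv.swap_apply_of_ne_of_ne] at this
          · exact this
          · intro h; have := Fin.ext_iff.1 h; simp at this; omega
          · intro h; have := Fin.ext_iff.1 h; simp at this
      · rw [tw_pos _ h0, tw_pos _ h0]
  rw [hBf, sub_eq_zero] at this; exact this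

end braid2


section yalg
set_option linter.unusedSectionVars false

/-- `U` elements: `Uel T r n = T_{r-n} ⋯ T_r ⋯ T_{r-n}` -/
def Uel {G : Type*} [Group G] (T : ℕ → G) (r : ℕ) : ℕ → G
  | 0 => T r
  | n + 1 => T (r - 1 - n) * Uel T r n * T (r - 1 - n)

/-- `Y` elements (index shifted by one) -/
def Yel {G : Type*} [Group G] (T : ℕ → G) (r : ℕ) : ℕ → G
  | 0 => T 0 * Uel T r (r - 1)
  | n + 1 => (T (n + 1))⁻¹ * Yel T r n * (T (n + 1))⁻¹

variable {G : Type*} [Group G] {T : ℕ → G} {r : ℕ} (hr : 2 ≤ r)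
  (hc : ∀ i j, j ≤ r → i + 2 ≤ j → Commute (T i) (T j))
  (hA : ∀ i, 1 ≤ i → i + 1 < r → T i * T (i + 1) * T i = T (i + 1) * T i * T (i + 1))
  (hB : T r * T (r - 1) * T r * T (r - 1) = T (r - 1) * T r * T (r - 1) * T r)
  (hZ : T 0 * T 1 * T 0 * T 1 = T 1 * T 0 * T 1 * T 0)

include hc in
theorem Uel_comm0 : ∀ n j : ℕ, j + 2 + n ≤ r → Commute (T j) (Uel T r n)
  | 0, j, h => hc j r le_rfl (by omega)
  | n + 1, j, h => by
    have h1 := hc j (r - 1 - n) (by omega) (by omega)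
    exact (h1.mul_right (Uel_comm0 n j (by omega))).mul_right h1

include hr hc hA hB in
theorem Uel_comm1 : ∀ n j : ℕ, n < r → r + 1 ≤ j + n → j ≤ r → Commute (T j) (Uel T r n)
  | 0, j, h, h1, h2 => by omega
  | 1, j, h, h1, h2 => by
    have : j = r := by omega
    subst this
    show T j * (T (j - 1 - 0) * T j * T (j - 1 - 0)) = (T (j - 1 - 0) * T j * T (j - 1 - 0)) * T j
    rw [Nat.sub_zero, ← hB]; simp only [mul_assoc]
  | n + 2, j, h, h1, h2 => by
    by_cases hj : r + 1 ≤ j + (n + 1)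
    · have e := (hc (r - 1 - (n + 1)) j h2 (by omega)).symm
      exact (e.mul_right (Uel_comm1 (n + 1) j (by omega) hj h2)).mul_right e
    · have e := Uel_comm0 hc n (r - 1 - (n + 1)) (by omega)
      have hj' : r - 1 - n = j := by omega
      have b := hA (r - 1 - (n + 1)) (by omega) (by omega)
      rw [show r - 1 - (n + 1) + 1 = j by omega] at b
      show T j * (T (r - 1 - (n + 1)) * (T (r - 1 - n) * Uel T r n * T (r - 1 - n)) *
        T (r - 1 - (n + 1))) = (T (r - 1 - (n + 1)) * (T (r - 1 - n) * Uel T r n * T (r - 1 - n)) *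
        T (r - 1 - (n + 1))) * T j
      rw [hj']
      generalize T (r - 1 - (n + 1)) = a at *
      generalize Uel T r n = u at *
      generalize T j = c at *
      calc c * (a * (c * u * c) * a) = (c * a * c) * u * c * a := by simp only [mul_assoc]
        _ = a * c * (a * u) * c * a := by rw [← b]; simp only [mul_assoc]
        _ = a * c * u * (a * c * a) := by rw [e.eq]; simp only [mul_assoc]
        _ = _ := by rw [b]; simp only [mul_assoc]

/-- `U_2` commutes with anything commuting with `T_j`, `j ≥ r-n` -/
theorem Uel_comm2 (g : G) : ∀ n : ℕ, n < r → (∀ j, r ≤ j + n → j ≤ r → Commute g (T j)) →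
    Commute g (Uel T r n)
  | 0, _, h => h r (by omega) le_rfl
  | n + 1, hn, h => by
    have e := h (r - 1 - n) (by omega) (by omega)
    exact (e.mul_right (Uel_comm2 g n (by omega) fun j h1 h2 => h j (by omega) h2)).mul_right e

include hr hc hA hB in
theorem Yel_comm0 : ∀ n j : ℕ, n < r → 1 ≤ j → j ≤ r → j ≠ n → j ≠ n + 1 →
    Commute (T j) (Yel T r n)
  | 0, j, hn, h1, h2, h3, h4 => (hc 0 j h2 (by omega)).symm.mul_right
      (Uel_comm1 hr hc hA hB (r - 1) j (by omega) (by omega) h2)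
  | n + 1, j, hn, h1, h2, h3, h4 => by
    by_cases hj : j = n
    · subst hj
      obtain ⟨m, rfl⟩ : ∃ m, j = m + 1 := ⟨j - 1, by omega⟩
      have e := Yel_comm0 m (m + 2) (by omega) (by omega) (by omega) (by omega) (by omega)
      have b := hA (m + 1) (by omega) (by omega)
      show T (m + 1) * ((T (m + 1 + 1))⁻¹ * ((T (m + 1))⁻¹ * Yel T r m * (T (m + 1))⁻¹) *
        (T (m + 1 + 1))⁻¹) = ((T (m + 1 + 1))⁻¹ * ((T (m + 1))⁻¹ * Yel T r m * (T (m + 1))⁻¹) *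
        (T (m + 1 + 1))⁻¹) * T (m + 1)
      rw [show m + 2 = m + 1 + 1 from rfl] at e
      generalize T (m + 1 + 1) = c at *
      generalize T (m + 1) = a at *
      generalize Yel T r m = u at *
      have b1 : a * c⁻¹ * a⁻¹ = c⁻¹ * a⁻¹ * c := by
        rw [mul_inv_eq_iff_eq_mul, mul_inv_eq_iff_eq_mul]
        have : c⁻¹ * a⁻¹ * c * a * c = c⁻¹ * a⁻¹ * (c * a * c) := by simp only [mul_assoc]
        rw [this, ← b]; group
      have b2 : c * a⁻¹ * c⁻¹ = a⁻¹ * c⁻¹ * a := by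
        rw [mul_inv_eq_iff_eq_mul, mul_inv_eq_iff_eq_mul]
        have : a⁻¹ * c⁻¹ * a * c * a = a⁻¹ * c⁻¹ * (a * c * a) := by simp only [mul_assoc]
        rw [this, b]; group
      calc a * (c⁻¹ * (a⁻¹ * u * a⁻¹) * c⁻¹) = (a * c⁻¹ * a⁻¹) * u * a⁻¹ * c⁻¹ := by
            simp only [mul_assoc]
        _ = c⁻¹ * a⁻¹ * (c * u) * a⁻¹ * c⁻¹ := by rw [b1]; simp only [mul_assoc]
        _ = c⁻¹ * a⁻¹ * u * (c * a⁻¹ * c⁻¹) := by rw [e.eq]; simp only [mul_assoc]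
        _ = _ := by rw [b2]; simp only [mul_assoc]
    · have e : Commute (T j) (T (n + 1)) := by
        rcases lt_or_gt_of_ne h3 with h | h
        · exact hc j (n + 1) (by omega) (by omega)
        · exact (hc (n + 1) j h2 (by omega)).symm
      exact (e.inv_right.mul_right (Yel_comm0 n j (by omega) h1 h2 hj (by omega))).mul_right
        e.inv_right

include hr hc hA hB hZ in
theorem Yel_comm01 : Commute (Yel T r 0) (Yel T r 1) := by
  have hU : Uel T r (r - 1) = T 1 * Uel T r (r - 2) * T 1 := by
    obtain ⟨m, rfl⟩ : ∃ m, r = m + 2 := ⟨r - 2, by omega⟩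
    show T (m + 2 - 1 - m) * Uel T (m + 2) m * T (m + 2 - 1 - m) = _
    rw [show m + 2 - 1 - m = 1 by omega]; rfl
  have c0 : Commute (T 0) (Uel T r (r - 2)) := Uel_comm0 hc _ _ (by omega)
  have c1 : Commute (T 1 * Uel T r (r - 2) * T 1) (Uel T r (r - 2)) := by
    rw [← hU]
    refine Uel_comm2 _ _ (by omega) fun j h1 h2 => ?_
    exact (Uel_comm1 hr hc hA hB (r - 1) j (by omega) (by omega) h2).symm
  show T 0 * Uel T r (r - 1) * ((T 1)⁻¹ * (T 0 * Uel T r (r - 1)) * (T 1)⁻¹) =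
    ((T 1)⁻¹ * (T 0 * Uel T r (r - 1)) * (T 1)⁻¹) * (T 0 * Uel T r (r - 1))
  rw [hU]
  generalize Uel T r (r - 2) = u at *
  generalize T 0 = a at *
  generalize T 1 = b at *
  have c1' : b * u * b * u = u * (b * u * b) := c1.eq
  calc a * (b * u * b) * (b⁻¹ * (a * (b * u * b)) * b⁻¹) = a * b * (u * a) * b * u := by group
    _ = b⁻¹ * (b * a * b * a) * u * b * u := by rw [← c0.eq]; group
    _ = b⁻¹ * a * b * a * (b * u * b * u) := by rw [← hZ]; group
    _ = b⁻¹ * a * b * (a * u) * b * u * b := by rw [c1']; group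
    _ = _ := by rw [c0.eq]; group

include hr hc hA hB hZ in
theorem Yel_comm_aux0 : ∀ n : ℕ, n + 1 < r → Commute (Yel T r 0) (Yel T r (n + 1))
  | 0, _ => Yel_comm01 hr hc hA hB hZ
  | n + 1, h => by
    have e := (Yel_comm0 hr hc hA hB 0 (n + 2) (by omega) (by omega) (by omega) (by omega)
      (by omega)).symm.inv_right
    exact (e.mul_right (Yel_comm_aux0 n (by omega))).mul_right e

include hr hc hA hB hZ in
theorem Yel_comm_aux : ∀ n m : ℕ, n < m → m < r → Commute (Yel T r n) (Yel T r m)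
  | 0, m, h1, h2 => by
    obtain ⟨k, rfl⟩ : ∃ k, m = k + 1 := ⟨m - 1, by omega⟩
    exact Yel_comm_aux0 hr hc hA hB hZ k h2
  | n + 1, m, h1, h2 => by
    have e := (Yel_comm0 hr hc hA hB m (n + 1) (by omega) (by omega) (by omega) (by omega)
      (by omega)).inv_left
    exact (e.mul_left (Yel_comm_aux n m (by omega) h2)).mul_left e

include hr hc hA hB hZ in
theorem Yel_comm (n m : ℕ) (hn : n < r) (hm : m < r) : Commute (Yel T r n) (Yel T r m) := by
  rcases lt_trichotomy n m with h | rfl | h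
  · exact Yel_comm_aux hr hc hA hB hZ n m h hm
  · exact Commute.refl _
  · exact (Yel_comm_aux hr hc hA hB hZ m n h hn).symm

end yalg


section matching
set_option linter.unusedSectionVars false
set_option linter.unusedSimpArgs false

theorem Uel_prod {G : Type*} [Group G] (T : ℕ → G) (r : ℕ) : ∀ n, n ≤ r → Uel T r n =
    ((List.range n).map (fun m => T (r - n + m))).prod * T r *
      ((List.range n).map (fun m => T (r - 1 - m))).prod
  | 0, _ => by simp [Uel]
  | n + 1, h => by
    rw [Uel, Uel_prod T r n (by omega), List.prod_range_succ', List.prod_range_succ]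
    have e1 : r - (n + 1) + 0 = r - 1 - n := by omega
    have e2 : (fun i => T (r - (n + 1) + i.succ)) = fun m => T (r - n + m) := by
      funext i; congr 1; omega
    rw [e1, e2]
    simp only [mul_assoc]

theorem Yel_prod {G : Type*} [Group G] (T : ℕ → G) (r : ℕ) (hr : 2 ≤ r) : ∀ n, n < r → Yel T r n =
    (((List.range n).map (· + 1)).reverse.map (fun j => (T j)⁻¹)).prod *
      ((Ylist r (n + 1)).map T).prod
  | 0, _ => by
    rw [Yel, Uel_prod T r (r - 1) (by omega)]
    have e1 : ∀ m, r - (r - 1) + m = m + 1 := by intro m; omega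
    simp [Ylist, e1, List.map_map, Function.comp_def, mul_assoc]
  | n + 1, h => by
    rw [Yel, Yel_prod T r hr n (by omega)]
    have e : (Ylist r (n + 1)) = Ylist r (n + 1 + 1) ++ [n + 1] := by
      have e1 : r - (n + 1) = (r - (n + 1 + 1)) + 1 := by omega
      simp only [Ylist]
      rw [e1, List.range_succ, List.map_append]
      simp only [List.append_assoc, List.cons_append, List.map_cons, List.map_nil]
      have : r - 1 - (r - (n + 1 + 1)) = n + 1 := by omega
      rw [this]
    rw [e, List.range_succ]
    simp [mul_assoc]

variable {F} {r}

/-- the `Y` operators in unified form -/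
def YG (P : Prm F) (Θ : E r → Fin r → Fˣ) (i : ℕ) : Module.End F (QA F r) :=
  ((((List.range (i - 1)).map (· + 1)).reverse.map (fun j => TG P Θ j - kap r P j 0 • 1)).prod) *
    (((Ylist r i).map (TG P Θ)).prod)

variable (hr : 2 ≤ r) (P : Prm F) {Θ : E r → Fin r → Fˣ} (hΘ : GoodTheta P.qh Θ)

include hr hΘ in
theorem exists_units : ∃ T : ℕ → (Module.End F (QA F r))ˣ, ∀ j, j ≤ r →
    (T j).val = TG P Θ j ∧ ((T j)⁻¹).val = TG P Θ j - kap r P j 0 • 1 := by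
  have h : ∀ j, ∃ u : (Module.End F (QA F r))ˣ, j ≤ r →
    u.val = TG P Θ j ∧ (u⁻¹).val = TG P Θ j - kap r P j 0 • 1 := by
    intro j
    by_cases hj : j ≤ r
    · have q : TG P Θ j * TG P Θ j = kap r P j 0 • TG P Θ j + 1 := by
        apply LinearMap.ext; intro f
        simpa using TG_quad hr P hΘ hj f
      refine ⟨⟨TG P Θ j, TG P Θ j - kap r P j 0 • 1, ?_, ?_⟩, fun _ => ⟨rfl, rfl⟩⟩
      · rw [mul_sub, q, mul_smul_comm, mul_one]; abel
      · rw [sub_mul, q, smul_mul_assoc, one_mul]; abel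
    · exact ⟨1, fun h => absurd h hj⟩
  choose T hT using h
  exact ⟨T, hT⟩

theorem mem_Ylist {i j : ℕ} (h : j ∈ Ylist r i) : j ≤ r := by
  simp only [Ylist, List.mem_cons, List.mem_append, List.mem_map, List.mem_range,
    List.not_mem_nil, or_false] at h
  rcases h with h | (⟨a, ha, h⟩ | h) | ⟨a, ha, h⟩ <;> omega

theorem mem_inv {i j : ℕ} (hi : i ≤ r) (h : j ∈ ((List.range (i - 1)).map (· + 1)).reverse) :
    1 ≤ j ∧ j < r := by
  simp only [List.mem_reverse, List.mem_map, List.mem_range] at h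
  rcases h with ⟨a, ha, h⟩ 
  omega

include hr hΘ in
theorem YG_comm {i j : ℕ} (hi : 1 ≤ i) (hi' : i ≤ r) (hj : 1 ≤ j) (hj' : j ≤ r) :
    Commute (YG P Θ i) (YG P Θ j) := by
  obtain ⟨T, hT⟩ := exists_units hr P hΘ
  have hc : ∀ i j, j ≤ r → i + 2 ≤ j → Commute (T i) (T j) := by
    intro i j h1 h2
    apply Units.ext
    rw [Units.val_mul, Units.val_mul, (hT i (by omega)).1, (hT j h1).1]
    exact LinearMap.ext fun f => TG_comm hr P hΘ h1 h2 f
  have hA : ∀ i, 1 ≤ i → i + 1 < r → T i * T (i + 1) * T i = T (i + 1) * T i * T (i + 1) := by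
    intro i h1 h2
    apply Units.ext
    simp only [Units.val_mul]
    rw [(hT i (by omega)).1, (hT (i + 1) (by omega)).1]
    apply LinearMap.ext; intro f
    have := braidA hr P hΘ ⟨i - 1, by omega⟩ ⟨i, by omega⟩ ⟨i + 1, by omega⟩
      (by show i = i - 1 + 1; omega) rfl f
    simp only [show i - 1 + 1 = i by omega] at this
    exact this
  have hB : T r * T (r - 1) * T r * T (r - 1) = T (r - 1) * T r * T (r - 1) * T r := by
    apply Units.ext
    simp only [Units.val_mul]
    rw [(hT r le_rfl).1, (hT (r - 1) (by omega)).1]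
    apply LinearMap.ext; intro f
    have := braidB_last hr P hΘ ⟨r - 2, by omega⟩ ⟨r - 1, by omega⟩
      (by show r - 1 = r - 2 + 1; omega) rfl f
    simp only [show r - 2 + 1 = r - 1 by omega] at this
    exact this
  have hZ : T 0 * T 1 * T 0 * T 1 = T 1 * T 0 * T 1 * T 0 := by
    apply Units.ext
    simp only [Units.val_mul]
    rw [(hT 0 (by omega)).1, (hT 1 (by omega)).1]
    apply LinearMap.ext; intro f
    exact braidB_zero hr P hΘ ⟨0, by omega⟩ ⟨1, by omega⟩ rfl rfl f
  have key : ∀ i, 1 ≤ i → i ≤ r → (Yel T r (i - 1)).val = YG P Θ i := by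
    intro i h1 h2
    rw [Yel_prod T r hr (i - 1) (by omega), show i - 1 + 1 = i by omega, Units.val_mul, YG]
    congr 1
    · have := map_list_prod (Units.coeHom (Module.End F (QA F r)))
        (((List.range (i - 1)).map (· + 1)).reverse.map (fun j => (T j)⁻¹))
      rw [Units.coeHom_apply] at this
      rw [this, List.map_map]
      congr 1
      apply List.map_congr_left
      intro j hj
      exact (hT j (mem_inv h2 hj).2.le).2
    · have := map_list_prod (Units.coeHom (Module.End F (QA F r))) ((Ylist r i).map T)
      rw [Units.coeHom_apply] at this
      rw [this, List.map_map]
      congr 1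
      apply List.map_congr_left
      intro j hj
      exact (hT j (mem_Ylist hj)).1
  rw [← key i hi hi', ← key j hj hj']
  have := Yel_comm hr hc hA hB hZ (i - 1) (j - 1) (by omega) (by omega)
  exact this.map (Units.coeHom (Module.End F (QA F r)))

/-! restriction to `F[O]` -/

theorem X_FO {O : Set (E r)} {y : E r} (hy : y ∈ O) : X F r y ∈ FO F r O :=
  Submodule.subset_span ⟨y, hy, rfl⟩

include hr in
theorem orbit_WM {O : Set (E r)} (hO : IsOrbit r O) {y : E r} (hy : y ∈ O) {g : E r → E r}
    (hg : IsWM g) : g y ∈ O := by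
  obtain ⟨l, hl, e⟩ := hg
  rw [← e]; exact orbit_word hO hy l hl

include hr in
theorem orbit_ng {O : Set (E r)} (hO : IsOrbit r O) {y : E r} (hy : y ∈ O) (a : Fin r) :
    ng a y ∈ O := orbit_WM hr hO hy (isWM_ng hr (r - 1 - a) a (by have := a.2; omega))

include hr in
theorem orbit_eV {O : Set (E r)} (hO : IsOrbit r O) {y : E r} (hy : y ∈ O) (a : Fin r) (m : ℤ) :
    y + (m : ℝ) • eV r a ∈ O := by
  have h1 : ∀ z ∈ O, z + eV r a ∈ O := fun z hz => orbit_WM hr hO hz (isWM_tr hr a a rfl)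
  have h2 : ∀ z ∈ O, z - eV r a ∈ O := by
    intro z hz
    have := orbit_ng hr hO (h1 _ (orbit_ng hr hO hz a)) a
    convert this using 1
    funext i
    by_cases h : i = a <;> simp [ng, eV_apply, h]; ring
  induction m using Int.induction_on with
  | zero => simpa using hy
  | succ n ih =>
    have := h1 _ ih
    convert this using 1
    push_cast; rw [add_smul, one_smul, add_assoc]
  | pred n ih =>
    have := h2 _ ih
    convert this using 1
    push_cast; rw [sub_smul, one_smul]; abel

include hr in
theorem orbit_vv {O : Set (E r)} (hO : IsOrbit r O) {j : ℕ} (hj : j ≤ r) {y : E r} (hy : y ∈ O)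
    (m : ℤ) : y + (m : ℝ) • vv r j ∈ O := by
  refine jcases hr ?_ ?_ ?_ j hj
  · rw [vv_zero hr]
    have := orbit_eV hr hO hy ⟨0, by omega⟩ (-m)
    convert this using 1
    push_cast; simp
  · rw [vv_last hr]
    exact orbit_eV hr hO hy _ m
  · intro a b hab
    rw [vv_mid a b hab]
    have := orbit_eV hr hO (orbit_eV hr hO hy a m) b (-m)
    convert this using 1
    push_cast; rw [smul_sub, neg_smul]; abel

include hr in
theorem orbit_shift {O : Set (E r)} (hO : IsOrbit r O) {j : ℕ} (hj : j ≤ r) {y : E r} (hy : y ∈ O) :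
    sbar j y ∈ O := by
  have := orbit_genF hO hy hj
  rw [genF_sbar hr j hj] at this
  by_cases h : j = 0
  · subst h
    rw [if_pos rfl] at this
    have h2 := orbit_vv hr hO hj this 1
    convert h2 using 1
    simp [vv]
  · simpa [h] using this

include hr in
theorem TG_FO {O : Set (E r)} (hO : IsOrbit r O) {j : ℕ} (hj : j ≤ r) {f : QA F r}
    (hf : f ∈ FO F r O) : TG P Θ j f ∈ FO F r O := by
  refine Submodule.span_induction (p := fun f _ => TG P Θ j f ∈ FO F r O) ?_ ?_ ?_ ?_ hf
  · rintro _ ⟨y, hy, rfl⟩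
    rw [TG_X]
    refine Submodule.add_mem _ (Submodule.smul_mem _ _ (X_FO (orbit_shift hr hO hj hy))) ?_
    exact Sg_mem _ _ _ fun m _ => Submodule.smul_mem _ _ (X_FO (orbit_vv hr hO hj hy m))
  · simp
  · intro f g _ _ h1 h2; rw [map_add]; exact Submodule.add_mem _ h1 h2
  · intro c f _ h; rw [map_smul]; exact Submodule.smul_mem _ _ h

include hr in
theorem Tfull_eq {O : Set (E r)} (t : Fin r → Fˣ) {j : ℕ} (hj : j ≤ r) {f : QA F r}
    (hf : f ∈ FO F r O) : Tfull F r P.qh P.k0 P.u0 P.k P.kr P.ur t j f =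
      TG P (Theta P.qh O t) j f := by
  refine Submodule.span_induction (p := fun f _ => Tfull F r P.qh P.k0 P.u0 P.k P.kr P.ur t j f =
      TG P (Theta P.qh O t) j f) ?_ ?_ ?_ ?_ hf
  · rintro _ ⟨y, hy, rfl⟩
    unfold Tfull
    split_ifs with h
    · subst h
      rw [T0op, mkOp_X, TG, mkOp_X, T0_X hr P t hy]
    · rw [Top, mkOp_X, TG, mkOp_X, Top_X hr P (Theta P.qh O t) (by omega) hj]
  · simp
  · intro f g _ _ h1 h2; rw [map_add, map_add, h1, h2]
  · intro c f _ h; rw [map_smul, map_smul, h]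

theorem kpar_eq (j : ℕ) : kpar F r P.k0 P.k P.kr j = (kj r P j : F) := by
  unfold kpar kj; split_ifs <;> rfl

theorem prod_agree (S : Submodule F (QA F r)) (A B : ℕ → Module.End F (QA F r)) :
    ∀ (l : List ℕ), (∀ j ∈ l, ∀ f ∈ S, A j f = B j f ∧ B j f ∈ S) →
      ∀ f ∈ S, (l.map A).prod f = (l.map B).prod f ∧ (l.map B).prod f ∈ S
  | [], _, f, hf => by simpa using hf
  | j :: l, h, f, hf => by
    obtain ⟨h1, h2⟩ := prod_agree S A B l (fun j hj => h j (List.mem_cons_of_mem _ hj)) f hf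
    simp only [List.map_cons, List.prod_cons, Module.End.mul_apply]
    rw [h1]
    exact h j (List.mem_cons_self ..) _ h2

include hr in
theorem Yop_eq {O : Set (E r)} (hO : IsOrbit r O) (t : Fin r → Fˣ) {i : ℕ} (hi : i ≤ r)
    {f : QA F r} (hf : f ∈ FO F r O) :
    Yop F r P.qh P.k0 P.u0 P.k P.kr P.ur t i f = YG P (Theta P.qh O t) i f ∧
      YG P (Theta P.qh O t) i f ∈ FO F r O := by
  unfold Yop YG
  obtain ⟨h1, h2⟩ := prod_agree (FO F r O) (Tfull F r P.qh P.k0 P.u0 P.k P.kr P.ur t)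
    (TG P (Theta P.qh O t)) (Ylist r i) (fun j hj f hf => ⟨Tfull_eq hr P t (mem_Ylist hj) hf,
      TG_FO hr P hO (mem_Ylist hj) hf⟩) f hf
  simp only [Module.End.mul_apply]
  rw [h1]
  refine prod_agree (FO F r O) _ _ _ ?_ _ h2
  intro j hj f hf
  have hj' := (mem_inv hi hj).2.le
  constructor
  · unfold TfullInv
    rw [LinearMap.sub_apply, LinearMap.sub_apply, Tfull_eq hr P t hj' hf, kpar_eq, kap_zero]
  · rw [LinearMap.sub_apply]
    exact Submodule.sub_mem _ (TG_FO hr P hO hj' hf) (Submodule.smul_mem _ _ hf)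

end matching


section tri
set_option linter.unusedSectionVars false
set_option linter.unusedSimpArgs false
set_option linter.unusedVariables false

theorem ex_even (n : ℤ) : (∃ m : ℤ, (n : ℝ) = 2 * m) ↔ Even n := by
  constructor
  · rintro ⟨m, h⟩
    have : n = 2 * m := by exact_mod_cast h
    exact ⟨m, by omega⟩
  · rintro ⟨m, h⟩; exact ⟨m, by rw [h]; push_cast; ring⟩

theorem ex_odd (n : ℤ) : (∃ m : ℤ, (n : ℝ) = 2 * m + 1) ↔ ¬ Even n := by
  rw [Int.not_even_iff_odd]
  constructor
  · rintro ⟨m, h⟩; exact ⟨m, by exact_mod_cast h⟩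
  · rintro ⟨m, h⟩; exact ⟨m, by rw [h]; push_cast; ring⟩

theorem etaE_int (n : ℤ) : etaE n = if Even n then (if 0 < n then 1 else -1) else 0 := by
  unfold etaE
  simp only [ex_even]
  by_cases h : Even n
  · rw [if_pos h, if_pos h]
    have : (2 : ℝ) ≤ n ↔ 0 < n := by
      obtain ⟨m, rfl⟩ := h
      constructor
      · intro h; have : (2 : ℤ) ≤ m + m := by exact_mod_cast h
        omega
      · intro h; have : (2 : ℤ) ≤ m + m := by omega
        exact_mod_cast this
    simp only [this]
  · simp only [h, if_false]

theorem etaO_int (n : ℤ) : etaO n = if Even n then 0 else (if 0 < n then 1 else -1) := by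
  unfold etaO
  simp only [ex_odd]
  by_cases h : Even n
  · simp [h]
  · have : (1 : ℝ) ≤ n ↔ 0 < n := by
      constructor
      · intro h; have : (1 : ℤ) ≤ n := by exact_mod_cast h
        omega
      · intro h; have : (1 : ℤ) ≤ n := by omega
        exact_mod_cast this
    simp only [this, h, if_false, not_false_eq_true, if_true]

theorem eta_int (n : ℤ) : eta n = if 0 < n then 1 else -1 := by
  unfold eta; rw [etaE_int, etaO_int]; split_ifs <;> simp

theorem chiE_int (n : ℤ) : chiE n = if Even n then 1 else 0 := by
  unfold chiE; simp only [ex_even]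

theorem chiO_int (n : ℤ) : chiO n = if Even n then 0 else 1 := by
  unfold chiO; simp only [ex_odd]; split_ifs <;> simp_all

theorem nonint_facts {p : ℝ} (hp : ∀ n : ℤ, p ≠ n) :
    etaE p = 0 ∧ etaO p = 0 ∧ eta p = 0 ∧ chiE p = 0 ∧ chiO p = 0 := by
  have h1 : ¬ ∃ n : ℤ, p = 2 * n := by
    rintro ⟨n, h⟩; exact hp (2 * n) (by rw [h]; push_cast; ring)
  have h2 : ¬ ∃ n : ℤ, p = 2 * n + 1 := by
    rintro ⟨n, h⟩; exact hp (2 * n + 1) (by rw [h]; push_cast; ring)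
  simp [eta, etaE, etaO, chiE, chiO, h1, h2]

theorem eta_neg {p : ℝ} (hp : p ≠ 0) :
    etaE (-p) = - etaE p ∧ etaO (-p) = - etaO p ∧ eta (-p) = - eta p := by
  by_cases h : ∃ n : ℤ, p = n
  · obtain ⟨n, rfl⟩ := h
    have hn : n ≠ 0 := by exact_mod_cast hp
    have e : (-(n : ℝ)) = ((-n : ℤ) : ℝ) := by push_cast; rfl
    rw [e, eta_int, eta_int, etaE_int, etaE_int, etaO_int, etaO_int]
    simp only [even_neg]
    split_ifs <;> first | rfl | omega
  · push Not at h
    have h' : ∀ n : ℤ, -p ≠ n := by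
      intro n hn; exact h (-n) (by push_cast; linarith)
    have f1 := nonint_facts h
    have f2 := nonint_facts h'
    simp [f1, f2]

variable {F} {r}

/-- leading coefficient of `T_j x^y` -/
def at1 (P : Prm F) (Θ : E r → Fin r → Fˣ) (j : ℕ) (y : E r) : Fˣ :=
  kj r P j ^ (-etaE (pj j y)) * uj r P j ^ (-etaO (pj j y)) * tw Θ j y

variable (hr : 2 ≤ r) (P : Prm F) {Θ : E r → Fin r → Fˣ} (hΘ : GoodTheta P.qh Θ)

include hr hΘ in
theorem TG_lead (j : ℕ) (hj : j ≤ r) (y : E r) (S : Submodule F (QA F r))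
    (hS : ∀ n : ℤ, (1 ≤ n ∧ (n : ℝ) < pj j y) ∨ (n ≤ 0 ∧ pj j y < n) →
      X F r (y - (n : ℝ) • vv r j) ∈ S) :
    TG P Θ j (X F r y) - (at1 P Θ j y : F) • X F r (sbar j y) ∈ S := by
  rw [TG_X]
  set p := pj j y with hp
  have hmem : ∀ m : ℤ, (1 ≤ -m ∧ ((-m : ℤ) : ℝ) < p) ∨ (-m ≤ 0 ∧ p < ((-m : ℤ) : ℝ)) →
      (kap r P j m * (cc P.qh j : F) ^ m) • X F r (y + (m : ℝ) • vv r j) ∈ S := by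
    intro m hm
    apply S.smul_mem
    have := hS (-m) hm
    simpa using this
  by_cases hI : ∃ n : ℤ, p = n
  · obtain ⟨n, hn⟩ := hI
    have ht := tw_int hr hΘ j y n (hp ▸ hn)
    rcases lt_or_ge 0 n with h0 | h0
    · rw [hn, Int.floor_intCast]
      have e := Sg_succ (fun m => (kap r P j m * (cc P.qh j : F) ^ m) • X F r (y + (m : ℝ) • vv r j))
        (-n)
      rw [← sub_eq_iff_eq_add] at e
      rw [← e]
      have e2 : y + ((-n : ℤ) : ℝ) • vv r j = sbar j y := by
        unfold sbar; rw [← hp, hn]; push_cast; rw [neg_smul]; abel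
      simp only [e2]
      have e3 : ee r P j n * (tw Θ j y : F) - kap r P j (-n) * (cc P.qh j : F) ^ (-n) =
          (at1 P Θ j y : F) := by
        unfold at1 ee kap
        rw [← hp, hn, etaE_int, etaO_int, chiE_int, chiO_int, ht]
        simp only [even_neg, h0, if_true]
        by_cases hv : Even n
        · simp only [hv, if_true]
          push_cast
          simp
          ring
        · simp only [hv, if_false]
          push_cast
          simp
          ring
      rw [add_sub_assoc, sub_sub, ← add_smul, add_sub_left_comm, ← sub_smul]
      have e4 : ee r P j n * (tw Θ j y : F) - (kap r P j (-n) * (cc P.qh j : F) ^ (-n) +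
        (at1 P Θ j y : F)) = 0 := by rw [← e3]; ring
      rw [e4, zero_smul, add_zero]
      apply Sg_mem
      intro m hm
      apply hmem
      left
      rw [hn]
      have : -m < n := by omega
      exact ⟨by omega, by exact_mod_cast this⟩
    · have e3 : ee r P j p * (tw Θ j y : F) = (at1 P Θ j y : F) := by
        unfold at1 ee
        rw [← hp, hn, etaE_int, etaO_int, chiE_int, chiO_int]
        simp only [not_lt.2 h0, if_false]
        by_cases hv : Even n <;> simp [hv]
      rw [e3, add_sub_cancel_left]
      apply Sg_mem
      intro m hm
      rw [hn, Int.floor_intCast] at hm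
      apply hmem
      right
      rw [hn]
      have : n < -m := by omega
      exact ⟨by omega, by exact_mod_cast this⟩
  · push Not at hI
    obtain ⟨f1, f2, f3, f4, f5⟩ := nonint_facts hI
    have e3 : ee r P j p * (tw Θ j y : F) = (at1 P Θ j y : F) := by
      unfold at1 ee
      rw [← hp, f1, f2, f4, f5]; simp
    rw [e3, add_sub_cancel_left]
    apply Sg_mem
    intro m hm
    apply hmem
    have g1 := Int.floor_le p
    have g2 := Int.lt_floor_add_one p
    have g3 : ((⌊p⌋ : ℤ) : ℝ) < p := lt_of_le_of_ne g1 fun h => hI _ h.symm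
    rcases hm with hm | hm
    · right
      refine ⟨by omega, lt_of_lt_of_le g2 ?_⟩
      have : ⌊p⌋ + 1 ≤ -m := by omega
      exact_mod_cast this
    · left
      refine ⟨by omega, lt_of_le_of_lt ?_ g3⟩
      have : -m ≤ ⌊p⌋ := by omega
      exact_mod_cast this

include hr hΘ in
theorem TG_lead' (a b : Fin r) (hab : (b : ℕ) = a + 1) (y : E r) (S : Submodule F (QA F r))
    (hS : ∀ n : ℤ, (1 ≤ n ∧ (n : ℝ) < -pj (a + 1) y) ∨ (n ≤ 0 ∧ -pj (a + 1) y < n) →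
      X F r (y + (n : ℝ) • vv r (a + 1)) ∈ S) :
    (TG P Θ (a + 1) - kap r P (a + 1) 0 • 1) (X F r y) -
      ((P.k ^ (eta (-pj (a + 1) y)) : Fˣ) : F) • X F r (sbar (a + 1) y) ∈ S := by
  have hb := b.2
  obtain ⟨k1, k2⟩ := kj_mid P a b hab
  have hat : at1 P Θ (a + 1) y = P.k ^ (-eta (pj (a + 1) y)) := by
    unfold at1; rw [k1, k2, tw_pos Θ (by omega), mul_one, ← zpow_add, eta]; congr 1; ring
  rcases lt_trichotomy (pj (a + 1) y) 0 with h | h | h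
  · -- negative
    rw [(eta_neg h.ne).2.2, ← hat]
    rw [LinearMap.sub_apply, LinearMap.smul_apply, Module.End.one_apply, TG_X]
    have hfl : ⌊pj (a + 1) y⌋ < 0 := Int.floor_lt_zero.2 h
    set p := pj (a + 1) y with hp
    have e3 : ee r P (a + 1) p * (tw Θ (a + 1) y : F) = (at1 P Θ (a + 1) y : F) := by
      unfold ee
      rw [hat, tw_pos Θ (by omega), k1, k2, ← pow_add, chi_add]
      by_cases hI : ∃ n : ℤ, p = n
      · obtain ⟨n, hn⟩ := hI
        have : ¬ 0 < n := by
          intro h0; rw [hn] at h; have : n < 0 := by exact_mod_cast h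
          omega
        rw [hn, eta_int, if_neg this]
        unfold chiZ
        rw [if_pos ⟨n, rfl⟩]; simp
      · unfold chiZ
        rw [if_neg hI]
        push Not at hI
        rw [(nonint_facts hI).2.2.1]; simp
    rw [e3]
    have e := Sg_shift (fun m => (kap r P (a + 1) m * (cc P.qh (a + 1) : F) ^ m) •
      X F r (y + (m : ℝ) • vv r (a + 1))) 1 (-⌊p⌋ - 1)
    rw [sub_add_cancel, Sg_one, eq_sub_iff_add_eq] at e
    rw [← e]
    simp only [Int.cast_zero, zero_smul, add_zero, zpow_zero, mul_one]
    rw [add_sub_assoc, add_sub_cancel_right, add_sub_cancel_left]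
    apply Sg_mem
    intro m hm
    apply S.smul_mem
    apply hS
    left
    have h1 : m + 1 < -⌊p⌋ := by omega
    have g1 := Int.lt_floor_add_one p
    have h2 : ((m + 1 : ℤ) : ℝ) + ⌊p⌋ + 1 ≤ 0 := by
      have : m + 1 + ⌊p⌋ + 1 ≤ 0 := by omega
      exact_mod_cast this
    exact ⟨by omega, by linarith⟩
  · rw [LinearMap.sub_apply, LinearMap.smul_apply, Module.End.one_apply, TG_X, h]
    have e1 : sbar (a + 1) y = y := by unfold sbar; rw [h]; simp
    rw [e1, neg_zero]
    have e2 := eta_int 0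
    simp only [Int.cast_zero, lt_irrefl, if_false] at e2
    rw [e2, kap_zero, k1, tw_pos Θ (by omega), ee, k1, k2, chi_zero.1, chi_zero.2]
    simp [Sg_zero]
    rw [← sub_smul, ← sub_smul]
    convert S.zero_mem
    convert zero_smul F (X F r y)
    ring
  · rw [(eta_neg h.ne').2.2, ← hat]
    rw [LinearMap.sub_apply, LinearMap.smul_apply, Module.End.one_apply, sub_right_comm]
    refine S.sub_mem (TG_lead hr P hΘ _ (by omega) y S ?_) (S.smul_mem _ ?_)
    · intro n hn
      have := hS (-n) (by
        rcases hn with ⟨h1, h2⟩ | ⟨h1, h2⟩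
        · right; exact ⟨by omega, by push_cast; linarith⟩
        · exfalso
          have : (n : ℝ) ≤ 0 := by exact_mod_cast h1
          linarith)
      simpa [sub_eq_add_neg] using this
    · have := hS 0 (Or.inr ⟨le_rfl, by simpa using h⟩)
      simpa using this

/-- triangularity of an operator with respect to a linear rearrangement -/
def Tri (A : Module.End F (QA F r)) (D : E r → E r) (co : E r → Fˣ) : Prop :=
  ∀ z, A (X F r z) - (co z : F) • X F r (D z) ∈
    Submodule.span F {f | ∃ z', Rt z' z ∧ f = X F r (D z')}

include hr in
theorem Tri.mul {A B : Module.End F (QA F r)} {D D' : E r → E r} {co co' : E r → Fˣ}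
    (hA : Tri A D co)
    (hB : ∀ z, B (X F r (D z)) - (co' z : F) • X F r (D' z) ∈
      Submodule.span F {f | ∃ z', Rt z' z ∧ f = X F r (D' z')}) :
    Tri (B * A) D' (fun z => co' z * co z) := by
  intro z
  have h1 := hA z
  set s := A (X F r z) - (co z : F) • X F r (D z) with hs
  have e : A (X F r z) = s + (co z : F) • X F r (D z) := by rw [hs]; abel
  rw [Module.End.mul_apply, e, map_add, map_smul, Units.val_mul, add_sub_assoc, mul_comm, ← smul_smul, ← smul_sub]
  refine Submodule.add_mem _ ?_ (Submodule.smul_mem _ _ (hB z))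
  refine Submodule.span_induction (p := fun f _ => B f ∈ Submodule.span F {f | ∃ z', Rt z' z ∧ f = X F r (D' z')})
    ?_ (by simp) ?_ ?_ h1
  · rintro _ ⟨z', hz', rfl⟩
    have h2 := hB z'
    have e2 : B (X F r (D z')) = (B (X F r (D z')) - (co' z' : F) • X F r (D' z')) +
      (co' z' : F) • X F r (D' z') := by abel
    rw [e2]
    refine Submodule.add_mem _ (Submodule.span_mono ?_ h2)
      (Submodule.smul_mem _ _ (Submodule.subset_span ⟨z', hz', rfl⟩))
    rintro _ ⟨z'', h, rfl⟩
    exact ⟨z'', Relation.TransGen.trans h hz', rfl⟩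
  · intro f g _ _ h1 h2; rw [map_add]; exact Submodule.add_mem _ h1 h2
  · intro c f _ h; rw [map_smul]; exact Submodule.smul_mem _ _ h

include hr hΘ in
theorem Tri.step {A : Module.End F (QA F r)} {D : E r → E r} {co : E r → Fˣ} (hA : Tri A D co)
    (hD : ∀ (z w : E r) (c : ℝ), D (z - c • w) = D z - c • D w)
    (j : ℕ) (hj : j ≤ r) {β : E r → ℝ} {w : E r} (hβ : PosR β w) (h1 : ∀ z, pj j (D z) = β z)
    (h2 : D w = vv r j) :
    Tri (TG P Θ j * A) (fun z => sbar j (D z)) (fun z => at1 P Θ j (D z) * co z) := by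
  apply hA.mul hr
  intro z
  apply TG_lead hr P hΘ j hj
  intro n hn
  rw [h1] at hn
  refine Submodule.subset_span ⟨_, hβ.lower z n hn, ?_⟩
  rw [hD, sbar_sub, sbar_smul, h2, sbar_vv hr j hj]
  congr 1
  unfold sbar; rw [h1, sub_smul, smul_neg, smul_neg]; abel

include hr hΘ in
theorem Tri.step' {A : Module.End F (QA F r)} {D : E r → E r} {co : E r → Fˣ} (hA : Tri A D co)
    (hD : ∀ (z w : E r) (c : ℝ), D (z - c • w) = D z - c • D w)
    (a b : Fin r) (hab : (b : ℕ) = a + 1) {β : E r → ℝ} {w : E r} (hβ : PosR β w)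
    (h1 : ∀ z, pj (a + 1) (D z) = - β z)
    (h2 : D w = - vv r (a + 1)) :
    Tri ((TG P Θ (a + 1) - kap r P (a + 1) 0 • 1) * A) (fun z => sbar (a + 1) (D z))
      (fun z => P.k ^ eta (β z) * co z) := by
  have hb := b.2
  apply hA.mul hr
  intro z
  have e : β z = - pj (a + 1) (D z) := by rw [h1]; ring
  rw [e]
  apply TG_lead' hr P hΘ a b hab
  intro n hn
  rw [← e] at hn
  refine Submodule.subset_span ⟨_, hβ.lower z n hn, ?_⟩
  rw [hD, sbar_sub, sbar_smul, h2, sbar_neg, sbar_vv hr _ (by omega)]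
  congr 1
  unfold sbar; rw [h1, sub_smul, neg_smul, neg_neg]; abel

end tri


section ytri
set_option linter.unusedSectionVars false
set_option linter.unusedSimpArgs false
set_option linter.unusedVariables false

variable {F} {r}

/-- skip index -/
def rm (i q : ℕ) : ℕ := if q < i then q else q + 1

/-- remove coordinate `i` and insert it (times `ε`) at position `p` -/
def Dins (i p : ℕ) (ε : ℝ) (z : E r) : E r := fun q =>
  if (q : ℕ) < p then cd r z (rm i q + 1) else if (q : ℕ) = p then ε * cd r z (i + 1)
  else cd r z (rm i (q - 1) + 1)

theorem Dins_lin (i p : ℕ) (ε : ℝ) (z w : E r) (c : ℝ) :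
    Dins i p ε (z - c • w) = Dins i p ε z - c • Dins i p ε w := by
  funext q
  simp only [Dins, cd_sub, cd_smul, Pi.sub_apply, Pi.smul_apply, smul_eq_mul]
  split_ifs <;> ring

theorem Dins_self {i : ℕ} (hi : i < r) (z : E r) : Dins i i 1 z = z := by
  funext q
  unfold Dins
  split_ifs with h1 h2
  · exact cd_fin z q _ (by simp [rm, h1])
  · rw [one_mul]; exact cd_fin z q _ (by omega)
  · apply cd_fin z q
    unfold rm; rw [if_neg (by omega)]; omega

variable (hr : 2 ≤ r)

include hr in
theorem Dins_swap (i p : ℕ) (hp : p + 1 < r) (ε : ℝ) (z : E r) :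
    sbar (p + 1) (Dins i p ε z) = Dins i (p + 1) ε z := by
  funext m
  have := sbar_mid (r := r) ⟨p, by omega⟩ ⟨p + 1, hp⟩ rfl (Dins i p ε z) m
  simp only at this
  rw [this]
  by_cases h1 : m = ⟨p, by omega⟩
  · subst h1; rw [Equiv.swap_apply_left]; simp [Dins]
  by_cases h2 : m = ⟨p + 1, hp⟩
  · subst h2; rw [Equiv.swap_apply_right]; simp [Dins]
  rw [Equiv.swap_apply_of_ne_of_ne h1 h2]
  simp only [Fin.ext_iff] at h1 h2
  unfold Dins
  by_cases h3 : (m : ℕ) < p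
  · rw [if_pos h3, if_pos (by omega)]
  · rw [if_neg h3, if_neg h1, if_neg (by omega), if_neg h2]

include hr in
theorem Dins_swap' (i p : ℕ) (hp : p + 1 < r) (ε : ℝ) (z : E r) :
    sbar (p + 1) (Dins i (p + 1) ε z) = Dins i p ε z := by
  rw [← Dins_swap hr i p hp, sbar_sbar hr _ (by omega)]

include hr in
theorem pj_Dins (i p : ℕ) (hp : p + 1 < r) (ε : ℝ) (z : E r) :
    pj (p + 1) (Dins i p ε z) = ε * cd r z (i + 1) - cd r z (rm i p + 1) := by
  have := pj_mid (r := r) ⟨p, by omega⟩ ⟨p + 1, hp⟩ rfl (Dins i p ε z)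
  simp only at this
  rw [this]; simp [Dins]

include hr in
theorem pj_Dins' (i p : ℕ) (hp : p + 1 < r) (ε : ℝ) (z : E r) :
    pj (p + 1) (Dins i (p + 1) ε z) = cd r z (rm i p + 1) - ε * cd r z (i + 1) := by
  have := pj_mid (r := r) ⟨p, by omega⟩ ⟨p + 1, hp⟩ rfl (Dins i (p + 1) ε z)
  simp only at this
  rw [this]; simp [Dins]

theorem cd_eV (a : Fin r) (n : ℕ) : cd r (eV r a) (n + 1) = if n = a then 1 else 0 := by
  by_cases h : n < r
  · rw [cd_fin _ ⟨n, h⟩ _ rfl, eV_apply]; simp [Fin.ext_iff]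
  · have := a.2
    rw [cd_oob _ _ (Or.inr (by omega)), if_neg (by omega)]

theorem Dins_eV (i : Fin r) (p : Fin r) (ε : ℝ) : Dins i p ε (eV r i) = ε • eV r p := by
  funext q
  simp only [Dins, cd_eV, Pi.smul_apply, eV_apply, smul_eq_mul, rm, Fin.ext_iff]
  split_ifs <;> first | omega | simp

/-- image of the other basis vectors, position before `p` -/
theorem Dins_eV1 (i : Fin r) (p : ℕ) (ε : ℝ) (q : Fin r) (hq : (q : ℕ) < p) (b : Fin r)
    (hb : (b : ℕ) = rm i q) : Dins i p ε (eV r b) = eV r q := by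
  funext m
  unfold rm at hb
  simp only [Dins, cd_eV, Pi.smul_apply, eV_apply, smul_eq_mul, rm, Fin.ext_iff]
  split_ifs at * <;> first | omega | simp

theorem Dins_eV2 (i : Fin r) (p : ℕ) (ε : ℝ) (q : Fin r) (hq : p < (q : ℕ)) (b : Fin r)
    (hb : (b : ℕ) = rm i (q - 1)) : Dins i p ε (eV r b) = eV r q := by
  funext m
  unfold rm at hb
  simp only [Dins, cd_eV, Pi.smul_apply, eV_apply, smul_eq_mul, rm, Fin.ext_iff]
  split_ifs at * <;> first | omega | simp

theorem Dins_sub (i p : ℕ) (ε : ℝ) (z w : E r) :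
    Dins i p ε (z - w) = Dins i p ε z - Dins i p ε w := by
  have := Dins_lin i p ε z w 1; simpa using this

theorem Dins_add (i p : ℕ) (ε : ℝ) (z w : E r) :
    Dins i p ε (z + w) = Dins i p ε z + Dins i p ε w := by
  have := Dins_lin i p ε z w (-1); simpa using this

/-- iterated left multiplication -/
def seqOp (f : ℕ → Module.End F (QA F r)) : ℕ → Module.End F (QA F r)
  | 0 => 1
  | n + 1 => f n * seqOp f n

theorem seqOp_prod (f : ℕ → Module.End F (QA F r)) :
    ∀ n, seqOp f n = ((List.range n).reverse.map f).prod
  | 0 => by simp [seqOp]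
  | n + 1 => by rw [seqOp, seqOp_prod f n, List.range_succ]; simp

variable (P : Prm F) {Θ : E r → Fin r → Fˣ} (hΘ : GoodTheta P.qh Θ)

theorem Tri.congr {A : Module.End F (QA F r)} {D D' : E r → E r} {co co' : E r → Fˣ}
    (h : Tri A D co) (hD : ∀ z, D z = D' z) (hc : ∀ z, co z = co' z) : Tri A D' co' := by
  rw [← funext hD, ← funext hc]; exact h

theorem at1_mid (p : ℕ) (hp : p + 1 < r) (y : E r) :
    at1 P Θ (p + 1) y = P.k ^ (-eta (pj (p + 1) y)) := by
  obtain ⟨k1, k2⟩ := kj_mid P (r := r) ⟨p, by omega⟩ ⟨p + 1, hp⟩ rfl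
  simp only at k1 k2
  unfold at1; rw [k1, k2, tw_pos Θ (by omega), mul_one, ← zpow_add, eta]; congr 1; ring

include hr hΘ in
theorem tri1 (i : Fin r) : ∀ n : ℕ, (i : ℕ) + n < r →
    Tri (seqOp (fun m => TG P Θ (i + m + 1)) n) (Dins i (i + n) 1)
      (fun z => P.k ^ (-∑ m ∈ Finset.range n, eta (cd r z (i + 1) - cd r z (i + m + 1 + 1))))
  | 0, h => by
    intro z
    rw [add_zero, Dins_self i.2]; simp [seqOp]
  | n + 1, h => by
    have ih := tri1 i n (by omega)
    have hrm : rm i (i + n) = i + n + 1 := by unfold rm; rw [if_neg (by omega)]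
    have := ih.step hr P hΘ (Dins_lin _ _ _) (i + n + 1) (by omega)
      (β := fun z => z i - z ⟨i + n + 1, h⟩)
      (w := eV r i - eV r ⟨i + n + 1, h⟩)
      (Or.inl ⟨i, ⟨i + n + 1, h⟩, Fin.lt_def.2 (show (i : ℕ) < i + n + 1 by omega), fun _ => rfl, rfl⟩)
      (by
        intro z
        rw [pj_Dins hr _ _ (by omega), hrm, one_mul, cd_fin z i _ rfl,
          cd_fin z ⟨i + n + 1, h⟩ _ rfl])
      (by
        have e1 := Dins_eV i (⟨i + n, by omega⟩ : Fin r) 1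
        have e2 := Dins_eV2 i (i + n) 1 ⟨i + n + 1, h⟩ (by simp) ⟨i + n + 1, h⟩ (by simp [hrm])
        simp only at e1
        rw [Dins_sub, e1, e2, one_smul]
        exact (vv_mid (r := r) ⟨i + n, by omega⟩ ⟨i + n + 1, h⟩ rfl).symm)
    refine this.congr (fun z => Dins_swap hr _ _ (by omega) _ _) (fun z => ?_)
    rw [at1_mid P _ (by omega), ← zpow_add, pj_Dins hr _ _ (by omega), Finset.sum_range_succ, hrm,
      one_mul]
    congr 1; ring

include hr in
theorem Dins_last (i : ℕ) (z : E r) :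
    sbar r (Dins i (r - 1) 1 z) = Dins i (r - 1) (-1) z := by
  funext m
  have := m.2
  rw [sbar_last hr]
  unfold Dins
  by_cases h : (m : ℕ) + 1 = r
  · rw [if_pos h, if_neg (by omega), if_pos (by omega), if_neg (by omega), if_pos (by omega)]; ring
  · rw [if_neg h, if_pos (by omega), if_pos (by omega)]

include hr hΘ in
theorem tri2 (i : Fin r) {A : Module.End F (QA F r)} {co : E r → Fˣ}
    (h : Tri A (Dins i (r - 1) 1) co) :
    Tri (TG P Θ r * A) (Dins i (r - 1) (-1))
      (fun z => P.kr ^ (-etaE (2 * z i)) * P.ur ^ (-etaO (2 * z i)) * co z) := by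
  have hi := i.2
  have hp : ∀ z : E r, pj r (Dins (r := r) i (r - 1) 1 z) = 2 * z i := by
    intro z
    rw [pj_last hr]
    simp [Dins, cd_fin z i _ rfl]
  have := h.step hr P hΘ (Dins_lin _ _ _) r le_rfl (β := fun z => 2 * z i) (w := eV r i)
    (Or.inr (Or.inr ⟨i, fun _ => rfl, rfl⟩)) hp
    (by
      have e1 := Dins_eV i (⟨r - 1, by omega⟩ : Fin r) 1
      simp only at e1
      rw [e1, one_smul, vv_last hr])
  refine this.congr (fun z => Dins_last hr _ _) (fun z => ?_)
  rw [at1, hp, tw_pos Θ (by omega), mul_one]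
  have h0 : r ≠ 0 := by omega
  simp [kj, uj, h0]

include hr hΘ in
theorem tri3 (i : Fin r) {A : Module.End F (QA F r)} {co : E r → Fˣ}
    (h0 : Tri A (Dins i (r - 1) (-1)) co) : ∀ n : ℕ, n < r →
    Tri (seqOp (fun m => TG P Θ (r - 1 - m)) n * A) (Dins i (r - 1 - n) (-1))
      (fun z => P.k ^ (-∑ m ∈ Finset.range n, eta (cd r z (i + 1) + cd r z (rm i (r - 1 - 1 - m) + 1)))
        * co z)
  | 0, h => by
    refine Tri.congr (A := seqOp (fun m => TG P Θ (r - 1 - m)) 0 * A) ?_ (fun z => rfl) (fun z => ?_)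
      (co := co)
    · simpa [seqOp] using h0
    · simp
  | n + 1, h => by
    have ih := tri3 i h0 n (by omega)
    obtain ⟨p, hp⟩ : ∃ p, r - 1 - n = p + 1 := ⟨r - 1 - n - 1, by omega⟩
    have hp' : r - 1 - (n + 1) = p := by omega
    have hp'' : r - 1 - 1 - n = p := by omega
    have hi := i.2
    have hb : rm i p < r := by unfold rm; split_ifs <;> omega
    have hbi : rm i p ≠ i := by unfold rm; split_ifs <;> omega
    rw [hp] at ih
    have := ih.step hr P hΘ (Dins_lin _ _ _) (p + 1) (by omega)
      (β := fun z => z ⟨rm i p, hb⟩ + z i)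
      (w := eV r ⟨rm i p, hb⟩ + eV r i)
      (by
        right; left
        rcases lt_or_gt_of_ne hbi with hlt | hlt
        · exact ⟨⟨rm i p, hb⟩, i, hlt, fun _ => rfl, rfl⟩
        · exact ⟨i, ⟨rm i p, hb⟩, hlt, fun _ => add_comm _ _, add_comm _ _⟩)
      (by
        intro z
        rw [pj_Dins' hr _ _ (by omega), cd_fin z i _ rfl, cd_fin z ⟨rm i p, hb⟩ _ rfl]; ring)
      (by
        have e1 := Dins_eV i (⟨p + 1, by omega⟩ : Fin r) (-1)
        have e2 := Dins_eV1 i (p + 1) (-1) ⟨p, by omega⟩ (by simp) ⟨rm i p, hb⟩ rfl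
        simp only at e1
        rw [Dins_add, e1, e2, neg_one_smul]
        exact (sub_eq_add_neg _ _).symm.trans
          (vv_mid (r := r) ⟨p, by omega⟩ ⟨p + 1, by omega⟩ rfl).symm)
    rw [seqOp, mul_assoc, hp, hp']
    refine this.congr (fun z => Dins_swap' hr _ _ (by omega) _ _) (fun z => ?_)
    rw [at1_mid P _ (by omega), ← mul_assoc, ← zpow_add, pj_Dins' hr _ _ (by omega),
      Finset.sum_range_succ, hp'']
    congr 2
    rw [show cd r z (rm i p + 1) - -1 * cd r z (i + 1) = cd r z (i + 1) + cd r z (rm i p + 1) by ring]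
    ring

include hr hΘ in
theorem theta_Dins1 (i : Fin r) (z : E r) : ∀ n : ℕ, (h : (i : ℕ) + n < r) →
    Θ (Dins i (i + n) 1 z) ⟨i + n, h⟩ = Θ z i
  | 0, h => by
    show Θ (Dins i i 1 z) i = Θ z i
    rw [Dins_self i.2]
  | n + 1, h => by
    have ih := theta_Dins1 i z n (by omega)
    have := hΘ.mid hr (Dins i (i + n) 1 z) ⟨i + n, by omega⟩ ⟨i + n + 1, h⟩ rfl ⟨i + n + 1, h⟩
    rw [Equiv.swap_apply_right, ih] at this
    rw [← this]
    simp only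
    rw [Dins_swap hr _ _ (by omega)]
    rfl

include hr hΘ in
theorem theta_Dins2 (i : Fin r) (z : E r) : ∀ n : ℕ, (h : n < r) →
    Θ (Dins i (r - 1 - n) (-1) z) ⟨r - 1 - n, by omega⟩ = (Θ z i)⁻¹
  | 0, h => by
    have hi := i.2
    have h1 := theta_Dins1 hr P hΘ i z (r - 1 - i) (by omega)
    have h2 := hΘ.ng hr (Dins i (r - 1) 1 z) ⟨r - 1, by omega⟩ ⟨r - 1, by omega⟩
    have e : (i : ℕ) + (r - 1 - i) = r - 1 := by omega
    simp only [e] at h1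
    rw [if_pos rfl, h1] at h2
    rw [← h2]
    simp only [Nat.sub_zero]
    congr 2
    rw [← Dins_last hr]
    funext m
    rw [sbar_last hr]
    have hm := m.2
    simp only [ng, Fin.ext_iff]
    by_cases h : (m : ℕ) + 1 = r
    · rw [if_pos h, if_pos (by omega)]
    · rw [if_neg h, if_neg (by omega)]
  | n + 1, h => by
    have ih := theta_Dins2 i z n (by omega)
    obtain ⟨p, hp⟩ : ∃ p, r - 1 - n = p + 1 := ⟨r - 1 - n - 1, by omega⟩
    have hp' : r - 1 - (n + 1) = p := by omega
    simp only [hp] at ih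
    simp only [hp']
    have := hΘ.mid hr (Dins i (p + 1) (-1) z) ⟨p, by omega⟩ ⟨p + 1, by omega⟩ rfl ⟨p, by omega⟩
    rw [Equiv.swap_apply_left, ih] at this
    rw [← this]
    simp only
    rw [Dins_swap' hr _ _ (by omega)]

include hr hΘ in
theorem tri4 (i : Fin r) {A : Module.End F (QA F r)} {co : E r → Fˣ}
    (h : Tri A (Dins i 0 (-1)) co) :
    Tri (TG P Θ 0 * A) (Dins i 0 1)
      (fun z => P.k0 ^ (-etaE (2 * z i)) * P.u0 ^ (-etaO (2 * z i)) * (Θ z i)⁻¹ * co z) := by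
  have hi := i.2
  have hp : ∀ z : E r, pj 0 (Dins (r := r) i 0 (-1) z) = 2 * z i := by
    intro z
    rw [pj_zero hr]
    simp [Dins, cd_fin z i _ rfl]
  have := h.step hr P hΘ (Dins_lin _ _ _) 0 (by omega) (β := fun z => 2 * z i) (w := eV r i)
    (Or.inr (Or.inr ⟨i, fun _ => rfl, rfl⟩)) hp
    (by
      have e1 := Dins_eV i (⟨0, by omega⟩ : Fin r) (-1)
      simp only at e1
      rw [e1, neg_one_smul, vv_zero hr])
  refine this.congr (fun z => ?_) (fun z => ?_)
  · funext m
    rw [sbar_zero hr]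
    unfold Dins
    by_cases h : (m : ℕ) = 0
    · rw [if_pos h, if_neg (by omega), if_pos h, if_neg (by omega), if_pos h]; ring
    · rw [if_neg h, if_neg (by omega), if_neg h, if_neg (by omega), if_neg h]
  · rw [at1, hp, tw_zero hr]
    have h2 := theta_Dins2 hr P hΘ i z (r - 1) (by omega)
    simp only [Nat.sub_self] at h2
    rw [h2]
    simp [kj, uj]

include hr hΘ in
theorem tri5 (i : Fin r) {A : Module.End F (QA F r)} {co : E r → Fˣ}
    (h0 : Tri A (Dins i 0 1) co) : ∀ n : ℕ, n ≤ i →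
    Tri (seqOp (fun m => TG P Θ (m + 1) - kap r P (m + 1) 0 • 1) n * A) (Dins i n 1)
      (fun z => P.k ^ (∑ m ∈ Finset.range n, eta (cd r z (m + 1) - cd r z (i + 1))) * co z)
  | 0, h => by
    refine Tri.congr (A := seqOp (fun m => TG P Θ (m + 1) - kap r P (m + 1) 0 • 1) 0 * A) ?_
      (fun z => rfl) (fun z => ?_) (co := co)
    · simpa [seqOp] using h0
    · simp
  | n + 1, h => by
    have hi := i.2
    have ih := tri5 i h0 n (by omega)
    have hrm : rm i n = n := by unfold rm; rw [if_pos (by omega)]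
    have := ih.step' hr P hΘ (Dins_lin _ _ _) ⟨n, by omega⟩ ⟨n + 1, by omega⟩ rfl
      (β := fun z => z ⟨n, by omega⟩ - z i)
      (w := eV r ⟨n, by omega⟩ - eV r i)
      (Or.inl ⟨⟨n, by omega⟩, i, Fin.lt_def.2 (show n < (i : ℕ) by omega), fun _ => rfl, rfl⟩)
      (by
        intro z
        simp only
        rw [pj_Dins hr _ _ (by omega), hrm, one_mul, cd_fin z i _ rfl,
          cd_fin z ⟨n, by omega⟩ _ rfl]; ring)
      (by
        have e1 := Dins_eV i (⟨n, by omega⟩ : Fin r) 1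
        have e2 := Dins_eV2 i n 1 ⟨n + 1, by omega⟩ (by simp) ⟨n, by omega⟩ (by simp [hrm])
        simp only at e1
        rw [Dins_sub, e1, e2, one_smul, vv_mid (r := r) ⟨n, by omega⟩ ⟨n + 1, by omega⟩ rfl, neg_sub])
    rw [seqOp, mul_assoc]
    refine this.congr (fun z => Dins_swap hr i n (by omega) 1 z) (fun z => ?_)
    rw [← mul_assoc, ← zpow_add, Finset.sum_range_succ, cd_fin z i _ rfl,
          cd_fin z ⟨n, by omega⟩ _ rfl]
    congr 2; ring

theorem YG_seq (i : Fin r) : YG P Θ (i + 1) =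
    seqOp (fun m => TG P Θ (m + 1) - kap r P (m + 1) 0 • 1) i * (TG P Θ 0 *
      (seqOp (fun m => TG P Θ (r - 1 - m)) (r - 1) * (TG P Θ r *
        seqOp (fun m => TG P Θ (i + m + 1)) (r - 1 - i)))) := by
  have hi := i.2
  have e1 : ((List.range (r - 1)).reverse.map (fun m => TG P Θ (r - 1 - m))) =
      (List.range (r - 1)).map (fun m => TG P Θ (m + 1)) := by
    apply List.ext_getElem
    · simp
    · intro n h1 h2
      simp at h1 h2 ⊢
      congr 1; omega
  have e2 : ((List.range (r - 1 - i)).reverse.map (fun m => TG P Θ (i + m + 1))) =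
      (List.range (r - (i + 1))).map (fun m => TG P Θ (r - 1 - m)) := by
    apply List.ext_getElem
    · simp; omega
    · intro n h1 h2
      simp at h1 h2 ⊢
      congr 1; omega
  rw [seqOp_prod, seqOp_prod, seqOp_prod, e1, e2]
  simp [YG, Ylist, List.map_reverse, Function.comp_def, mul_assoc]

theorem sum_split (g : ℕ → ℤ) (i : ℕ) (hi : i < r) (f1 f2 : ℕ → ℤ) :
    ∑ j : Fin r, (if i < (j : ℕ) then f1 j else 0) = ∑ m ∈ Finset.range (r - 1 - i), f1 (i + m + 1) ∧
    ∑ j : Fin r, (if (j : ℕ) < i then f2 j else 0) = ∑ m ∈ Finset.range i, f2 m ∧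
    ∑ m ∈ Finset.range (r - 1), g (rm i (r - 1 - 1 - m)) =
      ∑ m ∈ Finset.range i, g m + ∑ m ∈ Finset.range (r - 1 - i), g (i + m + 1) := by
  have er : r = (i + 1) + (r - 1 - i) := by omega
  have er' : r - 1 = i + (r - 1 - i) := by omega
  refine ⟨?_, ?_, ?_⟩
  · rw [Fin.sum_univ_eq_sum_range (fun n => if i < n then f1 n else 0)]
    conv_lhs => rw [er]
    rw [Finset.sum_range_add, Finset.sum_eq_zero, zero_add]
    · apply Finset.sum_congr rfl
      intro m _
      rw [if_pos (by omega)]; congr 1; omega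
    · intro m hm
      have := Finset.mem_range.1 hm
      rw [if_neg (by omega)]
  · rw [Fin.sum_univ_eq_sum_range (fun n => if n < i then f2 n else 0)]
    conv_lhs => rw [show r = i + (r - i) by omega]
    rw [Finset.sum_range_add]
    have : ∑ x ∈ Finset.range (r - i), (if i + x < i then f2 (i + x) else 0) = 0 := by
      apply Finset.sum_eq_zero; intro m _; rw [if_neg (by omega)]
    rw [this, add_zero]
    apply Finset.sum_congr rfl
    intro m hm
    rw [if_pos (Finset.mem_range.1 hm)]
  · rw [Finset.sum_range_reflect (fun m => g (rm i m))]
    conv_lhs => rw [er']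
    rw [Finset.sum_range_add]
    congr 1
    · apply Finset.sum_congr rfl
      intro m hm
      rw [rm, if_pos (Finset.mem_range.1 hm)]
    · apply Finset.sum_congr rfl
      intro m hm
      rw [rm, if_neg (by omega)]

include hr hΘ in
theorem YG_tri (i : Fin r) : Tri (YG P Θ (i + 1)) (fun z => z)
    (fun z => (sfrak F r P.k0 P.u0 P.k P.kr P.ur z i * Θ z i)⁻¹) := by
  have hi := i.2
  have t1 := tri1 hr P hΘ i (r - 1 - i) (by omega)
  rw [show (i : ℕ) + (r - 1 - i) = r - 1 by omega] at t1
  have t3 := tri3 hr P hΘ i (tri2 hr P hΘ i t1) (r - 1) (by omega)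
  rw [Nat.sub_self] at t3
  have t5 := tri5 hr P hΘ i (tri4 hr P hΘ i t3) i le_rfl
  rw [YG_seq]
  refine t5.congr (fun z => Dins_self i.2 z) (fun z => ?_)
  have hnO : nO r z i = ∑ m ∈ Finset.range (r - 1 - i), eta (cd r z (i + 1) - cd r z (i + m + 1 + 1)) +
      ∑ m ∈ Finset.range (r - 1), eta (cd r z (i + 1) + cd r z (rm i (r - 1 - 1 - m) + 1)) -
      ∑ m ∈ Finset.range i, eta (cd r z (m + 1) - cd r z (i + 1)) := by
    obtain ⟨s1, s2, s3⟩ := sum_split (r := r) (fun n => eta (cd r z (i + 1) + cd r z (n + 1))) i hi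
      (fun n => eta (cd r z (i + 1) - cd r z (n + 1)) + eta (cd r z (i + 1) + cd r z (n + 1)))
      (fun n => eta (cd r z (n + 1) + cd r z (i + 1)) - eta (cd r z (n + 1) - cd r z (i + 1)))
    rw [s3]
    have e : nO r z i = (∑ m ∈ Finset.range (r - 1 - ↑i),
      (eta (cd r z (↑i + 1) - cd r z (↑i + m + 1 + 1)) + eta (cd r z (↑i + 1) + cd r z (↑i + m + 1 + 1)))) +
      ∑ m ∈ Finset.range ↑i, (eta (cd r z (m + 1) + cd r z (↑i + 1)) - eta (cd r z (m + 1) - cd r z (↑i + 1))) := by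
      unfold nO
      refine congrArg₂ (· + ·) (Eq.trans ?_ s1) (Eq.trans ?_ s2)
      · apply Finset.sum_congr rfl
        intro j _
        rw [cd_fin z i _ rfl, cd_fin z j _ rfl]; rfl
      · apply Finset.sum_congr rfl
        intro j _
        rw [cd_fin z i _ rfl, cd_fin z j _ rfl]; rfl
    rw [e]
    simp only [Finset.sum_add_distrib, Finset.sum_sub_distrib]
    have : ∀ m, eta (cd r z (m + 1) + cd r z (i + 1)) = eta (cd r z (i + 1) + cd r z (m + 1)) := by
      intro m; rw [add_comm]
    simp only [this]
    ring
  unfold sfrak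
  rw [hnO, zpow_sub, zpow_add, zpow_neg, zpow_neg, zpow_neg, zpow_neg, zpow_neg, zpow_neg,
    mul_zpow, mul_zpow]
  generalize (∑ m ∈ Finset.range (r - 1), eta (cd r z (↑i + 1) + cd r z (rm (↑i) (r - 1 - 1 - m) + 1))) = a1
  generalize (∑ m ∈ Finset.range (r - 1 - ↑i), eta (cd r z (↑i + 1) - cd r z (↑i + m + 1 + 1))) = a2
  generalize (∑ m ∈ Finset.range ↑i, eta (cd r z (m + 1) - cd r z (↑i + 1))) = a3
  generalize Θ z i = th
  generalize etaE (2 * z i) = a4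
  generalize etaO (2 * z i) = a5
  refine Units.ext ?_
  simp only [Units.val_mul, Units.val_inv_eq_inv_val, Units.val_zpow_eq_zpow_val, Units.val_div_eq_div_val]
  field_simp

end ytri


section spec
set_option linter.unusedSectionVars false
set_option linter.unusedSimpArgs false
set_option linter.unusedVariables false
variable {F} {r}

/-- summand of `nO` -/
def Gs (c : E r) (m j : Fin r) : ℤ :=
  eta (c m + c j) + if m < j then eta (c m - c j) else - eta (c j - c m)

theorem nO_eq (c : E r) (m : Fin r) : nO r c m = ∑ j : Fin r, if j = m then 0 else Gs c m j := by
  unfold nO Gs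
  rw [← Finset.sum_add_distrib]
  apply Finset.sum_congr rfl
  intro j _
  rcases lt_trichotomy m j with h | h | h
  · rw [if_pos h, if_neg h.not_gt, if_neg h.ne', if_pos h]; ring
  · subst h; simp
  · rw [if_neg h.not_gt, if_pos h, if_neg h.ne, if_neg h.not_gt, add_comm (c j)]; ring

theorem nO_step (c c' : E r) (σ : Equiv.Perm (Fin r)) (s : ℤ) (m : Fin r)
    (h : ∀ j, j ≠ m → Gs c' m j = s * Gs c (σ m) (σ j)) : nO r c' m = s * nO r c (σ m) := by
  rw [nO_eq, nO_eq, ← Equiv.sum_comp σ (fun j => if j = σ m then 0 else Gs c (σ m) j), Finset.mul_sum]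
  apply Finset.sum_congr rfl
  intro j _
  by_cases hj : j = m
  · subst hj; simp
  · rw [if_neg hj, if_neg (fun e => hj (σ.injective e)), h j hj]

theorem eta_one_sub (p : ℝ) : eta (1 - p) = - eta p := by
  by_cases h : ∃ n : ℤ, p = n
  · obtain ⟨n, rfl⟩ := h
    have e : (1 - (n : ℝ)) = ((1 - n : ℤ) : ℝ) := by push_cast; rfl
    rw [e, eta_int, eta_int]
    split_ifs <;> omega
  · have h1 : ∀ n : ℤ, p ≠ n := fun n e => h ⟨n, e⟩
    have h2 : ∀ n : ℤ, 1 - p ≠ n := fun n e => h ⟨1 - n, by push_cast; linarith⟩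
    rw [(nonint_facts h1).2.2.1, (nonint_facts h2).2.2.1]; rfl

theorem eta_two_sub {p : ℝ} (hp : p < 1) : etaE (2 - p) = - etaE p ∧ etaO (2 - p) = - etaO p := by
  by_cases h : ∃ n : ℤ, p = n
  · obtain ⟨n, rfl⟩ := h
    have hn : n < 1 := by exact_mod_cast hp
    have e : (2 - (n : ℝ)) = ((2 - n : ℤ) : ℝ) := by push_cast; rfl
    have e2 : Even (2 - n) ↔ Even n := by
      constructor
      · rintro ⟨m, h⟩; exact ⟨1 - m, by omega⟩
      · rintro ⟨m, h⟩; exact ⟨1 - m, by omega⟩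
    rw [e, etaE_int, etaE_int, etaO_int, etaO_int]
    simp only [e2]
    constructor <;> split_ifs <;> omega
  · have h1 : ∀ n : ℤ, p ≠ n := fun n e => h ⟨n, e⟩
    have h2 : ∀ n : ℤ, 2 - p ≠ n := fun n e => h ⟨2 - n, by push_cast; linarith⟩
    rw [(nonint_facts h1).1, (nonint_facts h2).1, (nonint_facts h1).2.1, (nonint_facts h2).2.1]
    exact ⟨rfl, rfl⟩

theorem SData.det {j : ℕ} (D : SData r j) (m p : Fin r) (s : ℤ) (hs : s = 1 ∨ s = -1)
    (h : ∀ y : E r, sbar j y m = s * y p) : D.π m = p ∧ D.sg m = s := by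
  have h1 := h (eV r p)
  rw [D.h5, eV_apply, eV_apply, if_pos rfl] at h1
  have h2 := D.h2 m
  by_cases e : D.π m = p
  · rw [if_pos e] at h1
    exact ⟨e, by exact_mod_cast (by linarith : (D.sg m : ℝ) = s)⟩
  · rw [if_neg e] at h1
    rcases hs with rfl | rfl <;> norm_num at h1

theorem sfrak_of (k0 u0 k kr ur : Fˣ) (y y' : E r) (m p : Fin r) (s : ℤ)
    (h1 : etaE (2 * y' m) = s * etaE (2 * y p)) (h2 : etaO (2 * y' m) = s * etaO (2 * y p))
    (h3 : nO r y' m = s * nO r y p) :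
    sfrak F r k0 u0 k kr ur y' m = (sfrak F r k0 u0 k kr ur y p) ^ s := by
  unfold sfrak
  generalize k0 * kr = a
  generalize u0 * ur = b
  rw [h1, h2, h3, mul_zpow, mul_zpow, ← zpow_mul, ← zpow_mul, ← zpow_mul, mul_comm s, mul_comm s,
    mul_comm s]

theorem sfrak_step (hr : 2 ≤ r) (k0 u0 k kr ur : Fˣ) (j : ℕ) (hj : j ≤ r) :
    ∀ (D : SData r j) (y : E r), 0 < alphaF r j y → ∀ m,
    sfrak F r k0 u0 k kr ur (genF r j y) m = (sfrak F r k0 u0 k kr ur y (D.π m)) ^ D.sg m := by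
  refine jcases hr ?_ ?_ ?_ j hj
  · intro D y hp m
    rw [alphaF_eq, pj_zero hr, if_pos rfl] at hp
    have hg : ∀ m : Fin r, genF r 0 y m = if (m : ℕ) = 0 then 1 - y m else y m := by
      intro m; simp [genF]
    by_cases hm : (m : ℕ) = 0
    · obtain ⟨e1, e2⟩ := D.det m m (-1) (Or.inr rfl) (by
        intro y; rw [sbar_zero hr, if_pos hm]; push_cast; ring)
      have e0 : m = ⟨0, by omega⟩ := Fin.ext hm
      rw [← e0] at hp
      rw [e1, e2]
      have hh := eta_two_sub (p := 2 * y m) (by linarith)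
      refine sfrak_of _ _ _ _ _ _ _ _ _ _ ?_ ?_ ?_
      · rw [hg, if_pos hm, mul_sub, mul_one, hh.1]; ring
      · rw [hg, if_pos hm, mul_sub, mul_one, hh.2]; ring
      · refine nO_step _ _ (Equiv.refl _) (-1) m ?_
        intro i hi
        have hi0 : (i : ℕ) ≠ 0 := fun h => hi (Fin.ext (by omega))
        have hlt : m < i := Fin.lt_def.2 (by omega)
        simp only [Equiv.refl_apply]
        unfold Gs
        rw [if_pos hlt, if_pos hlt, hg, hg, if_pos hm, if_neg hi0,
          show 1 - y m + y i = 1 - (y m - y i) by ring,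
          show 1 - y m - y i = 1 - (y m + y i) by ring, eta_one_sub, eta_one_sub]
        ring
    · obtain ⟨e1, e2⟩ := D.det m m 1 (Or.inl rfl) (by
        intro y; rw [sbar_zero hr, if_neg hm]; push_cast; ring)
      rw [e1, e2]
      refine sfrak_of _ _ _ _ _ _ _ _ _ _ ?_ ?_ ?_
      · rw [hg, if_neg hm]; ring
      · rw [hg, if_neg hm]; ring
      · refine nO_step _ _ (Equiv.refl _) 1 m ?_
        intro i hi
        simp only [Equiv.refl_apply]
        by_cases hi0 : (i : ℕ) = 0
        · have hlt : ¬ m < i := by rw [Fin.lt_def]; omega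
          unfold Gs
          rw [if_neg hlt, if_neg hlt, hg, hg, if_neg hm, if_pos hi0,
            show y m + (1 - y i) = 1 - (y i - y m) by ring,
            show 1 - y i - y m = 1 - (y m + y i) by ring, eta_one_sub, eta_one_sub]
          ring
        · unfold Gs
          rw [hg, hg, if_neg hm, if_neg hi0]; ring
  · intro D y hp m
    rw [alphaF_eq, pj_last hr, if_neg (by omega), add_zero] at hp
    have hg : ∀ m : Fin r, genF r r y m = if (m : ℕ) + 1 = r then - y m else y m := by
      intro m; rw [genF_sbar hr _ le_rfl, if_neg (by omega), add_zero, sbar_last hr]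
    by_cases hm : (m : ℕ) + 1 = r
    · obtain ⟨e1, e2⟩ := D.det m m (-1) (Or.inr rfl) (by
        intro y; rw [sbar_last hr, if_pos hm]; push_cast; ring)
      have e0 : m = ⟨r - 1, by omega⟩ := Fin.ext (by simp; omega)
      rw [← e0] at hp
      rw [e1, e2]
      have hh := eta_neg (p := 2 * y m) hp.ne'
      refine sfrak_of _ _ _ _ _ _ _ _ _ _ ?_ ?_ ?_
      · rw [hg, if_pos hm, mul_neg, hh.1]; ring
      · rw [hg, if_pos hm, mul_neg, hh.2.1]; ring
      · refine nO_step _ _ (Equiv.refl _) (-1) m ?_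
        intro i hi
        have hi0 : ¬ (i : ℕ) + 1 = r := fun h => hi (Fin.ext (by omega))
        have hlt : ¬ m < i := by rw [Fin.lt_def]; omega
        simp only [Equiv.refl_apply]
        unfold Gs
        rw [if_neg hlt, if_neg hlt, hg, hg, if_pos hm, if_neg hi0,
          show - y m + y i = y i - y m by ring,
          show y i - - y m = y m + y i by ring]
        ring
    · obtain ⟨e1, e2⟩ := D.det m m 1 (Or.inl rfl) (by
        intro y; rw [sbar_last hr, if_neg hm]; push_cast; ring)
      rw [e1, e2]
      refine sfrak_of _ _ _ _ _ _ _ _ _ _ ?_ ?_ ?_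
      · rw [hg, if_neg hm]; ring
      · rw [hg, if_neg hm]; ring
      · refine nO_step _ _ (Equiv.refl _) 1 m ?_
        intro i hi
        simp only [Equiv.refl_apply]
        by_cases hi0 : (i : ℕ) + 1 = r
        · have hlt : m < i := by rw [Fin.lt_def]; omega
          unfold Gs
          rw [if_pos hlt, if_pos hlt, hg, hg, if_neg hm, if_pos hi0,
            show y m + (- y i) = y m - y i by ring,
            show y m - - y i = y m + y i by ring]
          ring
        · unfold Gs
          rw [hg, hg, if_neg hm, if_neg hi0]; ring
  · intro a b hab D y hp m
    rw [alphaF_eq, pj_mid a b hab, if_neg (by omega), add_zero] at hp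
    have hg := genF_mid hr a b hab y
    obtain ⟨e1, e2⟩ := D.det m (Equiv.swap a b m) 1 (Or.inl rfl) (by
      intro y; rw [sbar_mid a b hab]; push_cast; ring)
    rw [e1, e2]
    refine sfrak_of _ _ _ _ _ _ _ _ _ _ ?_ ?_ ?_
    · rw [hg]; ring
    · rw [hg]; ring
    · refine nO_step _ _ (Equiv.swap a b) 1 m ?_
      intro i hi
      have hab' : a ≠ b := by intro h; rw [h] at hab; omega
      have hE := (eta_neg hp.ne').2.2
      rw [neg_sub] at hE
      unfold Gs
      rw [hg, hg]
      by_cases hma : m = a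
      · subst hma
        rw [Equiv.swap_apply_left]
        by_cases hib : i = b
        · subst hib
          rw [Equiv.swap_apply_right, if_pos (Fin.lt_def.2 (by omega)),
            if_neg (by rw [Fin.lt_def]; omega), hE]; ring
        · rw [Equiv.swap_apply_of_ne_of_ne hi hib]
          have h1 : (i : ℕ) ≠ m := fun h => hi (Fin.ext h)
          have h2 : (i : ℕ) ≠ b := fun h => hib (Fin.ext h)
          have : m < i ↔ b < i := by rw [Fin.lt_def, Fin.lt_def]; omega
          simp only [this]; ring
      · by_cases hmb : m = b
        · subst hmb
          rw [Equiv.swap_apply_right]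
          by_cases hia : i = a
          · subst hia
            rw [Equiv.swap_apply_left, if_neg (by rw [Fin.lt_def]; omega),
              if_pos (Fin.lt_def.2 (by omega)), hE]; ring
          · rw [Equiv.swap_apply_of_ne_of_ne hia hi]
            have h1 : (i : ℕ) ≠ a := fun h => hia (Fin.ext h)
            have h2 : (i : ℕ) ≠ m := fun h => hi (Fin.ext h)
            have : m < i ↔ a < i := by rw [Fin.lt_def, Fin.lt_def]; omega
            simp only [this]; ring
        · rw [Equiv.swap_apply_of_ne_of_ne hma hmb]
          have h1 : (m : ℕ) ≠ a := fun h => hma (Fin.ext h)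
          have h2 : (m : ℕ) ≠ b := fun h => hmb (Fin.ext h)
          have : m < i ↔ m < Equiv.swap a b i := by
            by_cases hia : i = a
            · subst hia; rw [Equiv.swap_apply_left, Fin.lt_def, Fin.lt_def]; omega
            · by_cases hib : i = b
              · subst hib; rw [Equiv.swap_apply_right, Fin.lt_def, Fin.lt_def]; omega
              · rw [Equiv.swap_apply_of_ne_of_ne hia hib]
          simp only [this]; ring

theorem eta_base {x : ℝ} (h0 : 0 ≤ x) (h1 : x ≤ 1) :
    etaE x = -(chiE x : ℤ) ∧ etaO x = (chiO x : ℤ) := by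
  by_cases h : ∃ n : ℤ, x = n
  · obtain ⟨n, rfl⟩ := h
    have a0 : 0 ≤ n := by exact_mod_cast h0
    have a1 : n ≤ 1 := by exact_mod_cast h1
    rw [etaE_int, etaO_int, chiE_int, chiO_int]
    interval_cases n <;> simp
  · have hh := nonint_facts (fun n e => h ⟨n, e⟩)
    rw [hh.1, hh.2.1, hh.2.2.2.1, hh.2.2.2.2]; simp

theorem spec_eq (hr : 2 ≤ r) {O : Set (E r)} (hO : IsOrbit r O) (qh k0 u0 k kr ur : Fˣ)
    (t : Fin r → Fˣ) : ∀ y ∈ O, theta qh (fun m => sOtor F r k0 u0 k kr ur O m * t m) y =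
      fun m => sfrak F r k0 u0 k kr ur y m * theta qh t y m := by
  refine orbit_induction hr hO (P := fun y =>
    theta qh (fun m => sOtor F r k0 u0 k kr ur O m * t m) y =
      fun m => sfrak F r k0 u0 k kr ur y m * theta qh t y m) ?_ ?_
  · rw [theta_cpt hr hO, theta_cpt hr hO]
    funext m
    congr 1
    have hc := (cpt_mem hr hO).2.2 m
    have hh := eta_base (x := 2 * cpt r O m) (by linarith [hc.1]) (by linarith [hc.2])
    unfold sOtor sfrak
    rw [hh.1, hh.2]
  · intro y hy j hj hp ih
    obtain ⟨D⟩ := exists_SData hr j hj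
    rw [theta_step hr hO _ _ hy hj hp, theta_step hr hO _ _ hy hj hp, ih]
    funext m
    rw [tact_apply D, tact_apply D, sfrak_step hr _ _ _ _ _ j hj D y hp, mul_left_comm, ← mul_zpow]

theorem gammaO_eq (hr : 2 ≤ r) {O : Set (E r)} (hO : IsOrbit r O) (P : Prm F)
    (t : Fin r → Fˣ) {y : E r} (hy : y ∈ O) (i : Fin r) :
    gammaO F r P.qh P.k0 P.u0 P.k P.kr P.ur O t (i + 1) y =
      (sfrak F r P.k0 P.u0 P.k P.kr P.ur y i * Theta P.qh O t y i)⁻¹ := by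
  have := spec_eq hr hO P.qh P.k0 P.u0 P.k P.kr P.ur t y hy
  unfold gammaO
  rw [tcU_fin _ i _ rfl, Theta, if_pos hy]
  unfold theta at this ⊢
  rw [this]

end spec


section asm
set_option linter.unusedSectionVars false
set_option linter.unusedSimpArgs false
set_option linter.unusedVariables false
variable {F} {r}

/-- the coefficient functional -/
def cof (z : E r) : QA F r →ₗ[F] F :=
  Finsupp.lapply z ∘ₗ (AddMonoidAlgebra.coeffLinearEquiv F).toLinearMap

theorem cof_X (z w : E r) : cof z (X F r w) = if w = z then 1 else 0 := by
  unfold cof X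
  simp [Finsupp.single_apply]

/-- span of a set of monomials -/
def SpX (F : Type*) [Field F] {r : ℕ} (B : E r → Prop) : Submodule F (QA F r) :=
  Submodule.span F {f | ∃ z, B z ∧ f = X F r z}

theorem SpX_mono {B C : E r → Prop} (h : ∀ z, B z → C z) : SpX F B ≤ SpX F C := by
  apply Submodule.span_mono
  rintro _ ⟨z, hz, rfl⟩; exact ⟨z, h z hz, rfl⟩

theorem X_mem {B : E r → Prop} {z : E r} (h : B z) : X F r z ∈ SpX F B :=
  Submodule.subset_span ⟨z, h, rfl⟩

theorem SpX_le {B : E r → Prop} {N : Submodule F (QA F r)} (h : ∀ z, B z → X F r z ∈ N) :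
    SpX F B ≤ N := by
  apply Submodule.span_le.2
  rintro _ ⟨z, hz, rfl⟩; exact h z hz

theorem cof_zero {B : E r → Prop} {f : QA F r} (hf : f ∈ SpX F B) {z : E r} (hz : ¬ B z) :
    cof z f = 0 := by
  have : SpX F B ≤ LinearMap.ker (cof z) := by
    apply SpX_le
    intro w hw
    rw [LinearMap.mem_ker, cof_X, if_neg]
    rintro rfl; exact hz hw
  exact this hf

theorem mem_SpX {B : E r → Prop} {f : QA F r} (h : ∀ z, ¬ B z → cof z f = 0) : f ∈ SpX F B := by
  obtain ⟨c, rfl⟩ := Finsupp.mem_span_range_iff_exists_finsupp.1 (X_span f)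
  have hc : ∀ z, cof z (c.sum fun i a => a • X F r i) = c z := by
    intro z
    rw [Finsupp.sum, map_sum]
    simp only [map_smul, cof_X, smul_eq_mul, mul_ite, mul_one, mul_zero]
    rw [Finset.sum_ite_eq' c.support z]
    split_ifs with hz
    · rfl
    · exact (Finsupp.notMem_support_iff.1 hz).symm
  apply Submodule.sum_mem
  intro z hz
  apply Submodule.smul_mem
  apply X_mem
  by_contra hB
  have := h z hB
  rw [hc] at this
  exact (Finsupp.mem_support_iff.1 hz) this

variable (hr : 2 ≤ r) {O : Set (E r)} (hO : IsOrbit r O)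
  {A : Fin r → Module.End F (QA F r)} {γ : Fin r → E r → F}
  (hT : ∀ i z, A i (X F r z) - γ i z • X F r z ∈ SpX F (fun z' => Rt z' z))
  (hC : ∀ i j, Commute (A i) (A j))
  (hI : ∀ y ∈ O, ∀ y' ∈ O, (∀ i, γ i y = γ i y') → y = y')

include hT in
theorem A_S (i : Fin r) (y : E r) {f : QA F r} (hf : f ∈ SpX F (fun z => Rt z y)) :
    A i f ∈ SpX F (fun z => Rt z y) := by
  have : SpX F (fun z => Rt z y) ≤ (SpX F (fun z => Rt z y)).comap (A i) := by
    apply SpX_le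
    intro z hz
    rw [Submodule.mem_comap]
    have h1 := hT i z
    have h2 : SpX F (fun z' => Rt z' z) ≤ SpX F (fun z => Rt z y) :=
      SpX_mono (fun w hw => Relation.TransGen.trans hw hz)
    have := Submodule.add_mem _ (h2 h1) (Submodule.smul_mem _ (γ i z) (X_mem (F := F) (B := fun z => Rt z y) hz))
    simpa using this
  exact this hf

include hr hO hT hC hI in
theorem exists_Q {y : E r} (hy : y ∈ O) (s : Finset (E r)) :
    (∀ x ∈ s, Rt x y) → (∀ x ∈ s, ∀ z, Rt z x → z ∈ s) →
    ∃ Q : Module.End F (QA F r), (∀ i, Commute Q (A i)) ∧ (∀ z ∈ s, Q (X F r z) = 0) ∧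
      (Q (X F r y) - X F r y ∈ SpX F (fun z => Rt z y)) ∧
      ∀ f ∈ SpX F (fun z => Rt z y), Q f ∈ SpX F (fun z => Rt z y) := by
  induction s using Finset.induction_on_max_value (fun z => (gW r z).length) with
  | empty => exact fun _ _ => ⟨1, fun i => Commute.one_left _, by simp, by simp, fun f hf => hf⟩
  | insert a s has hmax ih =>
    intro h1 h2
    obtain ⟨Q, q1, q2, q3, q4⟩ := ih (fun x hx => h1 x (Finset.mem_insert_of_mem hx)) (by
      intro x hx z hz
      have := h2 x (Finset.mem_insert_of_mem hx) z hz
      rcases Finset.mem_insert.1 this with rfl | h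
      · exfalso
        have hxO := (Rt_facts hr hO hy (h1 x (Finset.mem_insert_of_mem hx))).1
        have := (Rt_facts hr hO hxO hz).2.1
        have := hmax x hx
        omega
      · exact h)
    have hay := h1 a (Finset.mem_insert_self _ _)
    obtain ⟨haO, hal, -⟩ := Rt_facts hr hO hy hay
    have hne : ∃ i, γ i y ≠ γ i a := by
      by_contra hcon
      push Not at hcon
      have := hI y hy a haO hcon
      rw [this] at hal; omega
    obtain ⟨i, hi⟩ := hne
    have hd : γ i y - γ i a ≠ 0 := sub_ne_zero.2 hi
    refine ⟨Q * ((γ i y - γ i a)⁻¹ • (A i - γ i a • 1)), ?_, ?_, ?_, ?_⟩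
    · intro j
      apply Commute.mul_left (q1 j)
      apply Commute.smul_left
      exact (hC i j).sub_left ((Commute.one_left _).smul_left _)
    · have hcomm : Commute Q ((γ i y - γ i a)⁻¹ • (A i - γ i a • 1)) := by
        apply Commute.smul_right
        exact (q1 i).sub_right ((Commute.one_right _).smul_right _)
      intro z hz
      rcases Finset.mem_insert.1 hz with rfl | hz
      · have hle : SpX F (fun z' => Rt z' z) ≤ LinearMap.ker Q := by
          apply SpX_le
          intro w hw
          rw [LinearMap.mem_ker]
          apply q2
          rcases Finset.mem_insert.1 (h2 z (Finset.mem_insert_self _ _) w hw) with rfl | h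
          · exact absurd (Rt_facts hr hO haO hw).2.1 (lt_irrefl _)
          · exact h
        have := hle (hT i z)
        rw [LinearMap.mem_ker] at this
        simp only [Module.End.mul_apply, LinearMap.smul_apply, LinearMap.sub_apply,
          Module.End.one_apply, map_smul]
        rw [this, smul_zero]
      · rw [hcomm.eq, Module.End.mul_apply, q2 z hz, map_zero]
    · simp only [Module.End.mul_apply, LinearMap.smul_apply, LinearMap.sub_apply,
          Module.End.one_apply, map_smul]
      have e : Q (A i (X F r y) - γ i a • X F r y) =
          Q (A i (X F r y) - γ i y • X F r y) + (γ i y - γ i a) • Q (X F r y) := by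
        rw [← map_smul, ← map_add]; congr 1; module
      rw [e, smul_add, smul_smul, inv_mul_cancel₀ hd, one_smul, add_sub_assoc]
      exact Submodule.add_mem _ (Submodule.smul_mem _ _ (q4 _ (hT i y))) q3
    · intro f hf
      simp only [Module.End.mul_apply, LinearMap.smul_apply, LinearMap.sub_apply,
          Module.End.one_apply, map_smul]
      apply Submodule.smul_mem
      apply q4
      exact Submodule.sub_mem _ (A_S hT i y hf) (Submodule.smul_mem _ _ hf)

include hr hO hT hC hI in
theorem exists_E {y : E r} (hy : y ∈ O) :
    ∃ Ey : QA F r, Ey - X F r y ∈ SpX F (fun z => Rt z y) ∧ ∀ i, A i Ey = γ i y • Ey := by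
  have hfin := Rt_finite hr hO hy
  obtain ⟨Q, q1, q2, q3, q4⟩ := exists_Q hr hO hT hC hI hy hfin.toFinset
    (fun x hx => by simpa using hx)
    (fun x hx z hz => by
      have hx' : Rt x y := by simpa using hx
      have : Rt z y := Relation.TransGen.trans hz hx'
      simpa using this)
  refine ⟨Q (X F r y), q3, fun i => ?_⟩
  have hle : SpX F (fun z' => Rt z' y) ≤ LinearMap.ker Q := by
    apply SpX_le
    intro w hw
    exact q2 w (by simpa using hw)
  have := hle (hT i y)
  rw [LinearMap.mem_ker, map_sub, map_smul, sub_eq_zero] at this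
  rw [← this, ← Module.End.mul_apply, ← Module.End.mul_apply, (q1 i).eq]

/-- low span -/
def Low (F : Type*) [Field F] {r : ℕ} (O : Set (E r)) (n : ℕ) : Submodule F (QA F r) :=
  SpX F (fun z => z ∈ O ∧ (gW r z).length < n)

include hr hO hT in
theorem A_low (i : Fin r) (n : ℕ) {f : QA F r} (hf : f ∈ Low F O n) : A i f ∈ Low F O n := by
  have : Low F O n ≤ (Low F O n).comap (A i) := by
    apply SpX_le
    rintro z ⟨hz, hl⟩
    rw [Submodule.mem_comap]
    have h2 : SpX F (fun z' => Rt z' z) ≤ Low F O n :=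
      SpX_mono (fun w hw => by
        obtain ⟨a, b, -⟩ := Rt_facts hr hO hz hw
        exact ⟨a, by omega⟩)
    have := Submodule.add_mem _ (h2 (hT i z)) (Submodule.smul_mem (Low F O n) (γ i z)
      (X_mem (F := F) (B := fun z => z ∈ O ∧ (gW r z).length < n) ⟨hz, hl⟩))
    simpa using this
  exact this hf

include hr hO hT in
theorem cof_A (i : Fin r) {z : E r} {f : QA F r} (hf : f ∈ Low F O ((gW r z).length + 1)) :
    cof z (A i f) = γ i z * cof z f := by
  have : Low F O ((gW r z).length + 1) ≤
      LinearMap.ker ((cof z ∘ₗ A i) - γ i z • (cof z : QA F r →ₗ[F] F)) := by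
    apply SpX_le
    rintro w ⟨hw, hl⟩
    rw [LinearMap.mem_ker, LinearMap.sub_apply, LinearMap.smul_apply, LinearMap.comp_apply]
    have h1 := cof_zero (hT i w) (z := z) (by
      intro h
      have := (Rt_facts hr hO hw h).2.1
      omega)
    rw [map_sub, map_smul, sub_eq_zero] at h1
    rw [h1, cof_X]
    by_cases e : w = z
    · subst e; simp
    · simp [e]
  have := this hf
  rw [LinearMap.mem_ker, LinearMap.sub_apply, LinearMap.smul_apply, LinearMap.comp_apply,
    sub_eq_zero] at this
  exact this

include hr hO hT hI in
theorem low_zero {y : E r} (hy : y ∈ O) {f : QA F r} (he : ∀ i, A i f = γ i y • f) :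
    ∀ n : ℕ, n ≤ (gW r y).length → f ∈ Low F O n → f = 0 := by
  intro n
  induction n with
  | zero =>
    intro _ hf
    have h : Low F O 0 ≤ (⊥ : Submodule F (QA F r)) := SpX_le (by rintro z ⟨-, h⟩; omega)
    exact (Submodule.mem_bot F).1 (h hf)
  | succ n ih =>
    intro hn hf
    apply ih (by omega)
    apply mem_SpX
    intro z hz
    by_cases hB : z ∈ O ∧ (gW r z).length < n + 1
    · have hl : (gW r z).length = n := by
        by_contra h
        exact hz ⟨hB.1, by omega⟩
      by_contra h0
      have : y = z := by
        apply hI y hy z hB.1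
        intro i
        have h1 := cof_A hr hO hT i (z := z) (by rw [hl]; exact hf)
        rw [he i, map_smul, smul_eq_mul] at h1
        exact mul_right_cancel₀ h0 h1
      rw [this] at hn; omega
    · exact cof_zero hf hB

include hr hO hT hI in
theorem unique_E {y : E r} (hy : y ∈ O) {f g : QA F r}
    (hf : f - X F r y ∈ Low F O (gW r y).length) (hg : g - X F r y ∈ Low F O (gW r y).length)
    (hfe : ∀ i, ∃ c : F, A i f = c • f) (hge : ∀ i, A i g = γ i y • g) : f = g := by
  have hfe' : ∀ i, A i f = γ i y • f := by
    intro i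
    obtain ⟨c, hc⟩ := hfe i
    have h1 : f ∈ Low F O ((gW r y).length + 1) := by
      have : Low F O (gW r y).length ≤ Low F O ((gW r y).length + 1) :=
        SpX_mono (fun z hz => ⟨hz.1, by have := hz.2; omega⟩)
      have := Submodule.add_mem _ (this hf) (X_mem (F := F)
        (B := fun z => z ∈ O ∧ (gW r z).length < (gW r y).length + 1) ⟨hy, by omega⟩)
      simpa using this
    have h2 := cof_A hr hO hT i h1
    have h3 : cof y f = 1 := by
      have := cof_zero hf (z := y) (by rintro ⟨-, h⟩; omega)
      rw [map_sub, cof_X, if_pos rfl, sub_eq_zero] at this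
      exact this
    rw [hc, map_smul, h3, smul_eq_mul, mul_one, mul_one] at h2
    rw [hc, h2]
  have := low_zero hr hO hT hI hy (f := f - g) (fun i => by
    rw [map_sub, hfe', hge, smul_sub]) _ le_rfl (by
    have := Submodule.sub_mem _ hf hg
    simpa using this)
  exact sub_eq_zero.1 this

end asm

section fin
set_option linter.unusedSectionVars false
set_option linter.unusedVariables false
variable {F} {r}

theorem final (hr : 2 ≤ r)
    (qh k0 u0 k kr ur : Fˣ) (O : Set (E r)) (hO : IsOrbit r O)
    (t : Fin r → Fˣ) (ht : t ∈ TOset F r qh O)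
    (hinj : ∀ y ∈ O, ∀ y' ∈ O,
      (∀ i : ℕ, 1 ≤ i → i ≤ r →
        gammaO F r qh k0 u0 k kr ur O t i y = gammaO F r qh k0 u0 k kr ur O t i y') →
      y = y') :
    ∀ y ∈ O, ∃ Ey : QA F r,
      (Ey ∈ FO F r O ∧ Ey - X F r y ∈ ltSpan F r y ∧
        ∀ i : ℕ, 1 ≤ i → i ≤ r → ∃ c : F,
          Yop F r qh (k0 : F) (u0 : F) (k : F) (kr : F) (ur : F) t i Ey = c • Ey) ∧
      (∀ E' : QA F r,
        (E' ∈ FO F r O ∧ E' - X F r y ∈ ltSpan F r y ∧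
          ∀ i : ℕ, 1 ≤ i → i ≤ r → ∃ c : F,
            Yop F r qh (k0 : F) (u0 : F) (k : F) (kr : F) (ur : F) t i E' = c • E') →
        E' = Ey) ∧
      (∀ i : ℕ, 1 ≤ i → i ≤ r →
        Yop F r qh (k0 : F) (u0 : F) (k : F) (kr : F) (ur : F) t i Ey
          = ((gammaO F r qh k0 u0 k kr ur O t i y : Fˣ) : F) • Ey) := by
  intro y hy
  have hΘ := goodTheta hr (qh := qh) hO ht
  set P : Prm F := ⟨qh, k0, u0, k, kr, ur⟩ with hP
  have hΘ' : GoodTheta P.qh (Theta P.qh O t) := hΘ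
  set A : Fin r → Module.End F (QA F r) := fun i => YG P (Theta P.qh O t) (i + 1) with hA
  set γ : Fin r → E r → F := fun i z =>
    (((sfrak F r P.k0 P.u0 P.k P.kr P.ur z i * Theta P.qh O t z i)⁻¹ : Fˣ) : F) with hγ
  have hγO : ∀ z ∈ O, ∀ i : Fin r,
      ((gammaO F r qh k0 u0 k kr ur O t (i + 1) z : Fˣ) : F) = γ i z := by
    intro z hz i
    rw [hγ]
    exact congrArg _ (gammaO_eq hr hO P t hz i)
  have hT : ∀ i z, A i (X F r z) - γ i z • X F r z ∈ SpX F (fun z' => Rt z' z) :=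
    fun i z => YG_tri hr P hΘ' i z
  have hC : ∀ i j, Commute (A i) (A j) := fun i j =>
    YG_comm hr P hΘ' (Nat.le_add_left 1 _) i.2 (Nat.le_add_left 1 _) j.2
  have hI : ∀ y ∈ O, ∀ y' ∈ O, (∀ i, γ i y = γ i y') → y = y' := by
    intro y hy y' hy' h
    apply hinj y hy y' hy'
    intro i h1 h2
    have := h ⟨i - 1, by omega⟩
    rw [← hγO y hy, ← hγO y' hy'] at this
    have e : ((⟨i - 1, by omega⟩ : Fin r) : ℕ) + 1 = i := by simp; omega
    rw [e] at this
    exact Units.ext this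
  have hlow : ltSpan F r y ≤ Low F O (gW r y).length :=
    SpX_mono (fun z hz => qlt_facts hr hO hy hz)
  have hY : ∀ f ∈ FO F r O, ∀ i : Fin r,
      Yop F r qh (k0 : F) (u0 : F) (k : F) (kr : F) (ur : F) t (i + 1) f = A i f :=
    fun f hf i => (Yop_eq hr P hO t i.2 hf).1
  obtain ⟨Ey, hE1, hE2⟩ := exists_E hr hO hT hC hI hy
  have hElt : Ey - X F r y ∈ ltSpan F r y :=
    SpX_mono (fun z hz => (Rt_facts hr hO hy hz).2.2) hE1
  have hFOlt : Ey ∈ FO F r O := by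
    have h1 : SpX F (fun z => Rt z y) ≤ FO F r O :=
      SpX_le (fun z hz => X_FO (Rt_facts hr hO hy hz).1)
    have := Submodule.add_mem _ (h1 hE1) (X_FO (F := F) hy)
    simpa using this
  have hEig : ∀ i : ℕ, 1 ≤ i → i ≤ r →
        Yop F r qh (k0 : F) (u0 : F) (k : F) (kr : F) (ur : F) t i Ey
          = ((gammaO F r qh k0 u0 k kr ur O t i y : Fˣ) : F) • Ey := by
    intro i h1 h2
    obtain ⟨m, rfl⟩ : ∃ m, i = m + 1 := ⟨i - 1, by omega⟩
    have e1 := hY Ey hFOlt ⟨m, by omega⟩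
    have e2 := hγO y hy ⟨m, by omega⟩
    simp only at e1 e2
    rw [e1, e2, hE2]
  refine ⟨Ey, ⟨hFOlt, hElt, fun i h1 h2 => ⟨_, hEig i h1 h2⟩⟩, ?_, hEig⟩
  rintro E' ⟨h1, h2, h3⟩
  refine unique_E hr hO hT hI hy (hlow h2) (hlow hElt) (fun i => ?_) hE2
  obtain ⟨c, hc⟩ := h3 (i + 1) (Nat.le_add_left 1 _) i.2
  exact ⟨c, by rw [← hc, hY E' h1 i]⟩

end fin


/-- Existence and uniqueness of the quasi-polynomial extensions
`E_y^𝒪` of the nonsymmetric Koornwinder polynomials, for parameters such that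
`y ↦ (γ₁^𝒪(y), …, γ_r^𝒪(y))` is injective on `𝒪`. -/
theorem statement8 (F : Type*) [Field F] [CharZero F] (r : ℕ) (hr : 2 ≤ r)
    (qh k0 u0 k kr ur : Fˣ) (O : Set (E r)) (hO : IsOrbit r O)
    (t : Fin r → Fˣ) (ht : t ∈ TOset F r qh O)
    (hinj : ∀ y ∈ O, ∀ y' ∈ O,
      (∀ i : ℕ, 1 ≤ i → i ≤ r →
        gammaO F r qh k0 u0 k kr ur O t i y = gammaO F r qh k0 u0 k kr ur O t i y') →
      y = y') :
    ∀ y ∈ O, ∃ Ey : QA F r,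
      (Ey ∈ FO F r O ∧ Ey - X F r y ∈ ltSpan F r y ∧
        ∀ i : ℕ, 1 ≤ i → i ≤ r → ∃ c : F,
          Yop F r qh (k0 : F) (u0 : F) (k : F) (kr : F) (ur : F) t i Ey = c • Ey) ∧
      (∀ E' : QA F r,
        (E' ∈ FO F r O ∧ E' - X F r y ∈ ltSpan F r y ∧
          ∀ i : ℕ, 1 ≤ i → i ≤ r → ∃ c : F,
            Yop F r qh (k0 : F) (u0 : F) (k : F) (kr : F) (ur : F) t i E' = c • E') →
        E' = Ey) ∧
      (∀ i : ℕ, 1 ≤ i → i ≤ r →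
        Yop F r qh (k0 : F) (u0 : F) (k : F) (kr : F) (ur : F) t i Ey
          = ((gammaO F r qh k0 u0 k kr ur O t i y : Fˣ) : F) • Ey) := by
  exact final hr qh k0 u0 k kr ur O hO t ht hinj


end QP

end
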